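/- Let k ≥ 2 be an integer and let s be an integer with s ≥ 2^k + 1 and s ≥ 4k² − 4k + 1. Let a₁,…,a_s be nonzero integers, and if k is even assume that the a_i do not all have the same sign. Then the equation a₁x₁^k + ⋯ + a_sx_s^k = 0 has a solution in integers x₁,…,x_s not all zero. -/

import Mathlib

/-- The additive character `x ↦ exp (2πix)` on the reals. -/
noncomputable def unitExp (x : ℝ) : ℂ := Complex.exp (((2 * Real.pi * x : ℝ) : ℂ) * Complex.I)

lemma unitExp_add (x y : ℝ) : unitExp (x + y) = unitExp x * unitExp y := by
  unfold unitExp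
  rw [← Complex.exp_add]
  congr 1
  push_cast
  ring

@[simp] lemma unitExp_zero : unitExp 0 = 1 := by simp [unitExp]

@[simp] lemma norm_unitExp (x : ℝ) : ‖unitExp x‖ = 1 := by
  unfold unitExp
  exact Complex.norm_exp_ofReal_mul_I _

@[simp] lemma unitExp_int (n : ℤ) : unitExp n = 1 := by
  unfold unitExp
  rw [Complex.exp_eq_one_iff]
  exact ⟨n, by push_cast; ring⟩

lemma star_unitExp (x : ℝ) : (starRingEnd ℂ) (unitExp x) = unitExp (-x) := by
  unfold unitExp
  rw [← Complex.exp_conj]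
  congr 1
  rw [map_mul, Complex.conj_ofReal, Complex.conj_I]
  push_cast
  ring

lemma unitExp_add_int (x : ℝ) (n : ℤ) : unitExp (x + n) = unitExp x := by
  rw [unitExp_add]; simp

lemma unitExp_sum {ι : Type*} (s : Finset ι) (f : ι → ℝ) :
    unitExp (∑ i ∈ s, f i) = ∏ i ∈ s, unitExp (f i) := by
  classical
  induction s using Finset.induction_on with
  | empty => simp
  | insert a s ha ih => rw [Finset.sum_insert ha, Finset.prod_insert ha, unitExp_add, ih]

lemma unitExp_nat_mul (n : ℕ) (x : ℝ) : unitExp (n * x) = unitExp x ^ n := by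
  unfold unitExp
  rw [← Complex.exp_nat_mul]
  congr 1
  push_cast
  ring

@[fun_prop] lemma continuous_unitExp : Continuous unitExp := by
  unfold unitExp
  fun_prop

lemma norm_unitExp_sub_one (x : ℝ) : ‖unitExp x - 1‖ = 2 * |Real.sin (Real.pi * x)| := by
  unfold unitExp
  rw [mul_comm, Complex.norm_exp_I_mul_ofReal_sub_one]
  rw [show 2 * Real.pi * x / 2 = Real.pi * x by ring]
  simp

lemma norm_unitExp_sub_one_le (x : ℝ) : ‖unitExp x - 1‖ ≤ 2 * Real.pi * |x| := by
  rw [norm_unitExp_sub_one]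
  have := Real.abs_sin_le_abs (x := Real.pi * x)
  rw [abs_mul, abs_of_pos Real.pi_pos] at this
  linarith

lemma norm_unitExp_sub_le (x y : ℝ) : ‖unitExp x - unitExp y‖ ≤ 2 * Real.pi * |x - y| := by
  have : unitExp x - unitExp y = unitExp y * (unitExp (x - y) - 1) := by
    rw [mul_sub, ← unitExp_add]; simp
  rw [this, norm_mul, norm_unitExp, one_mul]
  exact norm_unitExp_sub_one_le _

lemma le_norm_unitExp_sub_one {x : ℝ} (hx : |x| ≤ 1 / 2) : 4 * |x| ≤ ‖unitExp x - 1‖ := by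
  rw [norm_unitExp_sub_one]
  have hp := Real.pi_pos
  have h := Real.mul_abs_le_abs_sin (x := Real.pi * x) (by
    rw [abs_mul, abs_of_pos hp]; nlinarith)
  rw [abs_mul, abs_of_pos hp, ← mul_assoc, div_mul_cancel₀ _ hp.ne'] at h
  linarith

/-- The distance from a real number to the nearest integer. -/
noncomputable def distInt (x : ℝ) : ℝ := |x - round x|

lemma distInt_nonneg (x : ℝ) : 0 ≤ distInt x := abs_nonneg _

lemma distInt_le (x : ℝ) (n : ℤ) : distInt x ≤ |x - n| := round_le x n

lemma le_norm_unitExp_sub_one_distInt (x : ℝ) : 4 * distInt x ≤ ‖unitExp x - 1‖ := by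
  have h := le_norm_unitExp_sub_one (abs_sub_round x)
  have : unitExp (x - round x) = unitExp x := by
    have := unitExp_add_int (x - round x) (round x)
    rw [← this]; simp
  rwa [this] at h

lemma distInt_neg (x : ℝ) : distInt (-x) = distInt x := by
  apply le_antisymm
  · refine (distInt_le _ (-round x)).trans_eq ?_
    rw [distInt, ← abs_neg]; congr 1; push_cast; ring
  · refine (distInt_le _ (-round (-x))).trans_eq ?_
    rw [distInt, ← abs_neg]; congr 1; push_cast; ring

lemma unitExp_geom (θ c : ℝ) (A : ℤ) (n : ℕ) :
    (unitExp θ - 1) * ∑ x ∈ Finset.range n, unitExp (θ * (A + x : ℤ) + c) =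
      unitExp (θ * (A + n : ℤ) + c) - unitExp (θ * A + c) := by
  induction n with
  | zero => simp
  | succ n ih =>
    rw [Finset.sum_range_succ, mul_add, ih, sub_mul, ← unitExp_add]
    have : θ + (θ * ((A + n : ℤ) : ℝ) + c) = θ * ((A + (n + 1 : ℕ) : ℤ) : ℝ) + c := by
      push_cast; ring
    rw [this]; ring

lemma sum_Icc_int_eq_range {β : Type*} [AddCommMonoid β] (A B : ℤ) (f : ℤ → β) :
    ∑ x ∈ Finset.Icc A B, f x = ∑ x ∈ Finset.range (B + 1 - A).toNat, f (A + x) := by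
  symm
  refine Finset.sum_bij (fun x _ => A + (x : ℤ)) ?_ ?_ ?_ ?_
  · intro a ha
    simp only [Finset.mem_range, Finset.mem_Icc] at *
    omega
  · intro a _ b _ h
    simpa using h
  · intro b hb
    simp only [Finset.mem_Icc] at hb
    refine ⟨(b - A).toNat, ?_, ?_⟩
    · simp only [Finset.mem_range]; omega
    · omega
  · intro a _; rfl

lemma norm_sum_unitExp_linear_le (θ c : ℝ) (A B : ℤ) :
    2 * distInt θ * ‖∑ x ∈ Finset.Icc A B, unitExp (θ * x + c)‖ ≤ 1 := by
  rw [sum_Icc_int_eq_range]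
  have h := unitExp_geom θ c A (B + 1 - A).toNat
  have h2 := congrArg norm h
  rw [norm_mul] at h2
  have h3 := norm_sub_le (unitExp (θ * (A + (B + 1 - A).toNat : ℤ) + c)) (unitExp (θ * A + c))
  rw [norm_unitExp, norm_unitExp, ← h2] at h3
  have h4 := mul_le_mul_of_nonneg_right (le_norm_unitExp_sub_one_distInt θ)
    (norm_nonneg (∑ x ∈ Finset.range (B + 1 - A).toNat, unitExp (θ * (A + x : ℤ) + c)))
  linarith

open MeasureTheory in
lemma integral_unitExp_int_mul (n : ℤ) :
    ∫ α in (0 : ℝ)..1, unitExp (α * n) = if n = 0 then 1 else 0 := by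
  split_ifs with h
  · simp [h]
  · have hc : (2 * Real.pi * n * Complex.I : ℂ) ≠ 0 := by
      have : (n : ℂ) ≠ 0 := by exact_mod_cast h
      simp [this, Real.pi_ne_zero]
    have h1 := integral_exp_mul_complex (a := 0) (b := 1) hc
    have h2 : ∀ α : ℝ, unitExp (α * n) = Complex.exp (2 * Real.pi * n * Complex.I * α) := by
      intro α
      unfold unitExp
      congr 1
      push_cast
      ring
    simp_rw [h2, h1]
    have h3 : Complex.exp (2 * Real.pi * n * Complex.I * (1 : ℝ)) = 1 := by
      rw [Complex.exp_eq_one_iff]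
      exact ⟨n, by push_cast; ring⟩
    rw [h3]
    simp

/-- A discrete first-derivative test for exponential sums: the successive differences of the phase
increase and stay in `(0, 1/2]`. -/
lemma norm_sum_unitExp_le_of_monotone_diff (θ : ℕ → ℝ) (N M : ℕ) (hNM : N ≤ M)
    (hpos : 0 < θ (N + 1) - θ N)
    (hmono : ∀ n, N ≤ n → n < M → θ (n + 1) - θ n ≤ θ (n + 2) - θ (n + 1))
    (hhalf : θ (M + 1) - θ M ≤ 1 / 2) :
    ‖∑ n ∈ Finset.Ico N (M + 1), unitExp (θ n)‖ ≤ 1 / (θ (N + 1) - θ N) := by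
  set d : ℕ → ℝ := fun n => θ (n + 1) - θ n with hd
  set c : ℕ → ℂ := fun n => (unitExp (d n) - 1)⁻¹ with hc
  have hmono' : ∀ m, N ≤ m → m ≤ M → d N ≤ d m := by
    intro m hm
    induction m, hm using Nat.le_induction with
    | base => intro _; exact le_rfl
    | succ m hm ih => intro h; exact (ih (by omega)).trans (hmono m hm (by omega))
  have hmonoM : ∀ m, N ≤ m → m ≤ M → d m ≤ 1 / 2 := by
    intro m hm hmM
    have : ∀ r, m ≤ r → r ≤ M → d m ≤ d r := by
      intro r hr
      induction r, hr using Nat.le_induction with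
      | base => intro _; exact le_rfl
      | succ r hr ih => intro h; exact (ih (by omega)).trans (hmono r (by omega) (by omega))
    exact (this M hmM le_rfl).trans hhalf
  have hlow : ∀ m, N ≤ m → m ≤ M → 4 * d m ≤ ‖unitExp (d m) - 1‖ := by
    intro m hm hmM
    have h0 : 0 < d m := hpos.trans_le (hmono' m hm hmM)
    have := le_norm_unitExp_sub_one (x := d m) (by rw [abs_of_pos h0]; exact hmonoM m hm hmM)
    rwa [abs_of_pos h0] at this
  have hne : ∀ m, N ≤ m → m ≤ M → unitExp (d m) - 1 ≠ 0 := by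
    intro m hm hmM h
    have h0 : 0 < d m := hpos.trans_le (hmono' m hm hmM)
    have := hlow m hm hmM
    rw [h, norm_zero] at this
    linarith
  have hcn : ∀ m, N ≤ m → m ≤ M → ‖c m‖ ≤ 1 / (4 * d m) := by
    intro m hm hmM
    have h0 : 0 < d m := hpos.trans_le (hmono' m hm hmM)
    rw [hc]
    simp only [norm_inv]
    rw [← one_div]
    exact one_div_le_one_div_of_le (by linarith) (hlow m hm hmM)
  have hstep : ∀ m, N ≤ m → m ≤ M → unitExp (θ (m + 1)) = unitExp (d m) * unitExp (θ m) := by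
    intro m _ _
    rw [← unitExp_add]; congr 1; simp only [hd]; ring
  have hcdiff : ∀ m, N ≤ m → m < M →
      ‖c m - c (m + 1)‖ ≤ Real.pi / 8 * (1 / d m - 1 / d (m + 1)) := by
    intro m hm hmM
    have h0 : 0 < d m := hpos.trans_le (hmono' m hm hmM.le)
    have h1 : 0 < d (m + 1) := hpos.trans_le (hmono' (m + 1) (by omega) hmM)
    have e : c m - c (m + 1) = (unitExp (d (m + 1)) - unitExp (d m)) * (c m * c (m + 1)) := by
      have a1 := hne m hm hmM.le
      have a2 := hne (m + 1) (by omega) hmM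
      simp only [hc]
      field_simp
      ring
    rw [e, norm_mul, norm_mul]
    have b1 := norm_unitExp_sub_le (d (m + 1)) (d m)
    rw [abs_of_nonneg (by have := hmono m hm hmM; simp only [hd]; linarith)] at b1
    have b2 : ‖c m‖ * ‖c (m + 1)‖ ≤ 1 / (4 * d m) * (1 / (4 * d (m + 1))) :=
      mul_le_mul (hcn m hm hmM.le) (hcn (m + 1) (by omega) hmM) (norm_nonneg _) (by positivity)
    refine (mul_le_mul b1 b2 (by positivity) ((norm_nonneg _).trans b1)).trans_eq ?_
    field_simp
    ring
  have key : ∀ m, N ≤ m → m ≤ M →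
      ‖∑ n ∈ Finset.Ico N (m + 1), unitExp (θ n) - c m * unitExp (θ (m + 1))‖ ≤
        1 / (4 * d N) + Real.pi / 8 * (1 / d N - 1 / d m) := by
    intro m hm
    induction m, hm using Nat.le_induction with
    | base =>
      intro h
      have e : ∑ n ∈ Finset.Ico N (N + 1), unitExp (θ n) - c N * unitExp (θ (N + 1)) =
          - (c N * unitExp (θ N)) := by
        rw [hstep N le_rfl h]
        have a1 := hne N le_rfl h
        simp only [hc, Nat.Ico_succ_singleton, Finset.sum_singleton]
        field_simp
        ring
      rw [e, norm_neg, norm_mul, norm_unitExp, mul_one]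
      have := hcn N le_rfl h
      simpa using this
    | succ m hm ih =>
      intro h
      have ih' := ih (by omega)
      have e : ∑ n ∈ Finset.Ico N (m + 1 + 1), unitExp (θ n) - c (m + 1) * unitExp (θ (m + 1 + 1)) =
          (∑ n ∈ Finset.Ico N (m + 1), unitExp (θ n) - c m * unitExp (θ (m + 1)))
          + (c m - c (m + 1)) * unitExp (θ (m + 1)) := by
        rw [Finset.sum_Ico_succ_top (by omega), hstep (m + 1) (by omega) h]
        have a1 := hne (m + 1) (by omega) h
        have : c (m + 1) * (unitExp (d (m + 1)) - 1) = 1 := inv_mul_cancel₀ a1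
        linear_combination (-unitExp (θ (m + 1))) * this
      rw [e]
      refine (norm_add_le _ _).trans ?_
      rw [norm_mul, norm_unitExp, mul_one]
      have := hcdiff m hm (by omega)
      linarith
  have h1 := key M hNM le_rfl
  have h2 := hcn M hNM le_rfl
  have h0 : 0 < d N := hpos
  have h3 : 0 < d M := hpos.trans_le (hmono' M hNM le_rfl)
  have h4 : ‖∑ n ∈ Finset.Ico N (M + 1), unitExp (θ n)‖ ≤
      ‖∑ n ∈ Finset.Ico N (M + 1), unitExp (θ n) - c M * unitExp (θ (M + 1))‖ + ‖c M‖ := by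
    have := norm_add_le (∑ n ∈ Finset.Ico N (M + 1), unitExp (θ n) - c M * unitExp (θ (M + 1)))
      (c M * unitExp (θ (M + 1)))
    rwa [sub_add_cancel, norm_mul, norm_unitExp, mul_one] at this
  have h5 : 1 / d M ≤ 1 / d N := one_div_le_one_div_of_le h0 (hmono' M hNM le_rfl)
  have h6 : 1 / (4 * d M) = 1 / 4 * (1 / d M) := by field_simp
  have h7 : 1 / (4 * d N) = 1 / 4 * (1 / d N) := by field_simp
  have h8 : 0 < 1 / d M := by positivity
  have hp := Real.pi_lt_four
  have hp' := Real.pi_pos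
  rw [h6] at h2
  rw [h7] at h1
  show _ ≤ 1 / d N
  nlinarith

lemma exists_card_divisors_le (ε : ℝ) (hε : 0 < ε) :
    ∃ C : ℝ, 1 ≤ C ∧ ∀ n : ℕ, n ≠ 0 → (n.divisors.card : ℝ) ≤ C * (n : ℝ) ^ ε := by
  obtain ⟨B, hB⟩ := exists_nat_gt ((2 : ℝ) ^ (1 / ε))
  have hl : 0 < ε * Real.log 2 := mul_pos hε (Real.log_pos one_lt_two)
  set K : ℝ := 1 + 1 / (ε * Real.log 2) with hK
  have hK1 : 1 ≤ K := by rw [hK]; have : 0 < 1 / (ε * Real.log 2) := by positivity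
                         linarith
  have hsmall : ∀ p v : ℕ, 2 ≤ p → ((v : ℝ) + 1) ≤ K * (((p : ℝ) ^ v) ^ ε) := by
    intro p v hp
    have h2 : (2 : ℝ) ≤ p := by exact_mod_cast hp
    have h3 : 1 + v * (ε * Real.log 2) ≤ ((p : ℝ) ^ v) ^ ε := by
      have h4 : ((2 : ℝ) ^ v) ^ ε ≤ ((p : ℝ) ^ v) ^ ε := by gcongr
      refine le_trans ?_ h4
      rw [← Real.rpow_natCast, ← Real.rpow_mul (by norm_num), Real.rpow_def_of_pos (by norm_num)]
      have := Real.add_one_le_exp (Real.log 2 * (v * ε))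
      linarith
    have h5 : (v : ℝ) + 1 ≤ K * (1 + v * (ε * Real.log 2)) := by
      have e : K * (1 + v * (ε * Real.log 2)) = K + v * (ε * Real.log 2) + v := by
        rw [hK]; field_simp; ring
      rw [e]
      have : 0 ≤ v * (ε * Real.log 2) := by positivity
      linarith
    exact h5.trans (by gcongr)
  have hlarge : ∀ p v : ℕ, B ≤ p → ((v : ℝ) + 1) ≤ ((p : ℝ) ^ v) ^ ε := by
    intro p v hp
    have h2 : (2 : ℝ) ^ (1 / ε) ≤ p := hB.le.trans (by exact_mod_cast hp)
    have h3 : (2 : ℝ) ≤ (p : ℝ) ^ ε := by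
      have := Real.rpow_le_rpow (by positivity) h2 hε.le
      rwa [← Real.rpow_mul (by norm_num), one_div_mul_cancel hε.ne', Real.rpow_one] at this
    have h4 : ((p : ℝ) ^ v) ^ ε = ((p : ℝ) ^ ε) ^ v := by
      rw [← Real.rpow_natCast, ← Real.rpow_natCast, ← Real.rpow_mul (by positivity),
        ← Real.rpow_mul (by positivity), mul_comm]
    rw [h4]
    have h5 : (2 : ℝ) ^ v ≤ ((p : ℝ) ^ ε) ^ v := by gcongr
    have h6 : ((v : ℝ) + 1) ≤ 2 ^ v := by
      have := Nat.lt_two_pow_self (n := v)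
      exact_mod_cast this
    linarith
  refine ⟨K ^ B, one_le_pow₀ hK1, fun n hn => ?_⟩
  rw [Nat.card_divisors hn]
  have hn' : (n : ℝ) ^ ε = ∏ p ∈ n.primeFactors, ((p : ℝ) ^ n.factorization p) ^ ε := by
    rw [Real.finsetProd_rpow _ _ (fun p _ => by positivity)]
    congr 1
    have := Nat.prod_factorization_pow_eq_self hn
    conv_lhs => rw [← this]
    rw [Finsupp.prod, Nat.support_factorization]
    push_cast
    rfl
  rw [hn']
  have hpt : ∀ p ∈ n.primeFactors, ((n.factorization p : ℝ) + 1) ≤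
      (if p < B then K else 1) * ((p : ℝ) ^ n.factorization p) ^ ε := by
    intro p hp
    split_ifs with h
    · exact hsmall p _ (Nat.prime_of_mem_primeFactors hp).two_le
    · rw [one_mul]; exact hlarge p _ (not_lt.mp h)
  push_cast
  refine (Finset.prod_le_prod (fun p _ => by positivity) hpt).trans ?_
  rw [Finset.prod_mul_distrib]
  refine mul_le_mul_of_nonneg_right ?_ (Finset.prod_nonneg fun p _ => by positivity)
  rw [← Finset.prod_filter, Finset.prod_const]
  refine pow_le_pow_right₀ hK1 ?_
  have : (n.primeFactors.filter (· < B)) ⊆ Finset.range B := by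
    intro p hp
    simp only [Finset.mem_filter] at hp
    simpa using hp.2
  simpa using Finset.card_le_card this

open Polynomial in
/-- The forward difference `p(X + h) - p(X)` of a polynomial. -/
noncomputable def polyDiff (h : ℤ) (p : ℤ[X]) : ℤ[X] := taylor h p - p

open Polynomial in
/-- The iterated forward difference of a polynomial along a list of shifts. -/
noncomputable def iterDiff : ℤ[X] → List ℤ → ℤ[X]
  | p, [] => p
  | p, h :: hs => iterDiff (polyDiff h p) hs

section PolynomialDifferences

open Polynomial

lemma polyDiff_eval (h : ℤ) (p : ℤ[X]) (x : ℤ) :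
    (polyDiff h p).eval x = p.eval (x + h) - p.eval x := by
  simp [polyDiff, taylor_eval]

lemma polyDiff_C_mul (h c : ℤ) (p : ℤ[X]) : polyDiff h (C c * p) = C c * polyDiff h p := by
  rw [polyDiff, polyDiff, taylor_mul, taylor_C, mul_sub]

lemma C_dvd_polyDiff (h : ℤ) (p : ℤ[X]) : C h ∣ polyDiff h p := by
  have := Polynomial.sub_dvd_eval_sub (X + C h) X (p.map (C : ℤ →+* ℤ[X]))
  rw [eval_map, eval_map] at this
  have e : polyDiff h p = eval₂ C (X + C h) p - eval₂ C X p := by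
    rw [polyDiff, taylor_apply, comp, eval₂_C_X]
  rw [e]
  simpa using this

lemma C_dvd_iterDiff_of_dvd (c : ℤ) (hs : List ℤ) : ∀ p : ℤ[X], C c ∣ p → C c ∣ iterDiff p hs := by
  induction hs with
  | nil => intro p hp; exact hp
  | cons h hs ih =>
    rintro p ⟨r, rfl⟩
    exact ih _ ⟨polyDiff h r, polyDiff_C_mul h c r⟩

lemma C_dvd_iterDiff {hs : List ℤ} : ∀ p : ℤ[X], ∀ h ∈ hs, C h ∣ iterDiff p hs := by
  induction hs with
  | nil => intro p h hh; simp at hh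
  | cons h hs ih =>
    intro p h' hh'
    rcases List.mem_cons.mp hh' with rfl | hm
    · exact C_dvd_iterDiff_of_dvd h' hs (polyDiff h' p) (C_dvd_polyDiff _ _)
    · exact ih _ _ hm

lemma dvd_iterDiff_eval {hs : List ℤ} (p : ℤ[X]) {h : ℤ} (hh : h ∈ hs) (x : ℤ) :
    h ∣ (iterDiff p hs).eval x := by
  obtain ⟨r, hr⟩ := C_dvd_iterDiff p h hh
  rw [hr]
  simp

lemma polyDiff_degree_coeff (n : ℕ) (h : ℤ) (p : ℤ[X]) (hp : p.natDegree ≤ n + 1) :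
    (polyDiff h p).natDegree ≤ n ∧ (polyDiff h p).coeff n = (n + 1) * h * p.coeff (n + 1) := by
  have hz : ∀ m, n + 1 < m → p.coeff m = 0 := fun m hm =>
    coeff_eq_zero_of_natDegree_lt (by omega)
  have hform : ∀ m, n ≤ m → (taylor h p).coeff m = p.coeff m + (m + 1) * p.coeff (m + 1) * h := by
    intro m hm
    rw [taylor_coeff, eval_eq_sum_range' (n := 2)]
    · rw [Finset.sum_range_succ, Finset.sum_range_one, hasseDeriv_coeff, hasseDeriv_coeff]
      simp only [zero_add, Nat.choose_self, pow_zero, pow_one]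
      rw [show 1 + m = m + 1 by ring, Nat.choose_succ_self_right]
      push_cast
      ring
    · rw [Nat.lt_succ_iff, natDegree_le_iff_coeff_eq_zero]
      intro r hr
      rw [hasseDeriv_coeff, hz (r + m) (by omega), mul_zero]
  constructor
  · rw [natDegree_le_iff_coeff_eq_zero]
    intro m hm
    rw [polyDiff, coeff_sub, hform m hm.le, hz (m + 1) (by omega)]
    ring
  · rw [polyDiff, coeff_sub, hform n le_rfl]
    ring

lemma iterDiff_degree_coeff (hs : List ℤ) : ∀ (n : ℕ) (p : ℤ[X]), p.natDegree ≤ n + hs.length →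
    (iterDiff p hs).natDegree ≤ n ∧ (iterDiff p hs).coeff n =
      ((n + hs.length).descFactorial hs.length : ℕ) * hs.prod * p.coeff (n + hs.length) := by
  induction hs with
  | nil => intro n p hp; exact ⟨hp, by simp [iterDiff]⟩
  | cons h hs ih =>
    intro n p hp
    rw [List.length_cons] at hp ⊢
    obtain ⟨h1, h2⟩ := polyDiff_degree_coeff (n + hs.length) h p hp
    obtain ⟨h3, h4⟩ := ih n (polyDiff h p) h1
    refine ⟨h3, ?_⟩
    show (iterDiff (polyDiff h p) hs).coeff n = _
    rw [h4, h2, List.prod_cons, ← Nat.add_assoc, Nat.succ_descFactorial_succ]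
    push_cast
    ring

end PolynomialDifferences

/-- The left end of the summation interval after differencing. -/
noncomputable def lowerEnd : ℤ → List ℤ → ℤ
  | A, [] => A
  | A, h :: hs => lowerEnd (max A (A - h)) hs

/-- The right end of the summation interval after differencing. -/
noncomputable def upperEnd : ℤ → List ℤ → ℤ
  | B, [] => B
  | B, h :: hs => upperEnd (min B (B - h)) hs

lemma le_lowerEnd (hs : List ℤ) : ∀ A, A ≤ lowerEnd A hs := by
  induction hs with
  | nil => intro A; exact le_rfl
  | cons h hs ih => intro A; exact (le_max_left _ _).trans (ih _)

lemma upperEnd_le (hs : List ℤ) : ∀ B, upperEnd B hs ≤ B := by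
  induction hs with
  | nil => intro A; exact le_rfl
  | cons h hs ih => intro A; exact (ih _).trans (min_le_left _ _)

/-- Lists of length `j` with entries in `(-P, P)`. -/
noncomputable def shiftLists (P : ℕ) : ℕ → Finset (List ℤ)
  | 0 => {[]}
  | j + 1 => (Finset.Ioo (-(P : ℤ)) P ×ˢ shiftLists P j).map
      ⟨fun x => x.1 :: x.2, fun x y h => by
        simp only [List.cons.injEq] at h; exact Prod.ext h.1 h.2⟩

lemma sum_shiftLists_succ {β : Type*} [AddCommMonoid β] (P j : ℕ) (f : List ℤ → β) :
    ∑ hs ∈ shiftLists P (j + 1), f hs =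
      ∑ h ∈ Finset.Ioo (-(P : ℤ)) P, ∑ hs ∈ shiftLists P j, f (h :: hs) := by
  rw [shiftLists, Finset.sum_map, Finset.sum_product]
  rfl

lemma mem_shiftLists {P j : ℕ} {hs : List ℤ} : hs ∈ shiftLists P j ↔
    hs.length = j ∧ ∀ h ∈ hs, h ∈ Finset.Ioo (-(P : ℤ)) P := by
  induction j generalizing hs with
  | zero =>
    simp only [shiftLists, Finset.mem_singleton, List.length_eq_zero_iff]
    constructor
    · rintro rfl; simp
    · exact fun h => h.1
  | succ j ih =>
    cases hs with
    | nil => simp [shiftLists]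
    | cons h hs =>
      simp only [shiftLists, Finset.mem_map, Finset.mem_product, Prod.exists, List.length_cons,
        List.mem_cons, forall_eq_or_imp]
      constructor
      · rintro ⟨a, b, ⟨h1, h2⟩, h3⟩
        obtain ⟨rfl, rfl⟩ := List.cons.inj h3
        obtain ⟨h3, h4⟩ := ih.mp h2
        exact ⟨by simpa using h3, h1, h4⟩
      · rintro ⟨h1, h2, h3⟩
        exact ⟨h, hs, ⟨h2, ih.mpr ⟨by omega, h3⟩⟩, rfl⟩

lemma card_shiftLists_filter_le (P j : ℕ) (S : Finset ℤ) :
    ((shiftLists P j).filter (fun hs => ∀ h ∈ hs, h ∈ S)).card ≤ S.card ^ j := by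
  induction j with
  | zero => simp [shiftLists, Finset.filter_singleton]
  | succ j ih =>
    rw [Finset.card_filter, sum_shiftLists_succ]
    have : ∀ h ∈ Finset.Ioo (-(P : ℤ)) P,
        ∑ hs ∈ shiftLists P j, (if ∀ h' ∈ h :: hs, h' ∈ S then 1 else 0) ≤
        if h ∈ S then S.card ^ j else 0 := by
      intro h _
      split_ifs with hS
      · rw [Finset.card_filter] at ih
        refine le_trans (Finset.sum_le_sum fun hs _ => ?_) ih
        simp [hS]
      · refine (Finset.sum_eq_zero fun hs _ => ?_).le
        simp [hS]
    refine (Finset.sum_le_sum this).trans ?_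
    rw [← Finset.sum_filter, Finset.sum_const, smul_eq_mul, pow_succ, mul_comm]
    refine Nat.mul_le_mul_left _ (Finset.card_le_card ?_)
    intro x hx
    exact (Finset.mem_filter.mp hx).2

lemma card_shiftLists_le (P j : ℕ) : (shiftLists P j).card ≤ (2 * P) ^ j := by
  have h := card_shiftLists_filter_le P j (Finset.Ioo (-(P : ℤ)) P)
  rw [Finset.filter_true_of_mem (fun hs hh => (mem_shiftLists.mp hh).2)] at h
  refine h.trans (Nat.pow_le_pow_left ?_ _)
  rw [Int.card_Ioo]
  omega

lemma card_shiftLists_zero_mem_le (P j : ℕ) (hP : 0 < P) :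
    ((shiftLists P j).filter (fun hs => (0 : ℤ) ∈ hs)).card * (2 * P) ≤ j * (2 * P) ^ j := by
  induction j with
  | zero => simp [shiftLists, Finset.filter_singleton]
  | succ j ih =>
    rw [Finset.card_filter, sum_shiftLists_succ]
    have hc : (Finset.Ioo (-(P : ℤ)) P).card ≤ 2 * P := by rw [Int.card_Ioo]; omega
    have : ∀ h ∈ Finset.Ioo (-(P : ℤ)) P,
        ∑ hs ∈ shiftLists P j, (if (0 : ℤ) ∈ h :: hs then 1 else 0) ≤
        (if h = 0 then (2 * P) ^ j else 0) +
          ((shiftLists P j).filter (fun hs => (0 : ℤ) ∈ hs)).card := by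
      intro h _
      split_ifs with hS
      · refine le_trans (Finset.sum_le_sum (g := fun _ => 1) fun hs _ => ?_) ?_
        · split_ifs <;> simp
        · simp only [Finset.sum_const, smul_eq_mul, mul_one]
          exact (card_shiftLists_le P j).trans (Nat.le_add_right _ _)
      · rw [zero_add, Finset.card_filter]
        refine Finset.sum_le_sum fun hs _ => ?_
        have : (0 : ℤ) ∈ h :: hs ↔ (0 : ℤ) ∈ hs := by
          simp [Ne.symm hS]
        simp [this]
    refine (Nat.mul_le_mul_right _ (Finset.sum_le_sum this)).trans ?_
    rw [Finset.sum_add_distrib, Finset.sum_const, smul_eq_mul, Finset.sum_ite_eq' , if_pos (by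
      simp only [Finset.mem_Ioo]; omega)]
    rw [add_mul, mul_assoc]
    have := Nat.mul_le_mul hc ih
    rw [pow_succ]
    nlinarith

open Polynomial in
/-- The sum of `e(α Δ(x))` over all iterated differences `Δ` of `p` of order `j`. -/
noncomputable def weylSum (P : ℕ) (α : ℝ) (j : ℕ) (A B : ℤ) (p : ℤ[X]) : ℂ :=
  ∑ hs ∈ shiftLists P j, ∑ x ∈ Finset.Icc (lowerEnd A hs) (upperEnd B hs),
    unitExp (α * ((iterDiff p hs).eval x : ℤ))

lemma weylSum_zero (P : ℕ) (α : ℝ) (A B : ℤ) (p : Polynomial ℤ) :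
    weylSum P α 0 A B p = ∑ x ∈ Finset.Icc A B, unitExp (α * (p.eval x : ℤ)) := by
  simp [weylSum, shiftLists, lowerEnd, upperEnd, iterDiff]

lemma weylSum_succ (P : ℕ) (α : ℝ) (j : ℕ) (A B : ℤ) (p : Polynomial ℤ) :
    weylSum P α (j + 1) A B p = ∑ h ∈ Finset.Ioo (-(P : ℤ)) P,
      weylSum P α j (max A (A - h)) (min B (B - h)) (polyDiff h p) := by
  rw [weylSum, sum_shiftLists_succ]
  rfl

lemma weylSum_one (P : ℕ) (α : ℝ) (A B : ℤ) (hAB : B - A < P) (p : Polynomial ℤ) :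
    weylSum P α 1 A B p =
      ((‖∑ x ∈ Finset.Icc A B, unitExp (α * (p.eval x : ℤ))‖ ^ 2 : ℝ) : ℂ) := by
  rw [weylSum_succ]
  simp_rw [weylSum_zero]
  push_cast
  rw [← Complex.mul_conj', map_sum, Finset.sum_mul_sum, ← Finset.sum_product', Finset.sum_sigma']
  refine Finset.sum_bij (fun x _ => (x.2 + x.1, x.2)) ?_ ?_ ?_ ?_
  · rintro ⟨h, x⟩ hx
    simp only [Finset.mem_sigma, Finset.mem_Icc, Finset.mem_Ioo, Finset.mem_product] at *
    omega
  · rintro ⟨h, x⟩ _ ⟨h', x'⟩ _ he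
    simp only [Prod.mk.injEq] at he
    obtain ⟨h1, h2⟩ := he
    obtain rfl : x = x' := h2
    obtain rfl : h = h' := by linarith
    rfl
  · rintro ⟨y, x⟩ hx
    simp only [Finset.mem_Icc, Finset.mem_product] at hx
    refine ⟨⟨y - x, x⟩, ?_, ?_⟩
    · simp only [Finset.mem_sigma, Finset.mem_Icc, Finset.mem_Ioo]
      omega
    · simp
  · rintro ⟨h, x⟩ _
    rw [star_unitExp, ← unitExp_add, polyDiff_eval]
    congr 1
    push_cast
    ring

/-- Weyl differencing. -/
lemma norm_pow_le_weylSum (P : ℕ) (hP : 0 < P) (α : ℝ) (j : ℕ) : ∀ (A B : ℤ) (_ : B - A < P)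
    (p : Polynomial ℤ), ∃ r : ℝ, 0 ≤ r ∧ weylSum P α (j + 1) A B p = r ∧
      ‖∑ x ∈ Finset.Icc A B, unitExp (α * (p.eval x : ℤ))‖ ^ 2 ^ (j + 1) ≤
        (2 * P : ℝ) ^ (2 ^ (j + 1) - (j + 1) - 1) * r := by
  induction j with
  | zero =>
    intro A B hAB p
    refine ⟨_, by positivity, weylSum_one P α A B hAB p, ?_⟩
    rw [show 2 ^ (0 + 1) - (0 + 1) - 1 = 0 by norm_num, pow_zero, one_mul, zero_add, pow_one]
  | succ j ih =>
    intro A B hAB p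
    have hAB' : ∀ h : ℤ, min B (B - h) - max A (A - h) < P := by
      intro h
      have := min_le_left B (B - h)
      have := le_max_left A (A - h)
      linarith
    choose r hr0 hr1 hr2 using fun h : ℤ => ih _ _ (hAB' h) (polyDiff h p)
    refine ⟨∑ h ∈ Finset.Ioo (-(P : ℤ)) P, r h, Finset.sum_nonneg fun h _ => hr0 h, ?_, ?_⟩
    · rw [weylSum_succ]
      push_cast
      exact Finset.sum_congr rfl fun h _ => hr1 h
    · set S : ℤ → ℂ := fun h => ∑ x ∈ Finset.Icc (max A (A - h)) (min B (B - h)),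
        unitExp (α * ((polyDiff h p).eval x : ℤ)) with hS
      have h1 : ‖∑ x ∈ Finset.Icc A B, unitExp (α * (p.eval x : ℤ))‖ ^ 2 ≤
          ∑ h ∈ Finset.Ioo (-(P : ℤ)) P, ‖S h‖ := by
        have e := weylSum_one P α A B hAB p
        rw [weylSum_succ] at e
        simp_rw [weylSum_zero] at e
        have e2 := congrArg norm e
        rw [Complex.norm_real, Real.norm_of_nonneg (by positivity)] at e2
        rw [← e2]
        exact norm_sum_le _ _
      have hpow : 2 ^ (j + 1) = (2 ^ (j + 1) - 1) + 1 :=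
        (Nat.sub_add_cancel Nat.one_le_two_pow).symm
      have h2 := pow_sum_le_card_mul_sum_pow (s := Finset.Ioo (-(P : ℤ)) P)
        (f := fun h => ‖S h‖) (fun h _ => norm_nonneg _) (2 ^ (j + 1) - 1)
      rw [← hpow] at h2
      have hc : ((Finset.Ioo (-(P : ℤ)) P).card : ℝ) ≤ 2 * P := by
        have : (Finset.Ioo (-(P : ℤ)) P).card ≤ 2 * P := by rw [Int.card_Ioo]; omega
        exact_mod_cast this
      calc ‖∑ x ∈ Finset.Icc A B, unitExp (α * (p.eval x : ℤ))‖ ^ 2 ^ (j + 1 + 1)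
          = (‖∑ x ∈ Finset.Icc A B, unitExp (α * (p.eval x : ℤ))‖ ^ 2) ^ 2 ^ (j + 1) := by
            rw [← pow_mul]; congr 1; ring
        _ ≤ (∑ h ∈ Finset.Ioo (-(P : ℤ)) P, ‖S h‖) ^ 2 ^ (j + 1) := by gcongr
        _ ≤ _ := h2
        _ ≤ (2 * P : ℝ) ^ (2 ^ (j + 1) - 1) * ∑ h ∈ Finset.Ioo (-(P : ℤ)) P,
              ((2 * P : ℝ) ^ (2 ^ (j + 1) - (j + 1) - 1) * r h) := by
            refine mul_le_mul (pow_le_pow_left₀ (Nat.cast_nonneg _) hc _)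
              (Finset.sum_le_sum fun h _ => hr2 h)
              (Finset.sum_nonneg fun h _ => by positivity) (by positivity)
        _ = _ := by
            rw [← Finset.mul_sum, ← mul_assoc, ← pow_add]
            congr 2
            have : j + 1 < 2 ^ (j + 1) := Nat.lt_two_pow_self
            have h3 : 2 ^ (j + 1 + 1) = 2 * 2 ^ (j + 1) := by ring
            omega

/-- The exponential sum `∑ e(α x^k)` over `1 ≤ x ≤ P`. -/
noncomputable def powerSum (k P : ℕ) (α : ℝ) : ℂ :=
  ∑ x ∈ Finset.Icc (1 : ℤ) P, unitExp (α * ((x ^ k : ℤ) : ℝ))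

lemma powerSum_eq_eval (k P : ℕ) (α : ℝ) : powerSum k P α =
    ∑ x ∈ Finset.Icc (1 : ℤ) P,
      unitExp (α * (((Polynomial.X ^ k : Polynomial ℤ).eval x : ℤ) : ℝ)) := by
  simp [powerSum]

lemma norm_powerSum_le (k P : ℕ) (α : ℝ) : ‖powerSum k P α‖ ≤ P := by
  refine (norm_sum_le _ _).trans ?_
  simp

@[fun_prop] lemma continuous_powerSum (k P : ℕ) : Continuous (powerSum k P) := by
  unfold powerSum
  fun_prop

lemma powerSum_neg (k P : ℕ) (α : ℝ) : ‖powerSum k P (-α)‖ = ‖powerSum k P α‖ := by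
  have : powerSum k P (-α) = (starRingEnd ℂ) (powerSum k P α) := by
    simp [powerSum, map_sum, star_unitExp]
  rw [this, Complex.norm_conj]

open MeasureTheory in
lemma integral_sum_unitExp {κ : Type*} (T : Finset κ) (w : κ → ℤ) :
    ∫ α in (0 : ℝ)..1, ∑ t ∈ T, unitExp (α * w t) = ((T.filter (fun t => w t = 0)).card : ℂ) := by
  rw [intervalIntegral.integral_finsetSum]
  · simp_rw [integral_unitExp_int_mul]
    rw [Finset.sum_ite]
    simp
  · intro t _
    exact Continuous.intervalIntegrable (by fun_prop) _ _

/-- Index set for the double sum in `weylSum`. -/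
noncomputable def shiftPairs (P j : ℕ) : Finset (Σ _ : List ℤ, ℤ) :=
  (shiftLists P j).sigma fun hs => Finset.Icc (lowerEnd 1 hs) (upperEnd P hs)

lemma weylSum_eq_shiftPairs (P : ℕ) (α : ℝ) (j : ℕ) (p : Polynomial ℤ) :
    weylSum P α j 1 P p =
      ∑ t ∈ shiftPairs P j, unitExp (α * ((iterDiff p t.1).eval t.2 : ℤ)) := by
  rw [weylSum, shiftPairs, Finset.sum_sigma]

lemma card_Icc_ends_le (P : ℕ) (hs : List ℤ) :
    (Finset.Icc (lowerEnd 1 hs) (upperEnd P hs)).card ≤ P := by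
  have h1 := le_lowerEnd hs 1
  have h2 := upperEnd_le hs P
  rw [Int.card_Icc]
  omega

section Counting

open Polynomial

lemma card_eval_eq_le (k : ℕ) (hs : List ℤ) (hlen : hs.length < k) (h0 : (0 : ℤ) ∉ hs) (m : ℤ)
    (I : Finset ℤ) :
    (I.filter fun x => (iterDiff (X ^ k) hs).eval x = m).card ≤ k := by
  classical
  obtain ⟨d, hd⟩ : ∃ d, k = d + 1 + hs.length := ⟨k - hs.length - 1, by omega⟩
  obtain ⟨h1, h2⟩ := iterDiff_degree_coeff hs (d + 1) (X ^ k) (by rw [natDegree_X_pow, hd])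
  set q := iterDiff (X ^ k) hs - C m with hq
  have hne : q ≠ 0 := by
    intro h
    have h3 : q.coeff (d + 1) = 0 := by rw [h]; simp
    rw [hq, coeff_sub, coeff_C_succ, sub_zero, h2, ← hd, coeff_X_pow_self, mul_one] at h3
    rcases mul_eq_zero.mp h3 with h3 | h3
    · have : k.descFactorial hs.length = 0 := by exact_mod_cast h3
      rw [Nat.descFactorial_eq_zero_iff_lt] at this
      omega
    · exact h0 (List.prod_eq_zero_iff.mp h3)
  have hdeg : q.natDegree ≤ d + 1 := by
    refine (natDegree_sub_le _ _).trans ?_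
    simp [h1]
  have hsub : (I.filter fun x => (iterDiff (X ^ k) hs).eval x = m) ⊆ q.roots.toFinset := by
    intro x hx
    rw [Multiset.mem_toFinset, mem_roots hne]
    have := (Finset.mem_filter.mp hx).2
    simp [IsRoot, hq, this]
  calc _ ≤ q.roots.toFinset.card := Finset.card_le_card hsub
    _ ≤ Multiset.card q.roots := Multiset.toFinset_card_le _
    _ ≤ q.natDegree := card_roots' q
    _ ≤ k := by omega

lemma card_shiftPairs_zero_le (k P j : ℕ) (hP : 0 < P) (hj : j < k) :
    ((shiftPairs P j).filter fun t => (iterDiff (X ^ k) t.1).eval t.2 = 0).card ≤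
      (j + k) * (2 * P) ^ j := by
  rw [Finset.card_filter, shiftPairs, Finset.sum_sigma]
  have : ∀ hs ∈ shiftLists P j, ∑ x ∈ Finset.Icc (lowerEnd 1 hs) (upperEnd P hs),
      (if (iterDiff (X ^ k) hs).eval x = 0 then 1 else 0) ≤
      (if (0 : ℤ) ∈ hs then P else 0) + k := by
    intro hs hhs
    rw [← Finset.card_filter]
    split_ifs with h
    · exact (Finset.card_filter_le _ _).trans
        ((card_Icc_ends_le P hs).trans (Nat.le_add_right _ _))
    · rw [zero_add]
      exact card_eval_eq_le k hs (by rw [(mem_shiftLists.mp hhs).1]; exact hj) h 0 _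
  refine (Finset.sum_le_sum this).trans ?_
  rw [Finset.sum_add_distrib, ← Finset.sum_filter, Finset.sum_const, Finset.sum_const,
    smul_eq_mul, smul_eq_mul]
  have h1 := card_shiftLists_zero_mem_le P j hP
  have h2 := Nat.mul_le_mul_right k (card_shiftLists_le P j)
  nlinarith

/-- The integers dividing a nonzero integer. -/
noncomputable def intDivisors (m : ℤ) : Finset ℤ :=
  (m.natAbs.divisors.image fun d : ℕ => (d : ℤ)) ∪ (m.natAbs.divisors.image fun d : ℕ => -(d : ℤ))

lemma card_intDivisors_le (m : ℤ) : (intDivisors m).card ≤ 2 * m.natAbs.divisors.card := by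
  refine (Finset.card_union_le _ _).trans ?_
  rw [two_mul]
  exact add_le_add Finset.card_image_le Finset.card_image_le

lemma mem_intDivisors {m d : ℤ} (hm : m ≠ 0) (h : d ∣ m) : d ∈ intDivisors m := by
  rw [intDivisors, Finset.mem_union, Finset.mem_image, Finset.mem_image]
  have hd : d.natAbs ∈ m.natAbs.divisors := by
    rw [Nat.mem_divisors]
    exact ⟨Int.natAbs_dvd_natAbs.mpr h, by simpa using hm⟩
  rcases Int.natAbs_eq d with h | h
  · exact Or.inl ⟨_, hd, h.symm⟩
  · exact Or.inr ⟨_, hd, h.symm⟩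

lemma card_shiftPairs_eq_le (k P j : ℕ) (hj : j < k) (m : ℤ) (hm : m ≠ 0) :
    ((shiftPairs P j).filter fun t => (iterDiff (X ^ k) t.1).eval t.2 = m).card ≤
      (2 * m.natAbs.divisors.card) ^ j * k := by
  rw [Finset.card_filter, shiftPairs, Finset.sum_sigma]
  have : ∀ hs ∈ shiftLists P j, ∑ x ∈ Finset.Icc (lowerEnd 1 hs) (upperEnd P hs),
      (if (iterDiff (X ^ k) hs).eval x = m then 1 else 0) ≤
      (if ∀ h ∈ hs, h ∈ intDivisors m then k else 0) := by
    intro hs hhs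
    rw [← Finset.card_filter]
    by_cases hex : ∃ x, (iterDiff (X ^ k) hs).eval x = m
    · obtain ⟨x, hx⟩ := hex
      have hdvd : ∀ h ∈ hs, h ∣ m := fun h hh => by
        rw [← hx]; exact dvd_iterDiff_eval _ hh x
      rw [if_pos fun h hh => mem_intDivisors hm (hdvd h hh)]
      refine card_eval_eq_le k hs (by rw [(mem_shiftLists.mp hhs).1]; exact hj) ?_ m _
      intro h
      exact hm (zero_dvd_iff.mp (hdvd 0 h))
    · rw [Finset.filter_false_of_mem fun x _ hx => hex ⟨x, hx⟩]
      simp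
  refine (Finset.sum_le_sum this).trans ?_
  rw [← Finset.sum_filter, Finset.sum_const, smul_eq_mul]
  refine Nat.mul_le_mul_right _ ((card_shiftLists_filter_le P j _).trans ?_)
  exact Nat.pow_le_pow_left (card_intDivisors_le m) _

end Counting

lemma exists_norm_powerSum_pow_eq (k P n : ℕ) : ∃ (s : Finset ((Fin n → ℤ) × (Fin n → ℤ)))
    (v : (Fin n → ℤ) × (Fin n → ℤ) → ℤ), s.card = P ^ (2 * n) ∧
    (∀ i ∈ s, (v i).natAbs ≤ 2 * n * P ^ k) ∧
    ∀ α, ((‖powerSum k P α‖ ^ (2 * n) : ℝ) : ℂ) = ∑ i ∈ s, unitExp (α * v i) := by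
  set F := Fintype.piFinset fun _ : Fin n => Finset.Icc (1 : ℤ) P with hF
  refine ⟨F ×ˢ F, fun i => ∑ r, i.1 r ^ k - ∑ r, i.2 r ^ k, ?_, ?_, ?_⟩
  · rw [Finset.card_product, hF, Fintype.card_piFinset]
    simp only [Int.card_Icc, Finset.prod_const, Finset.card_univ, Fintype.card_fin]
    rw [← pow_add, ← two_mul]
    congr 1
    omega
  · intro i hi
    rw [Finset.mem_product, hF, Fintype.mem_piFinset, Fintype.mem_piFinset] at hi
    have hb : ∀ x : ℤ, x ∈ Finset.Icc (1 : ℤ) P → 0 ≤ x ^ k ∧ x ^ k ≤ (P : ℤ) ^ k := by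
      intro x hx
      rw [Finset.mem_Icc] at hx
      exact ⟨by have : 0 ≤ x := by omega
                positivity, pow_le_pow_left₀ (by omega) hx.2 k⟩
    have hs : ∀ y : Fin n → ℤ, (∀ r, y r ∈ Finset.Icc (1 : ℤ) P) →
        0 ≤ ∑ r, y r ^ k ∧ ∑ r, y r ^ k ≤ n * (P : ℤ) ^ k := by
      intro y hy
      refine ⟨Finset.sum_nonneg fun r _ => (hb _ (hy r)).1, ?_⟩
      refine (Finset.sum_le_sum fun r _ => (hb _ (hy r)).2).trans ?_
      simp
    obtain ⟨a1, a2⟩ := hs _ hi.1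
    obtain ⟨b1, b2⟩ := hs _ hi.2
    zify
    rw [abs_le]
    constructor <;> nlinarith
  · intro α
    have hpow : powerSum k P α ^ n = ∑ x ∈ F, unitExp (α * ((∑ r, x r ^ k : ℤ) : ℝ)) := by
      have e := Finset.prod_univ_sum (fun _ : Fin n => Finset.Icc (1 : ℤ) P)
        (fun _ x => unitExp (α * ((x ^ k : ℤ) : ℝ)))
      rw [Finset.prod_const, Finset.card_univ, Fintype.card_fin] at e
      rw [powerSum, e]
      refine Finset.sum_congr rfl fun x _ => ?_
      rw [← unitExp_sum]
      congr 1
      push_cast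
      rw [Finset.mul_sum]
    rw [pow_mul, ← pow_mul, mul_comm 2 n, pow_mul, ← norm_pow]
    push_cast
    rw [← Complex.mul_conj', hpow, map_sum, Finset.sum_mul_sum, ← Finset.sum_product']
    refine Finset.sum_congr rfl fun i _ => ?_
    rw [star_unitExp, ← unitExp_add]
    congr 1
    push_cast
    ring

open MeasureTheory Polynomial in
lemma integral_powerSum_step (k P j : ℕ) (hP : 0 < P) (hj : j + 1 < k) (D : ℝ)
    (hD : ∀ m : ℕ, m ≠ 0 → m ≤ 2 ^ (j + 1) * P ^ k → (m.divisors.card : ℝ) ≤ D) :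
    ∫ α in (0 : ℝ)..1, ‖powerSum k P α‖ ^ 2 ^ (j + 1 + 1) ≤
      (2 * P : ℝ) ^ (2 ^ (j + 1) - (j + 1) - 1) *
        ((((j + 1) + k : ℕ) * (2 * P : ℝ) ^ (j + 1)) *
            (∫ α in (0 : ℝ)..1, ‖powerSum k P α‖ ^ 2 ^ (j + 1))
          + (P : ℝ) ^ 2 ^ (j + 1) * ((2 * D) ^ (j + 1) * k)) := by
  classical
  obtain ⟨s, v, hcard, hv, hrep⟩ := exists_norm_powerSum_pow_eq k P (2 ^ j)
  have h2 : 2 * 2 ^ j = 2 ^ (j + 1) := by ring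
  rw [h2] at hcard hv hrep
  set K := (2 * P : ℝ) ^ (2 ^ (j + 1) - (j + 1) - 1) with hK
  set w : ((Fin (2 ^ j) → ℤ) × (Fin (2 ^ j) → ℤ)) × (Σ _ : List ℤ, ℤ) → ℤ :=
    fun t => v t.1 + (iterDiff (X ^ k) t.2.1).eval t.2.2 with hw
  set T := s ×ˢ shiftPairs P (j + 1) with hT
  have hcont : Continuous fun α => ∑ t ∈ T, unitExp (α * w t) := by fun_prop
  have hpt : ∀ α, ‖powerSum k P α‖ ^ 2 ^ (j + 1 + 1) ≤
      K * (∑ t ∈ T, unitExp (α * w t)).re := by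
    intro α
    obtain ⟨r, hr0, hr1, hr2⟩ := norm_pow_le_weylSum P hP α j 1 P (by omega) (X ^ k)
    rw [← powerSum_eq_eval] at hr2
    have e : ∑ t ∈ T, unitExp (α * w t) = ((‖powerSum k P α‖ ^ 2 ^ (j + 1) * r : ℝ) : ℂ) := by
      rw [Complex.ofReal_mul, hrep, ← hr1, weylSum_eq_shiftPairs, Finset.sum_mul_sum,
        ← Finset.sum_product']
      refine Finset.sum_congr rfl fun t _ => ?_
      rw [← unitExp_add]
      congr 1
      simp only [hw]
      push_cast
      ring
    rw [e, Complex.ofReal_re, show 2 ^ (j + 1 + 1) = 2 ^ (j + 1) + 2 ^ (j + 1) by ring, pow_add]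
    calc _ ≤ ‖powerSum k P α‖ ^ 2 ^ (j + 1) * (K * r) := by gcongr
      _ = _ := by ring
  have hmean : ∫ α in (0 : ℝ)..1, ‖powerSum k P α‖ ^ 2 ^ (j + 1 + 1) ≤
      K * ((T.filter (fun t => w t = 0)).card : ℝ) := by
    have e1 : ∫ α in (0 : ℝ)..1, K * (∑ t ∈ T, unitExp (α * w t)).re =
        K * ((T.filter (fun t => w t = 0)).card : ℝ) := by
      rw [intervalIntegral.integral_const_mul]
      congr 1
      have := integral_sum_unitExp T w
      have h3 := intervalIntegral.intervalIntegral_re (𝕜 := ℂ) (μ := volume) (a := 0) (b := 1)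
        (f := fun α : ℝ => ∑ t ∈ T, unitExp (α * w t)) (hcont.intervalIntegrable _ _)
      rw [this] at h3
      simpa using h3
    rw [← e1]
    refine intervalIntegral.integral_mono_on zero_le_one ?_ ?_ fun α _ => hpt α
    · exact Continuous.intervalIntegrable (by fun_prop) _ _
    · exact Continuous.intervalIntegrable (by fun_prop) _ _
  have hb0 : ((s.filter fun i => v i = 0).card : ℝ) =
      ∫ α in (0 : ℝ)..1, ‖powerSum k P α‖ ^ 2 ^ (j + 1) := by
    have := integral_sum_unitExp s v
    simp_rw [← hrep] at this
    rw [intervalIntegral.integral_ofReal] at this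
    exact_mod_cast this.symm
  have hcount : ((T.filter (fun t => w t = 0)).card : ℝ) ≤
      (((j + 1) + k : ℕ) * (2 * P : ℝ) ^ (j + 1)) *
          ((s.filter fun i => v i = 0).card : ℝ)
        + (P : ℝ) ^ 2 ^ (j + 1) * ((2 * D) ^ (j + 1) * k) := by
    rw [Finset.card_filter, hT, Finset.sum_product]
    push_cast
    have hfib : ∀ i ∈ s, (∑ t ∈ shiftPairs P (j + 1), (if w (i, t) = 0 then (1 : ℝ) else 0)) ≤
        (if v i = 0 then (((j + 1) + k : ℕ) * (2 * P : ℝ) ^ (j + 1)) else 0)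
          + (2 * D) ^ (j + 1) * k := by
      intro i hi
      have hD0 : 0 ≤ D := by
        refine le_trans (Nat.cast_nonneg _) (hD 1 one_ne_zero ?_)
        exact Nat.mul_pos (by positivity) (by positivity)
      have e : (∑ t ∈ shiftPairs P (j + 1), (if w (i, t) = 0 then (1 : ℝ) else 0)) =
          (((shiftPairs P (j + 1)).filter fun t =>
            (iterDiff (X ^ k) t.1).eval t.2 = -v i).card : ℝ) := by
        rw [Finset.card_filter]
        push_cast
        refine Finset.sum_congr rfl fun t _ => ?_
        have : w (i, t) = 0 ↔ (iterDiff (X ^ k) t.1).eval t.2 = -v i := by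
          simp only [hw]
          constructor <;> intro h <;> linarith
        simp only [this]
      rw [e]
      split_ifs with h
      · rw [h, neg_zero]
        have := card_shiftPairs_zero_le k P (j + 1) hP hj
        have h' : (((shiftPairs P (j + 1)).filter fun t =>
            (iterDiff (X ^ k) t.1).eval t.2 = 0).card : ℝ) ≤
            (((j + 1) + k : ℕ) * (2 * P : ℝ) ^ (j + 1)) := by exact_mod_cast this
        have : 0 ≤ (2 * D) ^ (j + 1) * k := by positivity
        linarith
      · rw [zero_add]
        have := card_shiftPairs_eq_le k P (j + 1) hj (-v i) (by simpa using h)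
        rw [Int.natAbs_neg] at this
        have h' : (((shiftPairs P (j + 1)).filter fun t =>
            (iterDiff (X ^ k) t.1).eval t.2 = -v i).card : ℝ) ≤
            (2 * ((v i).natAbs.divisors.card : ℝ)) ^ (j + 1) * k := by exact_mod_cast this
        refine h'.trans ?_
        have := hD (v i).natAbs (by simpa using h) (hv i hi)
        gcongr
    refine (Finset.sum_le_sum hfib).trans ?_
    rw [Finset.sum_add_distrib, ← Finset.sum_filter, Finset.sum_const, Finset.sum_const,
      nsmul_eq_mul, nsmul_eq_mul, hcard]
    push_cast
    exact le_of_eq (by ring)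
  refine hmean.trans ?_
  rw [← hb0]
  gcongr

open Polynomial in
lemma integral_powerSum_sq_le (k P : ℕ) (hk : 1 < k) (hP : 0 < P) :
    ∫ α in (0 : ℝ)..1, ‖powerSum k P α‖ ^ 2 ≤ (1 + k : ℕ) * (2 * P : ℝ) := by
  have h := integral_sum_unitExp (shiftPairs P 1) (fun t => (iterDiff (X ^ k) t.1).eval t.2)
  simp_rw [← weylSum_eq_shiftPairs] at h
  have h1 : ∀ α, weylSum P α 1 1 P (X ^ k) = ((‖powerSum k P α‖ ^ 2 : ℝ) : ℂ) := by
    intro α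
    rw [weylSum_one P α 1 P (by omega), ← powerSum_eq_eval]
  simp_rw [h1] at h
  rw [intervalIntegral.integral_ofReal] at h
  rw [← Complex.ofReal_natCast, Complex.ofReal_inj] at h
  rw [h]
  have h3 := card_shiftPairs_zero_le k P 1 hP hk
  rw [pow_one] at h3
  exact_mod_cast h3

lemma integral_powerSum_le (k : ℕ) (j : ℕ) (hj : j < k) (hk : 1 < k) (ε : ℝ) (hε : 0 < ε) :
    ∃ C : ℝ, 0 < C ∧ ∀ P : ℕ, 0 < P →
      ∫ α in (0 : ℝ)..1, ‖powerSum k P α‖ ^ 2 ^ (j + 1) ≤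
        C * (P : ℝ) ^ ((2 ^ (j + 1) - (j + 1) : ℕ) + ε) := by
  induction j with
  | zero =>
    refine ⟨(1 + k : ℕ) * 2, by positivity, fun P hP => ?_⟩
    have h := integral_powerSum_sq_le k P hk hP
    rw [zero_add, pow_one]
    refine h.trans ?_
    rw [← mul_assoc]
    have hP1 : (1 : ℝ) ≤ P := by exact_mod_cast hP
    refine mul_le_mul_of_nonneg_left ?_ (by positivity)
    calc (P : ℝ) = (P : ℝ) ^ (1 : ℝ) := (Real.rpow_one _).symm
      _ ≤ _ := Real.rpow_le_rpow_of_exponent_le hP1 (by norm_num; exact hε.le)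
  | succ j ih =>
    obtain ⟨C, hC, ih⟩ := ih (by omega)
    have hk0 : (0 : ℝ) < k := by positivity
    set ε' := ε / (k * (j + 1)) with hε'
    have hε'0 : 0 < ε' := by positivity
    obtain ⟨Cd, hCd, hdiv⟩ := exists_card_divisors_le ε' hε'0
    set C1 : ℝ := Cd * ((2 : ℝ) ^ (j + 1)) ^ ε' with hC1
    have hC1p : 0 < C1 := by positivity
    set e := 2 ^ (j + 1) - (j + 1) - 1 with he
    have hlt : j + 1 < 2 ^ (j + 1) := Nat.lt_two_pow_self
    refine ⟨2 ^ e * ((((j + 1) + k : ℕ) * 2 ^ (j + 1)) * C + (2 * C1) ^ (j + 1) * k),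
      by positivity, fun P hP => ?_⟩
    have hx : (1 : ℝ) ≤ P := by exact_mod_cast hP
    have hx0 : (0 : ℝ) < P := by linarith
    refine (integral_powerSum_step k P j hP hj (C1 * (P : ℝ) ^ (ε / (j + 1))) ?_).trans ?_
    · intro m hm hmle
      refine (hdiv m hm).trans ?_
      rw [hC1, mul_assoc]
      refine mul_le_mul_of_nonneg_left ?_ (by linarith)
      have : (m : ℝ) ≤ (2 : ℝ) ^ (j + 1) * (P : ℝ) ^ k := by exact_mod_cast hmle
      refine (Real.rpow_le_rpow (by positivity) this hε'0.le).trans ?_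
      rw [Real.mul_rpow (by positivity) (by positivity), ← Real.rpow_natCast (P : ℝ) k,
        ← Real.rpow_mul hx0.le]
      refine le_of_eq ?_
      congr 2
      rw [hε']
      field_simp
    · have hI := ih P hP
      set x : ℝ := (P : ℝ) with hxdef
      have hD : (2 * (C1 * x ^ (ε / (j + 1)))) ^ (j + 1) = (2 * C1) ^ (j + 1) * x ^ ε := by
        rw [← mul_assoc, mul_pow, ← Real.rpow_natCast (x ^ (ε / (j + 1))), ← Real.rpow_mul hx0.le]
        congr 2
        push_cast
        field_simp
      rw [hD]
      have hA : x ^ e * x ^ (j + 1) * x ^ (((2 ^ (j + 1) - (j + 1) : ℕ) : ℝ) + ε) =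
          x ^ (((2 ^ (j + 1 + 1) - (j + 1 + 1) : ℕ) : ℝ) + ε) := by
        rw [← Real.rpow_natCast x e, ← Real.rpow_natCast x (j + 1), ← Real.rpow_add hx0,
          ← Real.rpow_add hx0]
        congr 1
        have : e + (j + 1) + (2 ^ (j + 1) - (j + 1)) = 2 ^ (j + 1 + 1) - (j + 1 + 1) := by
          rw [pow_succ 2 (j + 1)]
          omega
        rw [← this]
        push_cast
        ring
      have hB : x ^ e * x ^ 2 ^ (j + 1) * x ^ ε =
          x ^ (((2 ^ (j + 1 + 1) - (j + 1 + 1) : ℕ) : ℝ) + ε) := by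
        rw [← Real.rpow_natCast x e, ← Real.rpow_natCast x (2 ^ (j + 1)), ← Real.rpow_add hx0,
          ← Real.rpow_add hx0]
        congr 1
        have : e + 2 ^ (j + 1) = 2 ^ (j + 1 + 1) - (j + 1 + 1) := by
          rw [pow_succ 2 (j + 1)]
          omega
        rw [← this]
        push_cast
        ring
      calc _ ≤ (2 * x) ^ e * ((((j + 1) + k : ℕ) * (2 * x) ^ (j + 1)) *
            (C * x ^ (((2 ^ (j + 1) - (j + 1) : ℕ) : ℝ) + ε)) +
              x ^ 2 ^ (j + 1) * ((2 * C1) ^ (j + 1) * x ^ ε * k)) := by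
            refine mul_le_mul_of_nonneg_left ?_ (by positivity)
            refine add_le_add_left ?_ _
            exact mul_le_mul_of_nonneg_left hI (by positivity)
        _ = 2 ^ e * ((((j + 1) + k : ℕ) * 2 ^ (j + 1)) * C *
              (x ^ e * x ^ (j + 1) * x ^ (((2 ^ (j + 1) - (j + 1) : ℕ) : ℝ) + ε)) +
              (2 * C1) ^ (j + 1) * k * (x ^ e * x ^ 2 ^ (j + 1) * x ^ ε)) := by
            rw [mul_pow, mul_pow]
            ring
        _ = _ := by
            rw [hA, hB]
            ring

/-- Hua's inequality. -/
theorem hua_inequality (k : ℕ) (hk : 2 ≤ k) (ε : ℝ) (hε : 0 < ε) :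
    ∃ C : ℝ, 0 < C ∧ ∀ P : ℕ, 0 < P →
      ∫ α in (0 : ℝ)..1, ‖powerSum k P α‖ ^ 2 ^ k ≤ C * (P : ℝ) ^ ((2 ^ k : ℝ) - k + ε) := by
  obtain ⟨j, rfl⟩ : ∃ j, k = j + 1 := ⟨k - 1, by omega⟩
  obtain ⟨C, hC, h⟩ := integral_powerSum_le (j + 1) j (by omega) (by omega) ε hε
  refine ⟨C, hC, fun P hP => (h P hP).trans (le_of_eq ?_)⟩
  rw [Nat.cast_sub Nat.lt_two_pow_self.le]
  push_cast
  ring_nf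

/-- The bound `min (P, 1 / (2‖θ‖))` for a linear exponential sum of length at most `P`. -/
noncomputable def linearBound (P θ : ℝ) : ℝ :=
  if distInt θ = 0 then P else min P (1 / (2 * distInt θ))

lemma linearBound_nonneg {P : ℝ} (hP : 0 ≤ P) (θ : ℝ) : 0 ≤ linearBound P θ := by
  unfold linearBound
  split_ifs
  · exact hP
  · exact le_min hP (div_nonneg zero_le_one (mul_nonneg zero_le_two (distInt_nonneg θ)))

lemma linearBound_le (P θ : ℝ) : linearBound P θ ≤ P := by
  unfold linearBound
  split_ifs
  · exact le_rfl
  · exact min_le_left _ _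

lemma distInt_mul_linearBound_le (P θ : ℝ) : 2 * distInt θ * linearBound P θ ≤ 1 := by
  unfold linearBound
  split_ifs with h
  · simp [h]
  · have h1 : 0 < 2 * distInt θ := by
      have := lt_of_le_of_ne (distInt_nonneg θ) (Ne.symm h)
      linarith
    calc _ ≤ 2 * distInt θ * (1 / (2 * distInt θ)) :=
          mul_le_mul_of_nonneg_left (min_le_right _ _) h1.le
      _ = 1 := by field_simp

lemma le_linearBound {P θ r : ℝ} (h1 : r ≤ P) (h2 : 2 * distInt θ * r ≤ 1) :
    r ≤ linearBound P θ := by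
  unfold linearBound
  split_ifs with h
  · exact h1
  · have h3 : 0 < 2 * distInt θ := by
      have := lt_of_le_of_ne (distInt_nonneg θ) (Ne.symm h)
      linarith
    refine le_min h1 ?_
    rw [le_div_iff₀ h3]
    linarith

lemma linearBound_neg (P θ : ℝ) : linearBound P (-θ) = linearBound P θ := by
  unfold linearBound
  rw [distInt_neg]

/-- The bound used for a point whose distance to the integers lies in the `u`-th of the
intervals of length `1 / (2q)`. -/
noncomputable def slotBound (P : ℝ) (q u : ℕ) : ℝ := if u = 0 then P else q / u

lemma slotBound_nonneg {P : ℝ} (hP : 0 ≤ P) (q u : ℕ) : 0 ≤ slotBound P q u := by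
  unfold slotBound
  split_ifs
  · exact hP
  · positivity

lemma sum_slotBound_le (P : ℝ) (hP : 0 ≤ P) (q : ℕ) :
    ∑ u ∈ Finset.range (2 * q), slotBound P q u ≤ P + q * (1 + Real.log (2 * q)) := by
  rcases Nat.eq_zero_or_pos q with rfl | hq
  · simpa using hP
  obtain ⟨n, hn⟩ : ∃ n, 2 * q = n + 1 := ⟨2 * q - 1, by omega⟩
  rw [hn, Finset.sum_range_succ']
  have h1 : ∑ u ∈ Finset.range n, slotBound P q (u + 1) = q * (harmonic n : ℝ) := by
    rw [harmonic]
    push_cast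
    rw [Finset.mul_sum]
    refine Finset.sum_congr rfl fun u _ => ?_
    simp [slotBound, div_eq_mul_inv]
  rw [h1]
  have h2 : (harmonic n : ℝ) ≤ 1 + Real.log n := harmonic_le_one_add_log n
  have h3 : Real.log n ≤ Real.log (2 * q) := by
    have hn1 : 0 < n := by omega
    refine Real.log_le_log (by exact_mod_cast hn1) ?_
    have : n ≤ 2 * q := by omega
    exact_mod_cast this
  have h4 : slotBound P q 0 = P := by simp [slotBound]
  rw [h4]
  have : (q : ℝ) * (harmonic n : ℝ) ≤ q * (1 + Real.log (2 * q)) :=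
    mul_le_mul_of_nonneg_left (by linarith) (by positivity)
  linarith

/-- The slot of a real number modulo one. -/
noncomputable def slot (q : ℕ) (θ : ℝ) : ℕ := ⌊2 * q * Int.fract θ⌋₊

lemma slot_lt {q : ℕ} (hq : 0 < q) (θ : ℝ) : slot q θ < 2 * q := by
  have hq' : (0 : ℝ) < q := by exact_mod_cast hq
  rw [slot, Nat.floor_lt (by have := Int.fract_nonneg θ; positivity)]
  have := Int.fract_lt_one θ
  push_cast
  nlinarith

lemma linearBound_le_slotBound {P : ℝ} (hP : 0 ≤ P) {q : ℕ} (hq : 0 < q) (θ : ℝ) :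
    linearBound P θ ≤ slotBound P q (slot q θ) + slotBound P q (2 * q - 1 - slot q θ) := by
  have hq' : (0 : ℝ) < q := by exact_mod_cast hq
  have hf0 := Int.fract_nonneg θ
  have hf1 := Int.fract_lt_one θ
  have hu1 : (slot q θ : ℝ) ≤ 2 * q * Int.fract θ := Nat.floor_le (by positivity)
  have hu2 : 2 * q * Int.fract θ < slot q θ + 1 := Nat.lt_floor_add_one _
  have hlt := slot_lt hq θ
  have hd : distInt θ = Int.fract θ ∨ distInt θ = 1 - Int.fract θ := by
    rw [distInt, abs_sub_round_eq_min]
    rcases min_choice (Int.fract θ) (1 - Int.fract θ) with h | h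
    · exact Or.inl h
    · exact Or.inr h
  have hb := distInt_mul_linearBound_le P θ
  have hL := linearBound_nonneg hP θ
  have hLP := linearBound_le P θ
  have key : ∀ u : ℕ, (u : ℝ) ≤ 2 * q * distInt θ → linearBound P θ ≤ slotBound P q u := by
    intro u hu
    unfold slotBound
    split_ifs with h0
    · exact hLP
    · have hu0 : (0 : ℝ) < u := by exact_mod_cast Nat.pos_of_ne_zero h0
      rw [le_div_iff₀ hu0]
      nlinarith
  rcases hd with h | h
  · have := key (slot q θ) (by rw [h]; exact hu1)
    have := slotBound_nonneg hP q (2 * q - 1 - slot q θ)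
    linarith
  · have := key (2 * q - 1 - slot q θ) (by
      rw [h, Nat.cast_sub (by omega), Nat.cast_sub (by omega)]
      push_cast
      linarith)
    have := slotBound_nonneg hP q (slot q θ)
    linarith

lemma sum_linearBound_block_le {P : ℝ} (hP : 0 ≤ P) {q : ℕ} (hq : 0 < q) (B : ℕ) (θ : ℕ → ℝ)
    (hsep : ∀ r < B, ∀ r' < B, r ≠ r' → 1 ≤ 2 * q * distInt (θ r - θ r')) :
    ∑ r ∈ Finset.range B, linearBound P (θ r) ≤ 2 * (P + q * (1 + Real.log (2 * q))) := by
  classical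
  have hq' : (0 : ℝ) < q := by exact_mod_cast hq
  have hinj : Set.InjOn (fun r => slot q (θ r)) (Finset.range B : Set ℕ) := by
    intro r hr r' hr' heq
    by_contra hne
    have h1 := hsep r (by simpa using hr) r' (by simpa using hr') hne
    have hd : distInt (θ r - θ r') ≤ |Int.fract (θ r) - Int.fract (θ r')| := by
      have := distInt_le (θ r - θ r') (⌊θ r⌋ - ⌊θ r'⌋)
      refine this.trans (le_of_eq ?_)
      rw [Int.fract, Int.fract]
      push_cast
      ring_nf
    simp only [slot] at heq
    have a1 := Int.fract_nonneg (θ r)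
    have a2 := Int.fract_nonneg (θ r')
    have b1 : (⌊2 * q * Int.fract (θ r)⌋₊ : ℝ) ≤ 2 * q * Int.fract (θ r) :=
      Nat.floor_le (by positivity)
    have b2 : (⌊2 * q * Int.fract (θ r')⌋₊ : ℝ) ≤ 2 * q * Int.fract (θ r') :=
      Nat.floor_le (by positivity)
    have c1 := Nat.lt_floor_add_one (2 * q * Int.fract (θ r))
    have c2 := Nat.lt_floor_add_one (2 * q * Int.fract (θ r'))
    rw [heq] at b1 c1
    have : 2 * q * |Int.fract (θ r) - Int.fract (θ r')| < 1 := by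
      rw [show 2 * (q : ℝ) * |Int.fract (θ r) - Int.fract (θ r')| =
        |2 * q * Int.fract (θ r) - 2 * q * Int.fract (θ r')| by
          rw [← mul_sub, abs_mul, abs_of_pos (by positivity : (0 : ℝ) < 2 * q)]]
      rw [abs_lt]
      constructor <;> linarith
    nlinarith
  have hsum : ∀ g : ℕ → ℝ, (∀ u, 0 ≤ g u) →
      ∑ r ∈ Finset.range B, g (slot q (θ r)) ≤ ∑ u ∈ Finset.range (2 * q), g u := by
    intro g hg
    rw [← Finset.sum_image (f := g) (g := fun r => slot q (θ r)) hinj]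
    refine Finset.sum_le_sum_of_subset_of_nonneg ?_ fun u _ _ => hg u
    intro u hu
    obtain ⟨r, _, rfl⟩ := Finset.mem_image.mp hu
    exact Finset.mem_range.mpr (slot_lt hq _)
  have h1 := hsum (slotBound P q) (slotBound_nonneg hP q)
  have h2 := hsum (fun u => slotBound P q (2 * q - 1 - u)) fun u => slotBound_nonneg hP q _
  rw [Finset.sum_range_reflect] at h2
  have h3 := sum_slotBound_le P hP q
  calc _ ≤ ∑ r ∈ Finset.range B, (slotBound P q (slot q (θ r)) +
        slotBound P q (2 * q - 1 - slot q (θ r))) :=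
        Finset.sum_le_sum fun r _ => linearBound_le_slotBound hP hq _
    _ ≤ _ := by
      rw [Finset.sum_add_distrib]
      linarith

lemma le_distInt_mul {α : ℝ} {q : ℕ} (hq : 0 < q) {a : ℤ} (haq : IsCoprime a q)
    (hα : |α - a / q| ≤ 1 / (q : ℝ) ^ 2) {n : ℤ} (hn0 : n ≠ 0) (hn : 2 * |n| ≤ q) (hq2 : |n| < q) :
    1 ≤ 2 * q * distInt (α * n) := by
  have hq' : (0 : ℝ) < q := by exact_mod_cast hq
  set m := round (α * n) with hm
  have hne : a * n - q * m ≠ 0 := by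
    intro h
    have h1 : (q : ℤ) ∣ a * n := ⟨m, by linarith⟩
    have h2 : (q : ℤ) ∣ n := haq.symm.dvd_of_dvd_mul_left h1
    have := Int.eq_zero_of_abs_lt_dvd h2 hq2
    exact hn0 this
  have h1 : (1 : ℝ) ≤ |(a * n - q * m : ℝ)| := by
    have := Int.one_le_abs hne
    exact_mod_cast this
  have h2 : (a * n - q * m : ℝ) = q * (α * n - m) - q * n * (α - a / q) := by
    field_simp
    ring
  have h3 : |(a * n - q * m : ℝ)| ≤ q * distInt (α * n) + q * |(n : ℝ)| * |α - a / q| := by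
    rw [h2]
    refine (abs_sub _ _).trans (le_of_eq ?_)
    rw [abs_mul, abs_mul, abs_mul, abs_of_pos hq', distInt, hm]
  have h4 : q * |(n : ℝ)| * |α - a / q| ≤ 1 / 2 := by
    have h5 : 2 * |(n : ℝ)| ≤ q := by exact_mod_cast hn
    calc q * |(n : ℝ)| * |α - a / q| ≤ q * (q / 2) * (1 / (q : ℝ) ^ 2) := by
          gcongr
          linarith
      _ = 1 / 2 := by field_simp
  linarith

lemma sum_range_mul_eq_sum_sum {β : Type*} [AddCommMonoid β] (f : ℕ → β) (R B : ℕ) :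
    ∑ m ∈ Finset.range (R * B), f m =
      ∑ i ∈ Finset.range R, ∑ r ∈ Finset.range B, f (r + B * i) := by
  induction R with
  | zero => simp
  | succ R ih =>
    rw [add_mul, one_mul, Finset.sum_range_add, ih, Finset.sum_range_succ]
    congr 1
    exact Finset.sum_congr rfl fun r _ => by rw [add_comm, mul_comm]

lemma sum_linearBound_le {P : ℝ} (hP : 0 ≤ P) {α : ℝ} {q : ℕ} (hq : 0 < q) {a : ℤ}
    (haq : IsCoprime a q) (hα : |α - a / q| ≤ 1 / (q : ℝ) ^ 2) (M : ℕ) :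
    ∑ m ∈ Finset.range M, linearBound P (α * m) ≤
      (3 * M / q + 1) * (2 * (P + q * (1 + Real.log (2 * q)))) := by
  have hq' : (0 : ℝ) < q := by exact_mod_cast hq
  have hlog : 0 ≤ Real.log (2 * q) := by
    refine Real.log_nonneg ?_
    have : (1 : ℝ) ≤ q := by exact_mod_cast hq
    linarith
  obtain ⟨B, hB0, hB1, hB2⟩ : ∃ B, 0 < B ∧ q ≤ 3 * B ∧ (2 * B ≤ q ∨ B = 1) := by
    by_cases h : 2 ≤ q
    · exact ⟨q / 2, by omega, by omega, by omega⟩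
    · exact ⟨1, by omega, by omega, by omega⟩
  set R := M / B + 1 with hR
  have hMR : M ≤ R * B := by
    have := Nat.lt_div_mul_add (a := M) hB0
    rw [hR, add_mul]
    omega
  have hblock : ∀ i, ∑ r ∈ Finset.range B, linearBound P (α * ((r + B * i : ℕ) : ℝ)) ≤
      2 * (P + q * (1 + Real.log (2 * q))) := by
    intro i
    refine sum_linearBound_block_le hP hq B (fun r => α * ((r + B * i : ℕ) : ℝ)) ?_
    intro r hr r' hr' hne
    have e : α * ((r + B * i : ℕ) : ℝ) - α * ((r' + B * i : ℕ) : ℝ) =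
        α * (((r : ℤ) - r' : ℤ) : ℝ) := by
      push_cast
      ring
    simp only [e]
    have habs : |(r : ℤ) - r'| < B := by
      rw [abs_lt]
      constructor <;> omega
    refine le_distInt_mul hq haq hα (by omega) ?_ ?_ <;> omega
  calc _ ≤ ∑ m ∈ Finset.range (R * B), linearBound P (α * m) :=
        Finset.sum_le_sum_of_subset_of_nonneg (Finset.range_mono hMR)
          fun m _ _ => linearBound_nonneg hP _
    _ = ∑ i ∈ Finset.range R, ∑ r ∈ Finset.range B, linearBound P (α * ((r + B * i : ℕ) : ℝ)) := by
        rw [sum_range_mul_eq_sum_sum]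
    _ ≤ R * (2 * (P + q * (1 + Real.log (2 * q)))) := by
        refine (Finset.sum_le_sum fun i _ => hblock i).trans ?_
        simp
    _ ≤ _ := by
        refine mul_le_mul_of_nonneg_right ?_ (by positivity)
        rw [hR]
        push_cast
        have h1 : ((M / B : ℕ) : ℝ) ≤ M / B := Nat.cast_div_le
        have h2 : (M : ℝ) / B ≤ 3 * M / q := by
          have hB' : (0 : ℝ) < B := by exact_mod_cast hB0
          rw [div_le_div_iff₀ hB' hq']
          have : (q : ℝ) ≤ 3 * B := by exact_mod_cast hB1
          nlinarith [(Nat.cast_nonneg M : (0 : ℝ) ≤ M)]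
        linarith

open Polynomial in
lemma norm_inner_le_linearBound (k P : ℕ) (α : ℝ) (hs : List ℤ) (hlen : hs.length + 1 = k) :
    ‖∑ x ∈ Finset.Icc (lowerEnd 1 hs) (upperEnd P hs),
      unitExp (α * ((iterDiff (X ^ k) hs).eval x : ℤ))‖ ≤
      linearBound P (α * ((k.descFactorial hs.length * hs.prod : ℤ) : ℝ)) := by
  obtain ⟨h1, h2⟩ := iterDiff_degree_coeff hs 1 (X ^ k) (by rw [natDegree_X_pow]; omega)
  rw [show 1 + hs.length = k by omega, coeff_X_pow_self, mul_one] at h2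
  have hev : ∀ x : ℤ, α * ((iterDiff (X ^ k) hs).eval x : ℤ) =
      α * ((k.descFactorial hs.length * hs.prod : ℤ) : ℝ) * x +
        α * ((iterDiff (X ^ k) hs).coeff 0 : ℤ) := by
    intro x
    rw [eval_eq_sum_range' (n := 2) (by omega), Finset.sum_range_succ, Finset.sum_range_one,
      h2]
    push_cast
    ring
  simp_rw [hev]
  refine le_linearBound ?_ (norm_sum_unitExp_linear_le _ _ _ _)
  refine (norm_sum_le _ _).trans ?_
  simp only [norm_unitExp, Finset.sum_const, nsmul_eq_mul, mul_one]
  exact_mod_cast card_Icc_ends_le P hs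

lemma card_shiftLists_prod_eq_le (P j c m : ℕ) (hm : m ≠ 0) :
    ((shiftLists P j).filter fun hs => ((c : ℤ) * hs.prod).natAbs = m).card ≤
      (2 * m.divisors.card) ^ j := by
  classical
  refine (Finset.card_le_card ?_).trans ((card_shiftLists_filter_le P j (intDivisors m)).trans
    (Nat.pow_le_pow_left ?_ _))
  · intro hs hhs
    rw [Finset.mem_filter] at hhs ⊢
    refine ⟨hhs.1, fun h hh => mem_intDivisors (by exact_mod_cast hm) ?_⟩
    rw [← hhs.2, Int.dvd_natAbs]
    exact (List.dvd_prod hh).mul_left _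
  · simpa using card_intDivisors_le (m : ℤ)

open Polynomial in
lemma norm_weylSum_le (k j P : ℕ) (hk : k = j + 2) (hP : 0 < P) (α : ℝ) (D : ℝ)
    (hD : ∀ m : ℕ, m ≠ 0 → m ≤ k.descFactorial (j + 1) * P ^ (j + 1) →
      (m.divisors.card : ℝ) ≤ D) :
    ‖weylSum P α (j + 1) 1 P (X ^ k)‖ ≤ (j + 1) * (2 * P : ℝ) ^ (j + 1) +
      (2 * D) ^ (j + 1) * ∑ m ∈ Finset.range (k.descFactorial (j + 1) * P ^ (j + 1) + 1),
        linearBound P (α * m) := by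
  classical
  set c := k.descFactorial (j + 1) with hc
  have hc0 : 0 < c := Nat.descFactorial_pos.mpr (by omega)
  set N := c * P ^ (j + 1) with hN
  have hD0 : 0 ≤ D := by
    refine le_trans (Nat.cast_nonneg _) (hD 1 one_ne_zero ?_)
    exact Nat.mul_pos hc0 (by positivity)
  have hbd : ∀ hs ∈ shiftLists P (j + 1),
      ‖∑ x ∈ Finset.Icc (lowerEnd 1 hs) (upperEnd P hs),
        unitExp (α * ((iterDiff (X ^ k) hs).eval x : ℤ))‖ ≤
      linearBound P (α * (((c : ℤ) * hs.prod).natAbs : ℝ)) := by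
    intro hs hhs
    have hlen := (mem_shiftLists.mp hhs).1
    refine (norm_inner_le_linearBound k P α hs (by omega)).trans (le_of_eq ?_)
    rw [hlen, ← hc]
    have : ((((c : ℤ) * hs.prod).natAbs : ℕ) : ℝ) = |(((c : ℤ) * hs.prod : ℤ) : ℝ)| := by
      rw [Nat.cast_natAbs, Int.cast_abs]
    rw [this]
    rcases abs_choice (((c : ℤ) * hs.prod : ℤ) : ℝ) with h | h
    · rw [h]
    · rw [h, mul_neg, linearBound_neg]
  rw [weylSum]
  refine (norm_sum_le _ _).trans ((Finset.sum_le_sum hbd).trans ?_)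
  rw [← Finset.sum_filter_add_sum_filter_not _ (fun hs : List ℤ => (0 : ℤ) ∈ hs)]
  refine add_le_add ?_ ?_
  · refine (Finset.sum_le_sum fun hs _ => linearBound_le (P : ℝ) _).trans ?_
    rw [Finset.sum_const, nsmul_eq_mul]
    have h := card_shiftLists_zero_mem_le P (j + 1) hP
    have h' : (((shiftLists P (j + 1)).filter (fun hs => (0 : ℤ) ∈ hs)).card : ℝ) * (2 * P) ≤
      ((j + 1 : ℕ) : ℝ) * (2 * P) ^ (j + 1) := by exact_mod_cast h
    push_cast at h'
    have h0 : (0 : ℝ) ≤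
        (((shiftLists P (j + 1)).filter (fun hs => (0 : ℤ) ∈ hs)).card : ℝ) * P := by
      positivity
    linarith
  · have hmaps : ∀ hs ∈ (shiftLists P (j + 1)).filter (fun hs => (0 : ℤ) ∉ hs),
        ((c : ℤ) * hs.prod).natAbs ∈ Finset.range (N + 1) := by
      intro hs hhs
      obtain ⟨h1, -⟩ := Finset.mem_filter.mp hhs
      obtain ⟨hlen, hmem⟩ := mem_shiftLists.mp h1
      rw [Finset.mem_range, Nat.lt_succ_iff, Int.natAbs_mul, Int.natAbs_natCast, hN]
      refine Nat.mul_le_mul_left _ ?_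
      rw [← hlen]
      clear h1 hlen hhs
      induction hs with
      | nil => simp
      | cons h hs ih =>
        rw [List.prod_cons, Int.natAbs_mul, List.length_cons, pow_succ, mul_comm]
        refine Nat.mul_le_mul (ih fun x hx => hmem x (List.mem_cons_of_mem _ hx)) ?_
        have := hmem h List.mem_cons_self
        rw [Finset.mem_Ioo] at this
        omega
    rw [← Finset.sum_fiberwise_of_maps_to hmaps, Finset.mul_sum]
    refine Finset.sum_le_sum fun m hm => ?_
    have hlb := linearBound_nonneg (Nat.cast_nonneg P) (α * m)
    rw [Finset.sum_congr rfl (g := fun _ => linearBound P (α * m))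
      (fun hs hhs => by rw [(Finset.mem_filter.mp hhs).2]), Finset.sum_const, nsmul_eq_mul]
    refine mul_le_mul_of_nonneg_right ?_ hlb
    by_cases hm0 : m = 0
    · subst hm0
      rw [Finset.card_eq_zero.mpr]
      · simp only [Nat.cast_zero]
        positivity
      · rw [Finset.filter_eq_empty_iff]
        intro hs hhs h
        rw [Int.natAbs_eq_zero, mul_eq_zero] at h
        rcases h with h | h
        · exact hc0.ne' (by exact_mod_cast h)
        · exact (Finset.mem_filter.mp hhs).2 (List.prod_eq_zero_iff.mp h)
    · have h1 : (((shiftLists P (j + 1)).filter (fun hs => (0 : ℤ) ∉ hs)).filter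
          fun hs => ((c : ℤ) * hs.prod).natAbs = m).card ≤ (2 * m.divisors.card) ^ (j + 1) := by
        refine (Finset.card_le_card ?_).trans (card_shiftLists_prod_eq_le P (j + 1) c m hm0)
        exact Finset.filter_subset_filter _ (Finset.filter_subset _ _)
      have h2 := hD m hm0 (by rw [Finset.mem_range] at hm; omega)
      have h3 : ((((shiftLists P (j + 1)).filter (fun hs => (0 : ℤ) ∉ hs)).filter
          fun hs => ((c : ℤ) * hs.prod).natAbs = m).card : ℝ) ≤
          (2 * (m.divisors.card : ℝ)) ^ (j + 1) := by exact_mod_cast h1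
      refine h3.trans ?_
      gcongr

/-- The main factor in Weyl's inequality. -/
noncomputable def weylFactor (k P q : ℕ) : ℝ := 1 / q + 1 / P + q / (P : ℝ) ^ k

lemma weylFactor_nonneg (k P q : ℕ) : 0 ≤ weylFactor k P q := by
  unfold weylFactor
  positivity

lemma weyl_divisor_bound (j : ℕ) (c : ℕ) (hc : 0 < c) (ε : ℝ) (hε : 0 < ε) :
    ∃ C : ℝ, 0 < C ∧ ∀ P : ℕ, 0 < P → ∃ D : ℝ, 0 ≤ D ∧ D ^ (j + 1) ≤ C * (P : ℝ) ^ ε ∧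
      ∀ m : ℕ, m ≠ 0 → m ≤ c * P ^ (j + 1) → (m.divisors.card : ℝ) ≤ D := by
  set ε' := ε / (((j + 1 : ℕ) : ℝ) * ((j + 1 : ℕ) : ℝ)) with hε'
  have hε'0 : 0 < ε' := by positivity
  obtain ⟨Cd, hCd, hdiv⟩ := exists_card_divisors_le ε' hε'0
  have hc' : (0 : ℝ) < c := by exact_mod_cast hc
  refine ⟨(Cd * (c : ℝ) ^ ε') ^ (j + 1), by positivity, fun P hP => ?_⟩
  have hx0 : (0 : ℝ) < P := by exact_mod_cast hP
  refine ⟨Cd * (c : ℝ) ^ ε' * (P : ℝ) ^ (ε / ((j + 1 : ℕ) : ℝ)), by positivity, ?_, ?_⟩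
  · rw [mul_pow (Cd * _)]
    refine le_of_eq ?_
    congr 1
    rw [← Real.rpow_natCast, ← Real.rpow_mul hx0.le]
    congr 1
    field_simp
  · intro m hm hmle
    refine (hdiv m hm).trans ?_
    rw [mul_assoc]
    refine mul_le_mul_of_nonneg_left ?_ (by linarith)
    have : (m : ℝ) ≤ c * (P : ℝ) ^ (j + 1) := by exact_mod_cast hmle
    refine (Real.rpow_le_rpow (by positivity) this hε'0.le).trans ?_
    rw [Real.mul_rpow (by positivity) (by positivity), ← Real.rpow_natCast (P : ℝ),
      ← Real.rpow_mul hx0.le]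
    refine le_of_eq ?_
    congr 2
    rw [hε']
    field_simp

lemma weyl_linear_bound (j P q c : ℕ) (hP : 0 < P) (hq : 0 < q) (hc : 0 < c) (L : ℝ)
    (hL : 1 ≤ L) :
    (3 * ((c * P ^ (j + 1) + 1 : ℕ) : ℝ) / q + 1) * (2 * (P + q * L)) ≤
      24 * c * L * ((P : ℝ) ^ (j + 2) * weylFactor (j + 2) P q) := by
  have hx : (1 : ℝ) ≤ P := by exact_mod_cast hP
  have hx0 : (0 : ℝ) < P := by linarith
  have hq1 : (1 : ℝ) ≤ q := by exact_mod_cast hq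
  have hc1 : (1 : ℝ) ≤ c := by exact_mod_cast hc
  set x : ℝ := (P : ℝ) with hxdef
  have hxj : 1 ≤ x ^ j := one_le_pow₀ hx
  have hF : x ^ (j + 2) * weylFactor (j + 2) P q = x ^ (j + 2) / q + x ^ (j + 1) + q := by
    unfold weylFactor
    rw [← hxdef]
    field_simp
    ring
  rw [hF]
  have h1 : ((c * P ^ (j + 1) + 1 : ℕ) : ℝ) ≤ 2 * c * x ^ (j + 1) := by
    push_cast
    have : 1 ≤ c * x ^ (j + 1) := one_le_mul_of_one_le_of_one_le hc1 (one_le_pow₀ hx)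
    linarith
  have h2 : 3 * ((c * P ^ (j + 1) + 1 : ℕ) : ℝ) / q + 1 ≤ 6 * c * (x ^ (j + 1) / q + 1) := by
    have : 3 * ((c * P ^ (j + 1) + 1 : ℕ) : ℝ) / q ≤ 3 * (2 * c * x ^ (j + 1)) / q := by gcongr
    calc _ ≤ 3 * (2 * c * x ^ (j + 1)) / q + 6 * c := by linarith
      _ = _ := by ring
  have h3 : 2 * (x + q * L) ≤ 2 * L * (x + q) := by nlinarith
  have hx1 : x ≤ x ^ (j + 1) := by
    rw [pow_succ]
    nlinarith
  calc _ ≤ 6 * c * (x ^ (j + 1) / q + 1) * (2 * L * (x + q)) :=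
        mul_le_mul h2 h3 (by positivity) (by positivity)
    _ = 12 * c * L * (x ^ (j + 2) / q + x ^ (j + 1) + x + q) := by
        field_simp
        ring
    _ ≤ 12 * c * L * (2 * (x ^ (j + 2) / q + x ^ (j + 1) + q)) := by
        refine mul_le_mul_of_nonneg_left ?_ (by positivity)
        have : 0 ≤ x ^ (j + 2) / q := by positivity
        linarith
    _ = _ := by ring

/-- Weyl's inequality. -/
theorem weyl_inequality (k : ℕ) (hk : 2 ≤ k) (ε : ℝ) (hε : 0 < ε) :
    ∃ C : ℝ, 0 < C ∧ ∀ P q : ℕ, 0 < P → 0 < q → ∀ (a : ℤ) (α : ℝ), IsCoprime a q →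
      |α - a / q| ≤ 1 / (q : ℝ) ^ 2 →
      ‖powerSum k P α‖ ^ 2 ^ (k - 1) ≤
        C * (P : ℝ) ^ ((2 ^ (k - 1) : ℕ) + ε) * weylFactor k P q := by
  obtain ⟨j, rfl⟩ : ∃ j, k = j + 2 := ⟨k - 2, by omega⟩
  set c := (j + 2).descFactorial (j + 1) with hc
  have hc0 : 0 < c := Nat.descFactorial_pos.mpr (by omega)
  obtain ⟨C1, hC1, hdiv⟩ := weyl_divisor_bound j c hc0 (ε / 2) (by positivity)
  set e := 2 ^ (j + 1) - (j + 1) - 1 with he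
  have hlt : j + 1 < 2 ^ (j + 1) := Nat.lt_two_pow_self
  set C2 : ℝ := 2 + (j + 2) / (ε / 2) with hC2
  have hC2p : 0 < C2 := by positivity
  set C3 : ℝ := 2 ^ e * ((j + 1) * 2 ^ (j + 1) + 2 ^ (j + 1) * C1 * (24 * c * C2)) with hC3
  have hC3p : 0 < C3 := by positivity
  refine ⟨max C3 1, by positivity, ?_⟩
  intro P q hP hq a α haq hα
  rw [show j + 2 - 1 = j + 1 by omega]
  have hx : (1 : ℝ) ≤ P := by exact_mod_cast hP
  have hx0 : (0 : ℝ) < P := by linarith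
  have hq1 : (1 : ℝ) ≤ q := by exact_mod_cast hq
  have hΔ := weylFactor_nonneg (j + 2) P q
  by_cases hqP : (P : ℝ) ^ (j + 2) < q
  · have h1 : 1 ≤ weylFactor (j + 2) P q := by
      unfold weylFactor
      have : 1 ≤ (q : ℝ) / (P : ℝ) ^ (j + 2) := by
        rw [le_div_iff₀ (by positivity)]
        linarith
      have : (0 : ℝ) ≤ 1 / q := by positivity
      have : (0 : ℝ) ≤ 1 / P := by positivity
      linarith
    calc ‖powerSum (j + 2) P α‖ ^ 2 ^ (j + 1) ≤ (P : ℝ) ^ 2 ^ (j + 1) :=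
          pow_le_pow_left₀ (norm_nonneg _) (norm_powerSum_le _ _ _) _
      _ = (P : ℝ) ^ (((2 ^ (j + 1) : ℕ) : ℝ)) := (Real.rpow_natCast _ _).symm
      _ ≤ (P : ℝ) ^ (((2 ^ (j + 1) : ℕ) : ℝ) + ε) :=
          Real.rpow_le_rpow_of_exponent_le hx (by linarith)
      _ = 1 * (P : ℝ) ^ (((2 ^ (j + 1) : ℕ) : ℝ) + ε) * 1 := by ring
      _ ≤ _ := by
          gcongr
          exact le_max_right _ _
  · push Not at hqP
    obtain ⟨D, hD0, hDp, hD⟩ := hdiv P hP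
    obtain ⟨r, hr0, hr1, hr2⟩ := norm_pow_le_weylSum P hP α j 1 P (by omega)
      (Polynomial.X ^ (j + 2))
    rw [← powerSum_eq_eval, ← he] at hr2
    have hw := norm_weylSum_le (j + 2) j P rfl hP α D hD
    rw [hr1, Complex.norm_real, Real.norm_of_nonneg hr0, ← hc] at hw
    set L : ℝ := 1 + Real.log (2 * q) with hL
    have hlog2 : 0 ≤ Real.log (2 * q) := Real.log_nonneg (by linarith)
    have hL1 : 1 ≤ L := by linarith
    have hLle : L ≤ C2 * (P : ℝ) ^ (ε / 2) := by
      have h1 : Real.log (2 * q) = Real.log 2 + Real.log q :=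
        Real.log_mul (by norm_num) (by positivity)
      have h2 : Real.log q ≤ (j + 2) * Real.log P := by
        have := Real.log_le_log (by positivity) hqP
        rw [Real.log_pow] at this
        exact_mod_cast this
      have h3 : Real.log P ≤ (P : ℝ) ^ (ε / 2) / (ε / 2) :=
        Real.log_le_rpow_div hx0.le (by positivity)
      have h4 : 1 ≤ (P : ℝ) ^ (ε / 2) := Real.one_le_rpow hx (by positivity)
      have h5 : Real.log 2 ≤ 1 := by
        have := Real.log_two_lt_d9
        linarith
      have h6 : ((j : ℝ) + 2) * Real.log P ≤ (j + 2) * ((P : ℝ) ^ (ε / 2) / (ε / 2)) := by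
        gcongr
      calc L ≤ 2 * (P : ℝ) ^ (ε / 2) + (j + 2) * ((P : ℝ) ^ (ε / 2) / (ε / 2)) := by linarith
        _ = _ := by rw [hC2]; ring
    have hlin := sum_linearBound_le (P := (P : ℝ)) (by positivity) hq haq hα (c * P ^ (j + 1) + 1)
    have hlin2 := hlin.trans (weyl_linear_bound j P q c hP hq hc0 L hL1)
    set x : ℝ := (P : ℝ) with hxdef
    set Δ := weylFactor (j + 2) P q with hΔdef
    have hxΔ : x ^ (j + 1) ≤ x ^ (j + 2) * Δ := by
      have : 1 / x ≤ Δ := by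
        rw [hΔdef, weylFactor]
        have h1 : (0 : ℝ) ≤ 1 / q := by positivity
        have h2 : (0 : ℝ) ≤ q / x ^ (j + 2) := by positivity
        linarith
      calc x ^ (j + 1) = x ^ (j + 2) * (1 / x) := by
            field_simp
            ring
        _ ≤ _ := by gcongr
    have hε1 : 1 ≤ x ^ ε := Real.one_le_rpow hx hε.le
    have hεε : x ^ (ε / 2) * x ^ (ε / 2) = x ^ ε := by
      rw [← Real.rpow_add hx0, add_halves]
    have hpow : x ^ e * x ^ (j + 2) * x ^ ε = x ^ (((2 ^ (j + 1) : ℕ) : ℝ) + ε) := by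
      rw [← pow_add, Real.rpow_add hx0, Real.rpow_natCast]
      congr 2
      omega
    have hr : r ≤ ((j + 1) * 2 ^ (j + 1) + 2 ^ (j + 1) * C1 * (24 * c * C2)) *
        (x ^ (j + 2) * Δ * x ^ ε) := by
      calc r ≤ _ := hw
        _ ≤ (j + 1) * (2 ^ (j + 1) * (x ^ (j + 2) * Δ * x ^ ε)) + 2 ^ (j + 1) * (C1 * x ^ (ε / 2)) *
            (24 * c * (C2 * x ^ (ε / 2)) * (x ^ (j + 2) * Δ)) := by
            refine add_le_add ?_ ?_
            · rw [mul_pow]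
              refine mul_le_mul_of_nonneg_left ?_ (by positivity)
              refine mul_le_mul_of_nonneg_left ?_ (by positivity)
              refine hxΔ.trans (le_mul_of_one_le_right (by positivity) hε1)
            · rw [mul_pow]
              refine mul_le_mul ?_ (hlin2.trans ?_) ?_ (by positivity)
              · exact mul_le_mul_of_nonneg_left hDp (by positivity)
              · refine mul_le_mul_of_nonneg_right ?_ (by positivity)
                exact mul_le_mul_of_nonneg_left hLle (by positivity)
              · exact Finset.sum_nonneg fun m _ => linearBound_nonneg hx0.le _
        _ = (j + 1) * 2 ^ (j + 1) * (x ^ (j + 2) * Δ * x ^ ε) + 2 ^ (j + 1) * C1 * (24 * c * C2) *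
            (x ^ (j + 2) * Δ * (x ^ (ε / 2) * x ^ (ε / 2))) := by ring
        _ = _ := by
            rw [hεε]
            ring
    calc ‖powerSum (j + 2) P α‖ ^ 2 ^ (j + 1) ≤ (2 * x) ^ e * r := hr2
      _ ≤ (2 * x) ^ e * (((j + 1) * 2 ^ (j + 1) + 2 ^ (j + 1) * C1 * (24 * c * C2)) *
        (x ^ (j + 2) * Δ * x ^ ε)) := mul_le_mul_of_nonneg_left hr (by positivity)
      _ = C3 * (x ^ e * x ^ (j + 2) * x ^ ε) * Δ := by
        rw [hC3, mul_pow]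
        ring
      _ = C3 * x ^ (((2 ^ (j + 1) : ℕ) : ℝ) + ε) * Δ := by rw [hpow]
      _ ≤ _ := by
        gcongr
        exact le_max_left _ _

lemma powerSum_eq_range (k P : ℕ) (α : ℝ) :
    powerSum k P α = ∑ n ∈ Finset.range P, unitExp (α * ((n + 1 : ℕ) : ℝ) ^ k) := by
  rw [powerSum, sum_Icc_int_eq_range]
  refine Finset.sum_congr (by congr 1; omega) fun n _ => ?_
  congr 2
  push_cast
  ring

lemma norm_sum_sub_mean_le (u : ℕ → ℂ) (q : ℕ) (hq : 0 < q) (hper : ∀ n, u (q + n) = u n)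
    (hu : ∀ n, ‖u n‖ ≤ 1) (x : ℕ) :
    ‖∑ i ∈ Finset.range x, (u i - (∑ j ∈ Finset.range q, u j) / q)‖ ≤ 2 * q := by
  have hq' : (0 : ℝ) < q := by exact_mod_cast hq
  have hqc : (q : ℂ) ≠ 0 := by exact_mod_cast hq.ne'
  set S := ∑ j ∈ Finset.range q, u j with hS
  induction x using Nat.strong_induction_on with
  | _ x ih =>
    by_cases hx : x < q
    · have hSq : ‖S / q‖ ≤ 1 := by
        rw [norm_div, Complex.norm_natCast, div_le_one hq', hS]
        refine (norm_sum_le _ _).trans ((Finset.sum_le_sum fun i _ => hu i).trans ?_)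
        simp
      refine (norm_sum_le _ _).trans
        ((Finset.sum_le_sum (g := fun _ => (2 : ℝ)) fun i _ => ?_).trans ?_)
      · have := norm_sub_le (u i) (S / q)
        have := hu i
        linarith
      · rw [Finset.sum_const, Finset.card_range, nsmul_eq_mul, mul_comm]
        have : (x : ℝ) ≤ q := by exact_mod_cast hx.le
        linarith
    · obtain ⟨y, rfl⟩ : ∃ y, x = q + y := ⟨x - q, by omega⟩
      rw [Finset.sum_range_add]
      have h0 : ∑ i ∈ Finset.range q, (u i - S / q) = 0 := by
        rw [Finset.sum_sub_distrib, ← hS, Finset.sum_const, Finset.card_range, nsmul_eq_mul]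
        field_simp
        ring
      simp_rw [h0, zero_add, hper]
      exact ih y (by omega)

lemma norm_sum_mul_le_of_partial_sums (c g : ℕ → ℂ) (K : ℝ) (d : ℕ → ℝ)
    (hc : ∀ x, ‖∑ i ∈ Finset.range x, c i‖ ≤ K) (hd : ∀ n, ‖g (n + 1) - g n‖ ≤ d n) (n : ℕ) :
    ‖∑ i ∈ Finset.range (n + 1), g i * c i‖ ≤ K * (‖g n‖ + ∑ i ∈ Finset.range n, d i) := by
  have h := Finset.sum_range_by_parts g c (n + 1)
  simp only [smul_eq_mul, Nat.add_sub_cancel] at h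
  have hK : 0 ≤ K := (norm_nonneg _).trans (hc 0)
  rw [h, mul_add K, Finset.mul_sum _ _ K]
  refine (norm_sub_le _ _).trans (add_le_add ?_ ?_)
  · rw [norm_mul, mul_comm]
    exact mul_le_mul_of_nonneg_right (hc _) (norm_nonneg _)
  · refine (norm_sum_le _ _).trans (Finset.sum_le_sum fun i _ => ?_)
    rw [norm_mul, mul_comm]
    exact mul_le_mul (hc _) (hd i) (norm_nonneg _) hK

lemma norm_powerSum_rat_add_sub_le (k P q : ℕ) (hP : 0 < P) (hq : 0 < q) (a : ℤ) (β : ℝ) :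
    ‖powerSum k P (a / q + β) - powerSum k q (a / q) / q * powerSum k P β‖ ≤
      2 * q * (1 + 2 * Real.pi * (|β| * (P : ℝ) ^ k)) := by
  obtain ⟨n, rfl⟩ : ∃ n, P = n + 1 := ⟨P - 1, by omega⟩
  have hq' : (q : ℝ) ≠ 0 := by exact_mod_cast hq.ne'
  set u : ℕ → ℂ := fun m => unitExp (a / q * ((m + 1 : ℕ) : ℝ) ^ k) with hu
  set g : ℕ → ℂ := fun m => unitExp (β * ((m + 1 : ℕ) : ℝ) ^ k) with hg
  have hper : ∀ m, u (q + m) = u m := by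
    intro m
    simp only [hu]
    have h1 : (q : ℤ) ∣ ((q + m + 1 : ℕ) : ℤ) ^ k - ((m + 1 : ℕ) : ℤ) ^ k := by
      have := sub_dvd_pow_sub_pow ((q + m + 1 : ℕ) : ℤ) ((m + 1 : ℕ) : ℤ) k
      refine dvd_trans ?_ this
      push_cast
      exact ⟨1, by ring⟩
    obtain ⟨t, ht⟩ := h1
    have ht' : (((q + m + 1 : ℕ) : ℝ)) ^ k = ((m + 1 : ℕ) : ℝ) ^ k + q * t := by
      have : ((q + m + 1 : ℕ) : ℤ) ^ k = ((m + 1 : ℕ) : ℤ) ^ k + q * t := by linarith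
      exact_mod_cast this
    rw [ht', mul_add, show (a : ℝ) / q * (q * t) = ((a * t : ℤ) : ℝ) by push_cast; field_simp,
      unitExp_add_int]
  have hS : powerSum k q (a / q) = ∑ j ∈ Finset.range q, u j := powerSum_eq_range _ _ _
  have hβ : powerSum k (n + 1) β = ∑ j ∈ Finset.range (n + 1), g j := powerSum_eq_range _ _ _
  have hsum : powerSum k (n + 1) (a / q + β) -
      powerSum k q (a / q) / q * powerSum k (n + 1) β =
      ∑ i ∈ Finset.range (n + 1), g i * (u i - (∑ j ∈ Finset.range q, u j) / q) := by
    rw [hS, hβ, powerSum_eq_range, Finset.mul_sum, ← Finset.sum_sub_distrib]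
    refine Finset.sum_congr rfl fun i _ => ?_
    simp only [hu, hg]
    rw [add_mul, unitExp_add]
    ring
  rw [hsum]
  have hd : ∀ m, ‖g (m + 1) - g m‖ ≤
      2 * Real.pi * (|β| * (((m + 1 + 1 : ℕ) : ℝ) ^ k - ((m + 1 : ℕ) : ℝ) ^ k)) := by
    intro m
    refine (norm_unitExp_sub_le _ _).trans (le_of_eq ?_)
    rw [← mul_sub, abs_mul, abs_of_nonneg (a := _ - _)]
    have : ((m + 1 : ℕ) : ℝ) ^ k ≤ ((m + 1 + 1 : ℕ) : ℝ) ^ k := by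
      gcongr
      omega
    linarith
  refine (norm_sum_mul_le_of_partial_sums _ g (2 * q) _
    (norm_sum_sub_mean_le u q hq hper fun m => (norm_unitExp _).le) hd n).trans ?_
  rw [← Finset.mul_sum, ← Finset.mul_sum,
    Finset.sum_range_sub (fun m => ((m + 1 : ℕ) : ℝ) ^ k) n]
  have h1 : ‖g n‖ = 1 := norm_unitExp _
  rw [h1]
  have h2 : ((n + 1 : ℕ) : ℝ) ^ k - ((0 + 1 : ℕ) : ℝ) ^ k ≤ ((n + 1 : ℕ) : ℝ) ^ k := by
    have : (0 : ℝ) ≤ ((0 + 1 : ℕ) : ℝ) ^ k := by positivity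
    linarith
  gcongr

lemma norm_powerSum_le_of_pos (k P : ℕ) (hk : 2 ≤ k) (β : ℝ) (hβ : 0 < β)
    (hβP : 1 < β * (P : ℝ) ^ k)
    (hhalf : β * (((P : ℝ) + 1) ^ k - (P : ℝ) ^ k) ≤ 1 / 2) :
    ‖powerSum k P β‖ ≤ 2 * β ^ (-(1 / k : ℝ)) := by
  have hk0 : (0 : ℝ) < k := by positivity
  set t := β ^ (-(1 / k : ℝ)) with ht
  have ht0 : 0 < t := by positivity
  have htk : t ^ k = β⁻¹ := by
    rw [ht, ← Real.rpow_natCast, ← Real.rpow_mul hβ.le, ← Real.rpow_neg_one]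
    congr 1
    field_simp
  have htP : t < P := by
    refine lt_of_pow_lt_pow_left₀ k (by positivity) ?_
    rw [htk, inv_lt_iff_one_lt_mul₀ hβ, mul_comm]
    exact hβP
  set N := ⌈t⌉₊ with hN
  have hNt : t ≤ N := Nat.le_ceil t
  have hNt2 : (N : ℝ) < t + 1 := Nat.ceil_lt_add_one ht0.le
  have hNP : N ≤ P := Nat.ceil_le.mpr htP.le
  have hN1 : 1 ≤ N := Nat.ceil_pos.mpr ht0
  set θ : ℕ → ℝ := fun n => β * (n : ℝ) ^ k with hθ
  have hf : powerSum k P β = ∑ n ∈ Finset.Ico 1 N, unitExp (θ n) +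
      ∑ n ∈ Finset.Ico N (P + 1), unitExp (θ n) := by
    rw [Finset.sum_Ico_consecutive _ hN1 (by omega), powerSum_eq_range, Finset.sum_Ico_eq_sum_range]
    refine Finset.sum_congr (by simp) fun n _ => ?_
    simp only [hθ, add_comm 1 n]
  have hstep : ∀ n : ℕ, θ (n + 1) - θ n = β * ((n + 1 : ℝ) ^ k - (n : ℝ) ^ k) := by
    intro n
    simp only [hθ]
    push_cast
    ring
  have hlow : t⁻¹ ≤ θ (N + 1) - θ N := by
    rw [hstep]
    have h1 : (N : ℝ) ^ (k - 1) ≤ (N + 1 : ℝ) ^ k - (N : ℝ) ^ k := by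
      obtain ⟨j, rfl⟩ : ∃ j, k = j + 1 := ⟨k - 1, by omega⟩
      have : (N : ℝ) ^ j ≤ (N + 1 : ℝ) ^ j := pow_le_pow_left₀ (by positivity) (by linarith) _
      rw [pow_succ, pow_succ, Nat.add_sub_cancel]
      nlinarith [(Nat.cast_nonneg N : (0 : ℝ) ≤ N)]
    have h2 : t ^ (k - 1) ≤ (N : ℝ) ^ (k - 1) := pow_le_pow_left₀ ht0.le hNt _
    calc t⁻¹ = β * t ^ (k - 1) := by
          have h3 : t ^ (k - 1) * t = β⁻¹ := by
            rw [← pow_succ, Nat.sub_add_cancel (by omega), htk]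
          field_simp
          have h4 : β * (t ^ (k - 1) * t) = 1 := by rw [h3, mul_inv_cancel₀ hβ.ne']
          linarith
      _ ≤ _ := mul_le_mul_of_nonneg_left (h2.trans h1) hβ.le
  have hpos : 0 < θ (N + 1) - θ N := lt_of_lt_of_le (by positivity) hlow
  have hKL := norm_sum_unitExp_le_of_monotone_diff θ N P hNP hpos (by
    intro n _ _
    rw [hstep, hstep]
    refine mul_le_mul_of_nonneg_left ?_ hβ.le
    have hconv := (convexOn_pow (𝕜 := ℝ) k).2 (show (n : ℝ) ∈ Set.Ici 0 by simp)
      (show (n : ℝ) + 2 ∈ Set.Ici 0 by simp; positivity) (show (0 : ℝ) ≤ 1 / 2 by norm_num)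
      (show (0 : ℝ) ≤ 1 / 2 by norm_num) (by norm_num)
    simp only [smul_eq_mul] at hconv
    rw [show (1 / 2 : ℝ) * n + 1 / 2 * (n + 2) = n + 1 by ring] at hconv
    push_cast
    rw [show (n : ℝ) + 1 + 1 = n + 2 by ring]
    linarith) (by rw [hstep]; exact hhalf)
  rw [hf]
  refine (norm_add_le _ _).trans ?_
  have h1 : ‖∑ n ∈ Finset.Ico 1 N, unitExp (θ n)‖ ≤ t := by
    refine (norm_sum_le _ _).trans ?_
    simp only [norm_unitExp, Finset.sum_const, Nat.card_Ico, nsmul_eq_mul, mul_one]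
    rw [Nat.cast_sub hN1]
    push_cast
    linarith
  have h2 : 1 / (θ (N + 1) - θ N) ≤ t := by
    rw [one_div, inv_le_comm₀ hpos ht0]
    exact hlow
  linarith

lemma norm_powerSum_small_le (k P : ℕ) (hk : 2 ≤ k) (hP : 0 < P) (β : ℝ)
    (hhalf : |β| * (((P : ℝ) + 1) ^ k - (P : ℝ) ^ k) ≤ 1 / 2) :
    ‖powerSum k P β‖ ≤ 4 * (P * (1 + (P : ℝ) ^ k * |β|) ^ (-(1 / k : ℝ))) := by
  have hk0 : (0 : ℝ) < k := by positivity
  have hP0 : (0 : ℝ) < P := by exact_mod_cast hP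
  have hk1 : (1 / k : ℝ) ≤ 1 := by
    rw [div_le_one hk0]
    exact_mod_cast (by omega : 1 ≤ k)
  have h2k : (1 / 2 : ℝ) ≤ (2 : ℝ) ^ (-(1 / k : ℝ)) := by
    calc (1 / 2 : ℝ) = (2 : ℝ) ^ (-1 : ℝ) := by rw [Real.rpow_neg_one]; norm_num
      _ ≤ _ := Real.rpow_le_rpow_of_exponent_le (by norm_num) (by linarith)
  by_cases hβP : 1 < |β| * (P : ℝ) ^ k
  · have hβ : 0 < |β| := by
      by_contra h
      have : |β| = 0 := le_antisymm (not_lt.mp h) (abs_nonneg _)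
      rw [this] at hβP
      norm_num at hβP
    have h1 := norm_powerSum_le_of_pos k P hk |β| hβ hβP hhalf
    have h2 : ‖powerSum k P |β|‖ = ‖powerSum k P β‖ := by
      rcases abs_choice β with h | h
      · rw [h]
      · rw [h, powerSum_neg]
    rw [h2] at h1
    have h3 : (2 * ((P : ℝ) ^ k * |β|)) ^ (-(1 / k : ℝ)) ≤
        (1 + (P : ℝ) ^ k * |β|) ^ (-(1 / k : ℝ)) := by
      refine Real.rpow_le_rpow_of_nonpos (by positivity) (by linarith) ?_
      have : (0 : ℝ) ≤ 1 / k := by positivity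
      linarith
    have h4 : (2 * ((P : ℝ) ^ k * |β|)) ^ (-(1 / k : ℝ)) =
        (2 : ℝ) ^ (-(1 / k : ℝ)) * ((P : ℝ)⁻¹ * |β| ^ (-(1 / k : ℝ))) := by
      rw [Real.mul_rpow (by norm_num) (by positivity), Real.mul_rpow (by positivity) hβ.le,
        ← Real.rpow_natCast (P : ℝ), ← Real.rpow_mul hP0.le, ← Real.rpow_neg_one]
      congr 3
      field_simp
    rw [h4] at h3
    have h5 : |β| ^ (-(1 / k : ℝ)) / 2 ≤ P * (1 + (P : ℝ) ^ k * |β|) ^ (-(1 / k : ℝ)) := by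
      calc |β| ^ (-(1 / k : ℝ)) / 2 = P * (1 / 2 * ((P : ℝ)⁻¹ * |β| ^ (-(1 / k : ℝ)))) := by
            field_simp
        _ ≤ P * ((2 : ℝ) ^ (-(1 / k : ℝ)) * ((P : ℝ)⁻¹ * |β| ^ (-(1 / k : ℝ)))) := by gcongr
        _ ≤ _ := by gcongr
    linarith
  · push Not at hβP
    have h1 := norm_powerSum_le k P β
    have h3 : (2 : ℝ) ^ (-(1 / k : ℝ)) ≤ (1 + (P : ℝ) ^ k * |β|) ^ (-(1 / k : ℝ)) := by
      refine Real.rpow_le_rpow_of_nonpos (by positivity) (by linarith) ?_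
      have : (0 : ℝ) ≤ 1 / k := by positivity
      linarith
    nlinarith

/-- A power saving for complete exponential sums which is strong enough for `2 ^ k + 1`
variables. -/
theorem exists_complete_sum_bound (k : ℕ) (hk : 2 ≤ k) :
    ∃ σ : ℝ, 0 < σ ∧ σ ≤ 1 ∧ 2 < (2 ^ k + 1 : ℝ) * σ ∧ ∃ C : ℝ, 0 < C ∧
      ∀ (q : ℕ) (a : ℤ), 0 < q → IsCoprime a q →
        ‖powerSum k q (a / q)‖ ≤ C * (q : ℝ) ^ (1 - σ) := by
  set X : ℕ := 2 ^ (k - 1) with hX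
  have hXk : (2 : ℝ) ^ k = 2 * X := by
    rw [hX]
    push_cast
    rw [← pow_succ', Nat.sub_add_cancel (by omega)]
  have hX1 : (1 : ℝ) ≤ X := by exact_mod_cast Nat.one_le_two_pow
  have hX0 : (0 : ℝ) < X := by linarith
  set ε : ℝ := 1 / (4 * X) with hε
  have hε0 : 0 < ε := by positivity
  have hε1 : ε ≤ 1 / 4 := by
    rw [hε]
    gcongr
    linarith
  obtain ⟨C, hC, hW⟩ := weyl_inequality k hk ε hε0
  refine ⟨(1 - ε) / X, by apply div_pos <;> linarith, ?_, ?_, (3 * C) ^ (1 / X : ℝ),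
    by positivity, ?_⟩
  · rw [div_le_one hX0]
    linarith
  · rw [hXk, ← mul_div_assoc, lt_div_iff₀ hX0, hε]
    have : (2 * (X : ℝ) + 1) * (1 - 1 / (4 * X)) = 2 * X + (1 / 2 - 1 / (4 * X)) := by
      field_simp
      ring
    rw [this, ← hε]
    linarith
  · intro q a hq haq
    have hq0 : (0 : ℝ) < q := by exact_mod_cast hq
    have hq1 : (1 : ℝ) ≤ q := by exact_mod_cast hq
    have h := hW q q hq hq a (a / q) haq (by simp)
    have hwf : weylFactor k q q ≤ 3 * (q : ℝ) ^ (-1 : ℝ) := by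
      rw [weylFactor, Real.rpow_neg_one]
      have : (q : ℝ) / (q : ℝ) ^ k ≤ 1 / q := by
        rw [div_le_div_iff₀ (by positivity) hq0, one_mul, ← sq]
        exact pow_le_pow_right₀ hq1 hk
      rw [← one_div]
      linarith
    rw [← hX] at h
    have h2 : ‖powerSum k q (a / q)‖ ^ X ≤
        ((3 * C) ^ (1 / X : ℝ) * (q : ℝ) ^ (1 - (1 - ε) / X)) ^ X := by
      calc _ ≤ _ := h
        _ ≤ C * (q : ℝ) ^ ((X : ℝ) + ε) * (3 * (q : ℝ) ^ (-1 : ℝ)) := by gcongr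
        _ = 3 * C * ((q : ℝ) ^ ((X : ℝ) + ε) * (q : ℝ) ^ (-1 : ℝ)) := by ring
        _ = _ := by
          rw [← Real.rpow_add hq0, mul_pow, ← Real.rpow_natCast (_ ^ (1 / X : ℝ)),
            ← Real.rpow_mul (by positivity), ← Real.rpow_natCast ((q : ℝ) ^ (1 - (1 - ε) / X)),
            ← Real.rpow_mul hq0.le, one_div_mul_cancel hX0.ne', Real.rpow_one]
          congr 2
          field_simp
          ring
    exact le_of_pow_le_pow_left₀ (by positivity) (by positivity) h2

lemma natCast_quarter_facts {x q u σ κ : ℝ} (hx : 1 ≤ x) (hq : 1 ≤ q) (hu : 1 ≤ u)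
    (hσ : σ ≤ 1) (hκ : κ ≤ 1 / 2) (hqx : q ≤ x ^ (1 / 4 : ℝ))
    (hux : u ≤ 2 * x ^ (1 / 4 : ℝ)) :
    q * u ≤ 4 * (q ^ (-σ) * x * u ^ (-κ)) := by
  have hx0 : 0 < x := by linarith
  have hq0 : 0 < q := by linarith
  have hu0 : 0 < u := by linarith
  have h1 : q ^ (-1 : ℝ) ≤ q ^ (-σ) := Real.rpow_le_rpow_of_exponent_le hq (by linarith)
  have h2 : u ^ (-1 : ℝ) ≤ u ^ (-κ) := Real.rpow_le_rpow_of_exponent_le hu (by linarith)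
  have h3 : (q * u) * (q * u) ≤ 4 * x := by
    have h4 : q * u ≤ 2 * x ^ (1 / 2 : ℝ) := by
      calc q * u ≤ x ^ (1 / 4 : ℝ) * (2 * x ^ (1 / 4 : ℝ)) := by gcongr
        _ = 2 * (x ^ (1 / 4 : ℝ) * x ^ (1 / 4 : ℝ)) := by ring
        _ = _ := by rw [← Real.rpow_add hx0]; norm_num
    calc _ ≤ (2 * x ^ (1 / 2 : ℝ)) * (2 * x ^ (1 / 2 : ℝ)) := by gcongr
      _ = 4 * (x ^ (1 / 2 : ℝ) * x ^ (1 / 2 : ℝ)) := by ring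
      _ = _ := by rw [← Real.rpow_add hx0]; norm_num
  calc q * u ≤ 4 * (q ^ (-1 : ℝ) * x * u ^ (-1 : ℝ)) := by
        rw [Real.rpow_neg_one, Real.rpow_neg_one]
        rw [show 4 * (q⁻¹ * x * u⁻¹) = 4 * x / (q * u) by field_simp, le_div_iff₀ (by positivity)]
        exact h3
    _ ≤ _ := by gcongr

lemma eventually_small_increment (k : ℕ) (hk : 2 ≤ k) : ∃ P0 : ℕ, 0 < P0 ∧ ∀ P : ℕ, P0 ≤ P →
    ∀ β : ℝ, |β| ≤ (P : ℝ) ^ (1 / 4 - k : ℝ) →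
      |β| * (((P : ℝ) + 1) ^ k - (P : ℝ) ^ k) ≤ 1 / 2 := by
  have hk1 : 1 ≤ k := by omega
  refine ⟨(2 ^ (k + 1)) ^ 2, by positivity, fun P hP β hβ => ?_⟩
  have hP1 : 1 ≤ P := le_trans (Nat.one_le_pow _ _ (by positivity)) hP
  have hx1 : (1 : ℝ) ≤ P := by exact_mod_cast hP1
  have hx : (0 : ℝ) < P := by linarith
  set x : ℝ := (P : ℝ) with hxdef
  have h1 : (x + 1) ^ k - x ^ k ≤ 2 ^ k * x ^ (k - 1) := by
    clear hP hβ
    induction k, hk using Nat.le_induction with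
    | base => norm_num; nlinarith
    | succ n hn ih =>
      have ih' := ih (by omega)
      have h2 : (x + 1) ^ n ≤ 2 ^ n * x ^ n := by
        rw [← mul_pow]
        exact pow_le_pow_left₀ (by positivity) (by linarith) _
      have h3 : x * x ^ (n - 1) = x ^ n := by
        rw [← pow_succ', Nat.sub_add_cancel (by omega)]
      rw [Nat.add_sub_cancel]
      calc (x + 1) ^ (n + 1) - x ^ (n + 1) = x * ((x + 1) ^ n - x ^ n) + (x + 1) ^ n := by ring
        _ ≤ x * (2 ^ n * x ^ (n - 1)) + 2 ^ n * x ^ n := by gcongr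
        _ = 2 ^ n * (x * x ^ (n - 1)) + 2 ^ n * x ^ n := by ring
        _ = _ := by rw [h3]; ring
  have h2 : (2 : ℝ) ^ (k + 1) ≤ x ^ (1 / 2 : ℝ) := by
    rw [← Real.sqrt_eq_rpow]
    refine Real.le_sqrt_of_sq_le ?_
    rw [hxdef]
    exact_mod_cast hP
  have h3 : x ^ (1 / 4 - k : ℝ) * x ^ (k - 1) = x ^ (-(3 / 4) : ℝ) := by
    rw [← Real.rpow_natCast, ← Real.rpow_add hx, Nat.cast_sub hk1]
    congr 1
    push_cast
    ring
  calc _ ≤ x ^ (1 / 4 - k : ℝ) * (2 ^ k * x ^ (k - 1)) := by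
        refine mul_le_mul hβ h1 ?_ (by positivity)
        have : x ^ k ≤ (x + 1) ^ k := by gcongr; linarith
        linarith
    _ = 2 ^ k * x ^ (-(3 / 4) : ℝ) := by rw [← h3]; ring
    _ ≤ 2 ^ k * x ^ (-(1 / 2) : ℝ) := by
        refine mul_le_mul_of_nonneg_left ?_ (by positivity)
        exact Real.rpow_le_rpow_of_exponent_le hx1 (by norm_num)
    _ ≤ 1 / 2 := by
        rw [Real.rpow_neg hx.le, ← div_eq_mul_inv, div_le_div_iff₀ (by positivity) (by norm_num)]
        rw [pow_succ] at h2
        linarith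

/-- The major arc estimate. -/
theorem exists_major_arc_bound (k : ℕ) (hk : 2 ≤ k) (σ : ℝ) (hσ1 : σ ≤ 1) (C : ℝ)
    (hC : 0 < C) (hS : ∀ (q : ℕ) (a : ℤ), 0 < q → IsCoprime a q →
        ‖powerSum k q (a / q)‖ ≤ C * (q : ℝ) ^ (1 - σ)) :
    ∃ C' : ℝ, 0 < C' ∧ ∃ P0 : ℕ, 0 < P0 ∧ ∀ P : ℕ, P0 ≤ P → ∀ (q : ℕ) (a : ℤ) (β : ℝ), 0 < q →
      IsCoprime a q → (q : ℝ) ≤ (P : ℝ) ^ (1 / 4 : ℝ) → |β| ≤ (P : ℝ) ^ (1 / 4 - k : ℝ) →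
        ‖powerSum k P (a / q + β)‖ ≤
          C' * ((q : ℝ) ^ (-σ) * P * (1 + (P : ℝ) ^ k * |β|) ^ (-(1 / k : ℝ))) := by
  obtain ⟨P0, hP0, hinc⟩ := eventually_small_increment k hk
  refine ⟨4 * C + 64, by positivity, P0, hP0, fun P hP q a β hq haq hqP hβ => ?_⟩
  have hPpos : 0 < P := by omega
  have hx1 : (1 : ℝ) ≤ P := by exact_mod_cast hPpos
  have hx : (0 : ℝ) < P := by linarith
  have hq1 : (1 : ℝ) ≤ q := by exact_mod_cast hq
  have hq0 : (0 : ℝ) < q := by linarith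
  have hk2 : (2 : ℝ) ≤ k := by exact_mod_cast hk
  have h1 := norm_powerSum_rat_add_sub_le k P q hPpos hq a β
  have h2 := norm_powerSum_small_le k P hk hPpos β (hinc P hP β hβ)
  have h3 := hS q a hq haq
  set x : ℝ := (P : ℝ) with hxdef
  set u := 1 + x ^ k * |β| with hu
  have hu1 : 1 ≤ u := by
    have : 0 ≤ x ^ k * |β| := by positivity
    linarith
  have hux : u ≤ 2 * x ^ (1 / 4 : ℝ) := by
    have : x ^ k * |β| ≤ x ^ (1 / 4 : ℝ) := by
      calc _ ≤ x ^ k * x ^ (1 / 4 - k : ℝ) := by gcongr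
        _ = _ := by
          rw [← Real.rpow_natCast, ← Real.rpow_add hx]
          congr 1
          ring
    have : 1 ≤ x ^ (1 / 4 : ℝ) := Real.one_le_rpow hx1 (by norm_num)
    linarith
  have hκ : (1 / k : ℝ) ≤ 1 / 2 := one_div_le_one_div_of_le (by norm_num) hk2
  have h4 := natCast_quarter_facts (σ := σ) hx1 hq1 hu1 hσ1 hκ hqP hux
  have hπ : Real.pi < 4 := by linarith [Real.pi_lt_d2]
  have h5 : 2 * q * (1 + 2 * Real.pi * (|β| * x ^ k)) ≤ 16 * (q * u) := by
    have h0 : 0 ≤ |β| * x ^ k := by positivity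
    have : 1 + 2 * Real.pi * (|β| * x ^ k) ≤ 8 * u := by
      rw [hu]
      nlinarith
    nlinarith
  have h6 : ‖powerSum k q (a / q) / q * powerSum k P β‖ ≤
      4 * C * ((q : ℝ) ^ (-σ) * x * u ^ (-(1 / k : ℝ))) := by
    rw [norm_mul, norm_div, Complex.norm_natCast]
    have h7 : ‖powerSum k q (a / q)‖ / q ≤ C * (q : ℝ) ^ (-σ) := by
      rw [div_le_iff₀ hq0]
      refine h3.trans (le_of_eq ?_)
      rw [mul_assoc, ← Real.rpow_add_one hq0.ne']
      congr 2
      ring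
    calc _ ≤ C * (q : ℝ) ^ (-σ) * (4 * (x * u ^ (-(1 / k : ℝ)))) :=
          mul_le_mul h7 h2 (norm_nonneg _) (by positivity)
      _ = _ := by ring
  have h8 := norm_add_le (powerSum k P (a / q + β) - powerSum k q (a / q) / q * powerSum k P β)
    (powerSum k q (a / q) / q * powerSum k P β)
  rw [sub_add_cancel] at h8
  linarith

lemma weylFactor_minor_le (k P q : ℕ) (hP : 0 < P) (h1 : (P : ℝ) ^ (1 / 4 : ℝ) < q)
    (h2 : (q : ℝ) ≤ (P : ℝ) ^ (k - 1 / 4 : ℝ)) :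
    weylFactor k P q ≤ 3 * (P : ℝ) ^ (-(1 / 4) : ℝ) := by
  have hx1 : (1 : ℝ) ≤ P := by exact_mod_cast hP
  have hx : (0 : ℝ) < P := by linarith
  have a1 : 1 / (q : ℝ) ≤ (P : ℝ) ^ (-(1 / 4) : ℝ) := by
    rw [Real.rpow_neg hx.le, ← one_div]
    exact one_div_le_one_div_of_le (by positivity) h1.le
  have a2 : 1 / (P : ℝ) ≤ (P : ℝ) ^ (-(1 / 4) : ℝ) := by
    rw [one_div, ← Real.rpow_neg_one]
    exact Real.rpow_le_rpow_of_exponent_le hx1 (by norm_num)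
  have a3 : (q : ℝ) / (P : ℝ) ^ k ≤ (P : ℝ) ^ (-(1 / 4) : ℝ) := by
    rw [div_le_iff₀ (by positivity), ← Real.rpow_natCast, ← Real.rpow_add hx]
    refine h2.trans (le_of_eq ?_)
    congr 1
    ring
  unfold weylFactor
  linarith

/-- Every real number is either in a major arc or the exponential sum at it has a power saving. -/
theorem exists_minor_arc_bound (k : ℕ) (hk : 2 ≤ k) :
    ∃ τ : ℝ, 0 < τ ∧ ∃ C : ℝ, 0 < C ∧ ∀ P : ℕ, 0 < P → ∀ α : ℝ,
      ‖powerSum k P α‖ ≤ C * (P : ℝ) ^ (1 - τ) ∨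
      ∃ (q : ℕ) (a : ℤ), 0 < q ∧ IsCoprime a q ∧ (q : ℝ) ≤ (P : ℝ) ^ (1 / 4 : ℝ) ∧
        |α - a / q| ≤ (P : ℝ) ^ (1 / 4 - k : ℝ) := by
  obtain ⟨C, hC, hW⟩ := weyl_inequality k hk (1 / 8) (by norm_num)
  set X : ℕ := 2 ^ (k - 1) with hX
  have hX1 : (1 : ℝ) ≤ X := by exact_mod_cast Nat.one_le_two_pow
  have hX0 : (0 : ℝ) < X := by linarith
  refine ⟨1 / (8 * X), by positivity, (3 * C) ^ (1 / X : ℝ), by positivity, fun P hP α => ?_⟩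
  have hx1 : (1 : ℝ) ≤ P := by exact_mod_cast hP
  have hx : (0 : ℝ) < P := by linarith
  have hk2 : (2 : ℝ) ≤ k := by exact_mod_cast hk
  set n := ⌊(P : ℝ) ^ (k - 1 / 4 : ℝ)⌋₊ with hn
  have hn1 : 0 < n := Nat.floor_pos.mpr (Real.one_le_rpow hx1 (by linarith))
  have hn2 : (n : ℝ) ≤ (P : ℝ) ^ (k - 1 / 4 : ℝ) := Nat.floor_le (by positivity)
  have hn3 : (P : ℝ) ^ (k - 1 / 4 : ℝ) < n + 1 := Nat.lt_floor_add_one _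
  obtain ⟨r, hr, hrn⟩ := Real.exists_rat_abs_sub_le_and_den_le α hn1
  have hq : 0 < r.den := r.den_pos
  have hq1 : (1 : ℝ) ≤ r.den := by exact_mod_cast hq
  have hcop : IsCoprime r.num r.den := by
    rw [Int.isCoprime_iff_gcd_eq_one]
    exact r.reduced
  have hrcast : (r : ℝ) = r.num / r.den := by
    exact_mod_cast (Rat.num_div_den r).symm
  rw [hrcast] at hr
  have hrn' : (r.den : ℝ) ≤ n := by exact_mod_cast hrn
  by_cases hsmall : (r.den : ℝ) ≤ (P : ℝ) ^ (1 / 4 : ℝ)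
  · right
    refine ⟨r.den, r.num, hq, hcop, hsmall, hr.trans ?_⟩
    rw [show (1 / 4 - k : ℝ) = -(k - 1 / 4) by ring, Real.rpow_neg hx.le, ← one_div]
    refine one_div_le_one_div_of_le (by positivity) ?_
    nlinarith
  · left
    push Not at hsmall
    have h1 := hW P r.den hP hq r.num α hcop (hr.trans (by
      refine one_div_le_one_div_of_le (by positivity) ?_
      nlinarith))
    have h2 := weylFactor_minor_le k P r.den hP hsmall (hrn'.trans hn2)
    refine le_of_pow_le_pow_left₀ (n := X) (by positivity) (by positivity) ?_
    calc _ ≤ _ := h1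
      _ ≤ C * (P : ℝ) ^ ((X : ℝ) + 1 / 8) * (3 * (P : ℝ) ^ (-(1 / 4) : ℝ)) := by gcongr
      _ = 3 * C * ((P : ℝ) ^ ((X : ℝ) + 1 / 8) * (P : ℝ) ^ (-(1 / 4) : ℝ)) := by ring
      _ = _ := by
        rw [← Real.rpow_add hx, mul_pow, ← Real.rpow_natCast (_ ^ (1 / X : ℝ)),
          ← Real.rpow_mul (by positivity), ← Real.rpow_natCast ((P : ℝ) ^ (1 - 1 / (8 * X) : ℝ)),
          ← Real.rpow_mul hx.le, one_div_mul_cancel hX0.ne', Real.rpow_one]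
        congr 2
        field_simp
        ring

/-- The deviation from one of the average of `e(W h α)` over `0 ≤ h < T`. -/
noncomputable def avgDefect (W : ℤ) (T : ℕ) (α : ℝ) : ℝ :=
  ‖1 - (∑ h ∈ Finset.range T, unitExp (α * ((W * h : ℤ) : ℝ))) / T‖

lemma avgDefect_nonneg (W : ℤ) (T : ℕ) (α : ℝ) : 0 ≤ avgDefect W T α := norm_nonneg _

@[fun_prop] lemma continuous_avgDefect (W : ℤ) (T : ℕ) : Continuous (avgDefect W T) := by
  unfold avgDefect
  fun_prop

lemma avgDefect_le_of_norm_le (W : ℤ) (T : ℕ) (hT : 0 < T) (α B : ℝ)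
    (h : ∀ h < T, ‖1 - unitExp (α * ((W * h : ℤ) : ℝ))‖ ≤ B) : avgDefect W T α ≤ B := by
  have hT' : (0 : ℝ) < T := by exact_mod_cast hT
  have hTc : (T : ℂ) ≠ 0 := by exact_mod_cast hT.ne'
  have e : 1 - (∑ h ∈ Finset.range T, unitExp (α * ((W * h : ℤ) : ℝ))) / T =
      (∑ h ∈ Finset.range T, (1 - unitExp (α * ((W * h : ℤ) : ℝ)))) / T := by
    rw [Finset.sum_sub_distrib, Finset.sum_const, Finset.card_range, nsmul_eq_mul, mul_one,
      sub_div, div_self hTc]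
  rw [avgDefect, e, norm_div, Complex.norm_natCast, div_le_iff₀ hT']
  refine (norm_sum_le _ _).trans
    ((Finset.sum_le_sum fun i hi => h i (Finset.mem_range.mp hi)).trans ?_)
  simp [mul_comm]

lemma avgDefect_le_two (W : ℤ) (T : ℕ) (hT : 0 < T) (α : ℝ) : avgDefect W T α ≤ 2 := by
  refine avgDefect_le_of_norm_le W T hT α 2 fun h _ => ?_
  refine (norm_sub_le _ _).trans ?_
  rw [norm_unitExp, norm_one]
  norm_num

lemma avgDefect_le_of_dvd (W : ℤ) (T : ℕ) (hT : 0 < T) (α : ℝ) (q : ℕ) (a : ℤ) (hq : 0 < q)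
    (hqW : (q : ℤ) ∣ W) :
    avgDefect W T α ≤ 2 * Real.pi * ((W.natAbs : ℝ) * T * |α - a / q|) := by
  have hq' : (q : ℝ) ≠ 0 := by exact_mod_cast hq.ne'
  obtain ⟨w, rfl⟩ := hqW
  refine avgDefect_le_of_norm_le _ T hT α _ fun h hh => ?_
  have e : unitExp (α * (((q : ℤ) * w * h : ℤ) : ℝ)) =
      unitExp ((α - a / q) * (((q : ℤ) * w * h : ℤ) : ℝ)) := by
    rw [← unitExp_add_int ((α - a / q) * (((q : ℤ) * w * h : ℤ) : ℝ)) (a * w * h)]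
    congr 1
    push_cast
    field_simp
    ring
  rw [e, norm_sub_rev]
  refine (norm_unitExp_sub_one_le _).trans ?_
  have hh' : (h : ℝ) ≤ T := by exact_mod_cast hh.le
  have hW : |((((q : ℤ) * w * h : ℤ)) : ℝ)| = (((q : ℤ) * w).natAbs : ℝ) * h := by
    rw [Nat.cast_natAbs, ← Int.cast_abs, abs_mul _ (h : ℤ)]
    push_cast
    simp
  rw [abs_mul, hW, mul_comm |α - a / q|]
  gcongr

open MeasureTheory in
lemma integral_decay_le (D : ℝ) (hD : 0 < D) (c : ℝ) :
    ∫ α in (0 : ℝ)..1, (1 + D * |α - c|) ^ (-(3 / 2) : ℝ) ≤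
      D⁻¹ * ∫ u : ℝ, (1 + |u|) ^ (-(3 / 2) : ℝ) := by
  have hmean : Integrable fun u : ℝ => (1 + |u|) ^ (-(3 / 2) : ℝ) := by
    have := integrable_one_add_norm (E := ℝ) (μ := volume) (r := 3 / 2) (by norm_num)
    simpa using this
  have h1 : Integrable fun u : ℝ => (1 + |D * (u - c)|) ^ (-(3 / 2) : ℝ) :=
    (hmean.comp_mul_left' hD.ne').comp_sub_right c
  have h2 : ∫ u : ℝ, (1 + |D * (u - c)|) ^ (-(3 / 2) : ℝ) =
      D⁻¹ * ∫ u : ℝ, (1 + |u|) ^ (-(3 / 2) : ℝ) := by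
    rw [integral_sub_right_eq_self (fun u : ℝ => (1 + |D * u|) ^ (-(3 / 2) : ℝ)) c,
      Measure.integral_comp_mul_left (fun u : ℝ => (1 + |u|) ^ (-(3 / 2) : ℝ)) D,
      abs_of_pos (by positivity), smul_eq_mul]
  have h3 : (fun α : ℝ => (1 + D * |α - c|) ^ (-(3 / 2) : ℝ)) =
      fun u : ℝ => (1 + |D * (u - c)|) ^ (-(3 / 2) : ℝ) := by
    ext u
    rw [abs_mul, abs_of_pos hD]
  rw [h3, intervalIntegral.integral_of_le zero_le_one, ← h2]
  exact setIntegral_le_integral h1 (Filter.Eventually.of_forall fun u => by positivity)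

lemma rpow_neg_mul_le_rpow (u r : ℝ) (hu : 0 ≤ u) (hr : 5 / 2 ≤ r) :
    (1 + u) ^ (-r) * u ≤ (1 + u) ^ (-(3 / 2) : ℝ) := by
  have h1 : (1 + u) ^ (-r) ≤ (1 + u) ^ (-(5 / 2) : ℝ) :=
    Real.rpow_le_rpow_of_exponent_le (by linarith) (by linarith)
  have h2 : (1 + u) ^ (-(3 / 2) : ℝ) = (1 + u) ^ (-(5 / 2) : ℝ) * (1 + u) := by
    rw [← Real.rpow_add_one (by positivity)]
    norm_num
  rw [h2]
  exact mul_le_mul h1 (by linarith) hu (by positivity)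

lemma five_halves_mul_le_two_pow (k : ℕ) (hk : 2 ≤ k) : 5 / 2 * (k : ℝ) ≤ 2 ^ k + 1 := by
  induction k, hk using Nat.le_induction with
  | base => norm_num
  | succ n hn ih =>
    have : (2 : ℝ) ≤ n := by exact_mod_cast hn
    rw [pow_succ]
    push_cast
    linarith

lemma exists_finset_weighted_sum_le (e δ : ℝ) (he : 1 < e) (hδ : 0 < δ) :
    ∃ S : Finset ℕ, ∃ Z : ℝ, 0 < Z ∧ ∀ (x : ℝ), 0 ≤ x → ∀ U : Finset ℕ,
      ∑ q ∈ U, (q : ℝ) ^ (-e) * (if q ∈ S then x else 2) ≤ x * Z + δ := by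
  have hs : Summable fun q : ℕ => (q : ℝ) ^ (-e) := Real.summable_nat_rpow.mpr (by linarith)
  obtain ⟨S, hS⟩ := summable_iff_vanishing_norm.mp hs (δ / 2) (by positivity)
  refine ⟨S, ∑' q : ℕ, (q : ℝ) ^ (-e) + 1, ?_, fun x hx U => ?_⟩
  · have : 0 ≤ ∑' q : ℕ, (q : ℝ) ^ (-e) := tsum_nonneg fun q => by positivity
    linarith
  classical
  rw [← Finset.sum_filter_add_sum_filter_not U (· ∈ S)]
  refine add_le_add ?_ ?_
  · calc ∑ q ∈ U with q ∈ S, (q : ℝ) ^ (-e) * (if q ∈ S then x else 2)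
        = x * ∑ q ∈ U with q ∈ S, (q : ℝ) ^ (-e) := by
          rw [Finset.mul_sum]
          refine Finset.sum_congr rfl fun q hq => ?_
          rw [if_pos (Finset.mem_filter.mp hq).2, mul_comm]
      _ ≤ x * (∑' q : ℕ, (q : ℝ) ^ (-e) + 1) := by
          refine mul_le_mul_of_nonneg_left ?_ hx
          have := hs.sum_le_tsum (U.filter (· ∈ S)) fun q _ => by positivity
          linarith
  · have h := hS (U.filter (· ∉ S)) (Finset.disjoint_left.mpr fun q hq =>
      (Finset.mem_filter.mp hq).2)
    have h2 := (le_abs_self _).trans_lt h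
    calc ∑ q ∈ U with q ∉ S, (q : ℝ) ^ (-e) * (if q ∈ S then x else 2)
        = 2 * ∑ q ∈ U with q ∉ S, (q : ℝ) ^ (-e) := by
          rw [Finset.mul_sum]
          refine Finset.sum_congr rfl fun q hq => ?_
          rw [if_neg (Finset.mem_filter.mp hq).2, mul_comm]
      _ ≤ δ := by linarith

/-- The majorant on the major arcs: a sum of decaying bumps around rationals. -/
noncomputable def bumpSum (k P : ℕ) (w : ℕ → ℝ) (α : ℝ) : ℝ :=
  ∑ q ∈ Finset.Icc 1 P, ∑ a ∈ Finset.Icc (-(2 * q) : ℤ) (2 * q),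
    w q * (1 + (P : ℝ) ^ k * |α - a / q|) ^ (-(3 / 2) : ℝ)

lemma continuous_bump (b D c : ℝ) (hD : 0 ≤ D) :
    Continuous fun α : ℝ => b * (1 + D * |α - c|) ^ (-(3 / 2) : ℝ) := by
  refine continuous_const.mul (Continuous.rpow_const (by fun_prop) fun x => Or.inl ?_)
  positivity

lemma continuous_bumpSum (k P : ℕ) (w : ℕ → ℝ) : Continuous (bumpSum k P w) := by
  unfold bumpSum
  refine continuous_finsetSum _ fun q _ => continuous_finsetSum _ fun a _ =>
    continuous_bump _ _ _ (by positivity)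

lemma bumpSum_nonneg (k P : ℕ) (w : ℕ → ℝ) (hw : ∀ q, 0 ≤ w q) (α : ℝ) :
    0 ≤ bumpSum k P w α := by
  refine Finset.sum_nonneg fun q _ => Finset.sum_nonneg fun a _ => ?_
  have := hw q
  positivity

lemma bump_le_bumpSum (k P : ℕ) (w : ℕ → ℝ) (hw : ∀ q, 0 ≤ w q) (α : ℝ) (q : ℕ) (a : ℤ)
    (hq : 0 < q) (hqP : q ≤ P) (hα : α ∈ Set.Icc (0 : ℝ) 1) (ha : |α - a / q| ≤ 1) :
    w q * (1 + (P : ℝ) ^ k * |α - a / q|) ^ (-(3 / 2) : ℝ) ≤ bumpSum k P w α := by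
  have hnn : ∀ (q : ℕ) (a : ℤ),
      0 ≤ w q * (1 + (P : ℝ) ^ k * |α - a / q|) ^ (-(3 / 2) : ℝ) := fun q a => by
    have := hw q
    positivity
  have hq' : (0 : ℝ) < q := by exact_mod_cast hq
  obtain ⟨h1, h2⟩ := abs_le.mp ha
  have e : (a : ℝ) = a / q * q := by field_simp
  have ha1 : (a : ℝ) ≤ 2 * q := by
    rw [e]
    exact mul_le_mul_of_nonneg_right (by linarith [hα.2]) hq'.le
  have ha2 : -(2 * q : ℝ) ≤ a := by
    rw [e, ← neg_mul]
    exact mul_le_mul_of_nonneg_right (by linarith [hα.1]) hq'.le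
  have ham : a ∈ Finset.Icc (-(2 * q) : ℤ) (2 * q) :=
    Finset.mem_Icc.mpr ⟨by exact_mod_cast ha2, by exact_mod_cast ha1⟩
  refine le_trans ?_ (Finset.single_le_sum (f := fun q : ℕ =>
    ∑ a ∈ Finset.Icc (-(2 * q) : ℤ) (2 * q),
      w q * (1 + (P : ℝ) ^ k * |α - a / q|) ^ (-(3 / 2) : ℝ))
    (fun q _ => Finset.sum_nonneg fun a _ => hnn q a) (Finset.mem_Icc.mpr ⟨hq, hqP⟩))
  exact Finset.single_le_sum (f := fun a : ℤ =>
      w q * (1 + (P : ℝ) ^ k * |α - a / q|) ^ (-(3 / 2) : ℝ)) (fun a _ => hnn q a) ham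

lemma integral_bumpSum_le (k P : ℕ) (hP : 0 < P) (w : ℕ → ℝ) (hw : ∀ q, 0 ≤ w q) :
    ∫ α in (0 : ℝ)..1, bumpSum k P w α ≤
      5 * (∫ u : ℝ, (1 + |u|) ^ (-(3 / 2) : ℝ)) / (P : ℝ) ^ k *
        ∑ q ∈ Finset.Icc 1 P, w q * q := by
  have hP' : (0 : ℝ) < P := by exact_mod_cast hP
  have hD : (0 : ℝ) < (P : ℝ) ^ k := by positivity
  have hJ : 0 ≤ ∫ u : ℝ, (1 + |u|) ^ (-(3 / 2) : ℝ) :=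
    MeasureTheory.integral_nonneg fun u => by positivity
  unfold bumpSum
  rw [intervalIntegral.integral_finsetSum fun q _ => (continuous_finsetSum _ fun a _ =>
    continuous_bump _ _ _ hD.le).intervalIntegrable _ _, Finset.mul_sum]
  refine Finset.sum_le_sum fun q hq => ?_
  rw [intervalIntegral.integral_finsetSum fun a _ =>
    (continuous_bump _ _ _ hD.le).intervalIntegrable _ _]
  have hq1 : 1 ≤ q := (Finset.mem_Icc.mp hq).1
  have hcard : ((Finset.Icc (-(2 * q) : ℤ) (2 * q)).card : ℝ) ≤ 5 * q := by
    rw [Int.card_Icc]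
    have : (2 * q + 1 - -(2 * q) : ℤ).toNat ≤ 5 * q := by omega
    exact_mod_cast this
  set J := ∫ u : ℝ, (1 + |u|) ^ (-(3 / 2) : ℝ) with hJdef
  calc ∑ a ∈ Finset.Icc (-(2 * q) : ℤ) (2 * q), ∫ α in (0 : ℝ)..1,
        w q * (1 + (P : ℝ) ^ k * |α - a / q|) ^ (-(3 / 2) : ℝ)
      ≤ ∑ a ∈ Finset.Icc (-(2 * q) : ℤ) (2 * q), w q * (((P : ℝ) ^ k)⁻¹ * J) := by
        refine Finset.sum_le_sum fun a _ => ?_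
        rw [intervalIntegral.integral_const_mul]
        exact mul_le_mul_of_nonneg_left (integral_decay_le _ hD _) (hw q)
    _ = (Finset.Icc (-(2 * q) : ℤ) (2 * q)).card * (w q * (((P : ℝ) ^ k)⁻¹ * J)) := by
        rw [Finset.sum_const, nsmul_eq_mul]
    _ ≤ 5 * q * (w q * (((P : ℝ) ^ k)⁻¹ * J)) := by
        refine mul_le_mul_of_nonneg_right hcard ?_
        have := hw q
        positivity
    _ = 5 * J / (P : ℝ) ^ k * (w q * q) := by
        rw [div_eq_mul_inv]
        ring

/-- Mean value estimate for powers of `powerSum` weighted by `avgDefect`, at the exponent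
`2 ^ k + 1`. -/
lemma exists_integral_avgDefect_le_base (k : ℕ) (hk : 2 ≤ k) (ε : ℝ) (hε : 0 < ε) :
    ∃ W0 : ℕ, 0 < W0 ∧ ∃ η : ℝ, 0 < η ∧ ∃ P0 : ℕ, 0 < P0 ∧ ∀ P : ℕ, P0 ≤ P → ∀ W : ℤ,
      (W0 : ℤ) ∣ W → ∀ T : ℕ, 0 < T → (W.natAbs : ℝ) * T ≤ η * (P : ℝ) ^ k →
        ∫ α in (0 : ℝ)..1, ‖powerSum k P α‖ ^ (2 ^ k + 1) * avgDefect W T α ≤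
          ε * ((P : ℝ) ^ (2 ^ k + 1) / (P : ℝ) ^ k) := by
  obtain ⟨σ, hσ0, hσ1, hσ, C, hC, hcs⟩ := exists_complete_sum_bound k hk
  obtain ⟨C', hC', P1, hP1, hmaj⟩ := exists_major_arc_bound k hk σ hσ1 C hC hcs
  obtain ⟨τ, hτ, C1, hC1, hmin⟩ := exists_minor_arc_bound k hk
  obtain ⟨C2, hC2, hhua⟩ := hua_inequality k hk (τ / 2) (by positivity)
  set n : ℕ := 2 ^ k + 1 with hn
  have hnr : (n : ℝ) = 2 ^ k + 1 := by rw [hn]; push_cast; rfl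
  set J := ∫ u : ℝ, (1 + |u|) ^ (-(3 / 2) : ℝ) with hJdef
  have hJ : 0 ≤ J := MeasureTheory.integral_nonneg fun u => by positivity
  set B : ℝ := 5 * J * C' ^ n + 1 with hB
  have hB0 : 0 < B := by positivity
  set δ : ℝ := ε / (4 * B) with hδdef
  have hδ : 0 < δ := by positivity
  obtain ⟨S, Z, hZ, hSZ⟩ := exists_finset_weighted_sum_le (n * σ - 1) δ
    (by rw [hnr]; linarith) hδ
  have hpi := Real.pi_pos
  set η : ℝ := δ / (2 * Real.pi * Z) with hηdef
  have hη : 0 < η := by positivity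
  have hev : ∀ᶠ P : ℕ in Filter.atTop, (P : ℝ) ^ (-(τ / 2)) < ε / (4 * C1 * C2) := by
    have := (tendsto_rpow_neg_atTop (show 0 < τ / 2 by positivity)).comp
      tendsto_natCast_atTop_atTop
    exact this.eventually (gt_mem_nhds (by positivity))
  obtain ⟨P2, hP2⟩ := Filter.eventually_atTop.mp hev
  refine ⟨∏ q ∈ S.erase 0, q, Finset.prod_pos fun q hq =>
    Nat.pos_of_ne_zero (Finset.ne_of_mem_erase hq), η, hη, max P1 P2, by omega,
    fun P hP W hW T hT hWT => ?_⟩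
  have hPP1 : P1 ≤ P := le_trans (le_max_left _ _) hP
  have hP0 : 0 < P := by omega
  have hx1 : (1 : ℝ) ≤ P := by exact_mod_cast hP0
  have hx : (0 : ℝ) < P := by linarith
  have hk0 : (0 : ℝ) < k := by
    have : 0 < k := by omega
    exact_mod_cast this
  set w : ℕ → ℝ := fun q => C' ^ n * (P : ℝ) ^ n * ((q : ℝ) ^ (-(n * σ)) *
    (if q ∈ S then 2 * Real.pi * η else 2)) with hw
  have hw0 : ∀ q, 0 ≤ w q := fun q => by
    rw [hw]
    dsimp only
    split_ifs <;> positivity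
  have hr : 5 / 2 ≤ (n : ℝ) / k := by
    rw [le_div_iff₀ hk0, hnr]
    exact five_halves_mul_le_two_pow k hk
  have hpt : ∀ α ∈ Set.Icc (0 : ℝ) 1, ‖powerSum k P α‖ ^ n * avgDefect W T α ≤
      2 * (C1 * (P : ℝ) ^ (1 - τ)) * ‖powerSum k P α‖ ^ 2 ^ k + bumpSum k P w α := by
    intro α hα
    rcases hmin P hP0 α with h | ⟨q, a, hq, haq, hqP, hβ⟩
    · have h1 : ‖powerSum k P α‖ ^ n * avgDefect W T α ≤
          (C1 * (P : ℝ) ^ (1 - τ) * ‖powerSum k P α‖ ^ 2 ^ k) * 2 := by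
        refine mul_le_mul ?_ (avgDefect_le_two W T hT α) (avgDefect_nonneg _ _ _) (by positivity)
        rw [hn, pow_succ']
        exact mul_le_mul_of_nonneg_right h (by positivity)
      have := bumpSum_nonneg k P w hw0 α
      linarith
    · have hm := hmaj P hPP1 q a (α - a / q) hq haq hqP hβ
      rw [add_sub_cancel] at hm
      set β := |α - a / q| with hβdef
      have hβ0 : 0 ≤ β := abs_nonneg _
      have hu0 : 0 ≤ (P : ℝ) ^ k * β := by positivity
      have hm2 : ‖powerSum k P α‖ ^ n ≤ C' ^ n * (P : ℝ) ^ n * (q : ℝ) ^ (-(n * σ)) *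
          (1 + (P : ℝ) ^ k * β) ^ (-((n : ℝ) / k)) := by
        refine (pow_le_pow_left₀ (norm_nonneg _) hm n).trans (le_of_eq ?_)
        rw [mul_pow, mul_pow, mul_pow, ← Real.rpow_mul_natCast (by positivity),
          ← Real.rpow_mul_natCast (by positivity)]
        rw [show -σ * (n : ℝ) = -(n * σ) by ring,
          show -(1 / k : ℝ) * (n : ℝ) = -((n : ℝ) / k) by ring]
        ring
      have hβ1 : β ≤ 1 := hβ.trans (Real.rpow_le_one_of_one_le_of_nonpos hx1 (by
        have : (2 : ℝ) ≤ k := by exact_mod_cast hk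
        linarith))
      have hqP' : q ≤ P := by
        have : (q : ℝ) ≤ P := hqP.trans (by
          conv_rhs => rw [← Real.rpow_one (P : ℝ)]
          exact Real.rpow_le_rpow_of_exponent_le hx1 (by norm_num))
        exact_mod_cast this
      have hb := bump_le_bumpSum k P w hw0 α q a hq hqP' hα hβ1
      have key : (1 + (P : ℝ) ^ k * β) ^ (-((n : ℝ) / k)) * avgDefect W T α ≤
          (if q ∈ S then 2 * Real.pi * η else 2) *
            (1 + (P : ℝ) ^ k * β) ^ (-(3 / 2) : ℝ) := by
        split_ifs with hqS
        · have hdvd : (q : ℤ) ∣ W := by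
            refine dvd_trans ?_ hW
            exact_mod_cast Finset.dvd_prod_of_mem (fun q => q)
              (Finset.mem_erase.mpr ⟨hq.ne', hqS⟩)
          have h1 := avgDefect_le_of_dvd W T hT α q a hq hdvd
          have h2 : avgDefect W T α ≤ 2 * Real.pi * η * ((P : ℝ) ^ k * β) := by
            refine h1.trans ?_
            calc 2 * Real.pi * ((W.natAbs : ℝ) * T * |α - a / q|)
                ≤ 2 * Real.pi * (η * (P : ℝ) ^ k * |α - a / q|) := by gcongr
              _ = _ := by ring
          calc (1 + (P : ℝ) ^ k * β) ^ (-((n : ℝ) / k)) * avgDefect W T α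
              ≤ (1 + (P : ℝ) ^ k * β) ^ (-((n : ℝ) / k)) *
                (2 * Real.pi * η * ((P : ℝ) ^ k * β)) :=
                mul_le_mul_of_nonneg_left h2 (by positivity)
            _ = 2 * Real.pi * η * ((1 + (P : ℝ) ^ k * β) ^ (-((n : ℝ) / k)) *
                ((P : ℝ) ^ k * β)) := by ring
            _ ≤ _ := mul_le_mul_of_nonneg_left (rpow_neg_mul_le_rpow _ _ hu0 hr) (by positivity)
        · rw [mul_comm]
          refine mul_le_mul (avgDefect_le_two W T hT α) ?_ (by positivity) (by norm_num)
          exact Real.rpow_le_rpow_of_exponent_le (by linarith) (by linarith)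
      have h3 : ‖powerSum k P α‖ ^ n * avgDefect W T α ≤ w q *
          (1 + (P : ℝ) ^ k * β) ^ (-(3 / 2) : ℝ) := by
        calc ‖powerSum k P α‖ ^ n * avgDefect W T α
            ≤ (C' ^ n * (P : ℝ) ^ n * (q : ℝ) ^ (-(n * σ)) *
              (1 + (P : ℝ) ^ k * β) ^ (-((n : ℝ) / k))) * avgDefect W T α :=
              mul_le_mul_of_nonneg_right hm2 (avgDefect_nonneg _ _ _)
          _ = C' ^ n * (P : ℝ) ^ n * (q : ℝ) ^ (-(n * σ)) *
              ((1 + (P : ℝ) ^ k * β) ^ (-((n : ℝ) / k)) * avgDefect W T α) := by ring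
          _ ≤ C' ^ n * (P : ℝ) ^ n * (q : ℝ) ^ (-(n * σ)) *
              ((if q ∈ S then 2 * Real.pi * η else 2) *
                (1 + (P : ℝ) ^ k * β) ^ (-(3 / 2) : ℝ)) :=
              mul_le_mul_of_nonneg_left key (by positivity)
          _ = _ := by rw [hw]; ring
      have : 0 ≤ 2 * (C1 * (P : ℝ) ^ (1 - τ)) * ‖powerSum k P α‖ ^ 2 ^ k := by positivity
      linarith
  have c1 : Continuous fun α => ‖powerSum k P α‖ ^ n * avgDefect W T α :=
    ((continuous_powerSum k P).norm.pow n).mul (continuous_avgDefect W T)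
  have c2 : Continuous fun α => 2 * (C1 * (P : ℝ) ^ (1 - τ)) * ‖powerSum k P α‖ ^ 2 ^ k :=
    continuous_const.mul ((continuous_powerSum k P).norm.pow _)
  have c3 := continuous_bumpSum k P w
  have hI := intervalIntegral.integral_mono_on (μ := MeasureTheory.volume) zero_le_one
    (c1.intervalIntegrable 0 1) ((c2.add c3).intervalIntegrable 0 1) hpt
  simp only [Pi.add_apply] at hI
  rw [intervalIntegral.integral_add (c2.intervalIntegrable 0 1) (c3.intervalIntegrable 0 1),
    intervalIntegral.integral_const_mul] at hI
  refine hI.trans ?_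
  have hpart1 : 2 * (C1 * (P : ℝ) ^ (1 - τ)) * ∫ α in (0 : ℝ)..1, ‖powerSum k P α‖ ^ 2 ^ k ≤
      ε / 2 * ((P : ℝ) ^ n / (P : ℝ) ^ k) := by
    have e : (P : ℝ) ^ n / (P : ℝ) ^ k = (P : ℝ) ^ ((n : ℝ) - k) := by
      rw [Real.rpow_sub hx, Real.rpow_natCast, Real.rpow_natCast]
    calc 2 * (C1 * (P : ℝ) ^ (1 - τ)) * ∫ α in (0 : ℝ)..1, ‖powerSum k P α‖ ^ 2 ^ k
        ≤ 2 * (C1 * (P : ℝ) ^ (1 - τ)) * (C2 * (P : ℝ) ^ ((2 ^ k : ℝ) - k + τ / 2)) :=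
          mul_le_mul_of_nonneg_left (hhua P hP0) (by positivity)
      _ = 2 * C1 * C2 * ((P : ℝ) ^ (1 - τ) * (P : ℝ) ^ ((2 ^ k : ℝ) - k + τ / 2)) := by ring
      _ = 2 * C1 * C2 * ((P : ℝ) ^ (-(τ / 2)) * (P : ℝ) ^ ((n : ℝ) - k)) := by
          rw [← Real.rpow_add hx, ← Real.rpow_add hx, hnr]
          congr 2
          ring
      _ ≤ 2 * C1 * C2 * (ε / (4 * C1 * C2) * (P : ℝ) ^ ((n : ℝ) - k)) := by
          refine mul_le_mul_of_nonneg_left (mul_le_mul_of_nonneg_right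
            (hP2 P (le_trans (le_max_right _ _) hP)).le (by positivity)) (by positivity)
      _ = ε / 2 * ((P : ℝ) ^ n / (P : ℝ) ^ k) := by
          rw [e]
          field_simp
          ring
  have hpart2 : ∫ α in (0 : ℝ)..1, bumpSum k P w α ≤ ε / 2 * ((P : ℝ) ^ n / (P : ℝ) ^ k) := by
    refine (integral_bumpSum_le k P hP0 w hw0).trans ?_
    have hsum : ∑ q ∈ Finset.Icc 1 P, w q * q ≤ C' ^ n * (P : ℝ) ^ n * (2 * δ) := by
      have h1 := hSZ (2 * Real.pi * η) (by positivity) (Finset.Icc 1 P)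
      have h2 : 2 * Real.pi * η * Z = δ := by
        rw [hηdef]
        field_simp
      rw [h2] at h1
      calc ∑ q ∈ Finset.Icc 1 P, w q * q
          = C' ^ n * (P : ℝ) ^ n * ∑ q ∈ Finset.Icc 1 P, (q : ℝ) ^ (-(n * σ - 1)) *
            (if q ∈ S then 2 * Real.pi * η else 2) := by
            rw [Finset.mul_sum]
            refine Finset.sum_congr rfl fun q hq => ?_
            have hq1 : (0 : ℝ) < q := by exact_mod_cast (Finset.mem_Icc.mp hq).1
            rw [show -(n * σ - 1) = -(n * σ) + 1 by ring, Real.rpow_add_one hq1.ne', hw]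
            ring
        _ ≤ C' ^ n * (P : ℝ) ^ n * (2 * δ) :=
            mul_le_mul_of_nonneg_left (by linarith) (by positivity)
    calc 5 * J / (P : ℝ) ^ k * ∑ q ∈ Finset.Icc 1 P, w q * q
        ≤ 5 * J / (P : ℝ) ^ k * (C' ^ n * (P : ℝ) ^ n * (2 * δ)) :=
          mul_le_mul_of_nonneg_left hsum (by positivity)
      _ = (5 * J * C' ^ n) * (2 * δ) * ((P : ℝ) ^ n / (P : ℝ) ^ k) := by
          rw [div_eq_mul_inv, div_eq_mul_inv]
          ring
      _ ≤ B * (2 * δ) * ((P : ℝ) ^ n / (P : ℝ) ^ k) := by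
          refine mul_le_mul_of_nonneg_right (mul_le_mul_of_nonneg_right ?_ (by positivity))
            (by positivity)
          rw [hB]
          linarith
      _ = ε / 2 * ((P : ℝ) ^ n / (P : ℝ) ^ k) := by
          rw [hδdef]
          field_simp
          ring
  linarith

/-- Mean value estimate for powers of `powerSum` weighted by `avgDefect`. -/
theorem exists_integral_avgDefect_le (k s : ℕ) (hk : 2 ≤ k) (hs : 2 ^ k + 1 ≤ s) (ε : ℝ)
    (hε : 0 < ε) :
    ∃ W0 : ℕ, 0 < W0 ∧ ∃ η : ℝ, 0 < η ∧ ∃ P0 : ℕ, 0 < P0 ∧ ∀ P : ℕ, P0 ≤ P → ∀ W : ℤ,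
      (W0 : ℤ) ∣ W → ∀ T : ℕ, 0 < T → (W.natAbs : ℝ) * T ≤ η * (P : ℝ) ^ k →
        ∫ α in (0 : ℝ)..1, ‖powerSum k P α‖ ^ s * avgDefect W T α ≤
          ε * ((P : ℝ) ^ s / (P : ℝ) ^ k) := by
  obtain ⟨W0, hW0, η, hη, P0, hP0, h⟩ := exists_integral_avgDefect_le_base k hk ε hε
  refine ⟨W0, hW0, η, hη, P0, hP0, fun P hP W hW T hT hWT => ?_⟩
  have h1 := h P hP W hW T hT hWT
  obtain ⟨r, rfl⟩ := Nat.exists_eq_add_of_le' hs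
  have hc : ∀ m : ℕ, Continuous fun α => ‖powerSum k P α‖ ^ m * avgDefect W T α := fun m =>
    ((continuous_powerSum k P).norm.pow m).mul (continuous_avgDefect W T)
  calc ∫ α in (0 : ℝ)..1, ‖powerSum k P α‖ ^ (r + (2 ^ k + 1)) * avgDefect W T α
      ≤ ∫ α in (0 : ℝ)..1, (P : ℝ) ^ r *
        (‖powerSum k P α‖ ^ (2 ^ k + 1) * avgDefect W T α) := by
        refine intervalIntegral.integral_mono_on zero_le_one ((hc _).intervalIntegrable 0 1)
          ((continuous_const.mul (hc _)).intervalIntegrable 0 1) fun α _ => ?_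
        rw [pow_add, mul_assoc]
        refine mul_le_mul_of_nonneg_right
          (pow_le_pow_left₀ (norm_nonneg _) (norm_powerSum_le k P α) r) ?_
        have := avgDefect_nonneg W T α
        positivity
    _ = (P : ℝ) ^ r * ∫ α in (0 : ℝ)..1,
        ‖powerSum k P α‖ ^ (2 ^ k + 1) * avgDefect W T α := by
        rw [intervalIntegral.integral_const_mul]
    _ ≤ (P : ℝ) ^ r * (ε * ((P : ℝ) ^ (2 ^ k + 1) / (P : ℝ) ^ k)) :=
        mul_le_mul_of_nonneg_left h1 (by positivity)
    _ = _ := by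
        rw [pow_add _ r]
        ring

/-- The set of values of `∑ i ∈ J, c i * y i`, where each `y i` is zero or lies in `H`. -/
def valueSet {R ι : Type*} [CommRing R] (H : Subgroup Rˣ) (c : ι → R) (J : Finset ι) : Set R :=
  {v | ∃ y : ι → R, (∀ i, y i = 0 ∨ ∃ h ∈ H, y i = (h : R)) ∧ v = ∑ i ∈ J, c i * y i}

section ValueSet

variable {R ι : Type*} [CommRing R] (H : Subgroup Rˣ) (c : ι → R) (J : Finset ι)

lemma zero_mem_valueSet : (0 : R) ∈ valueSet H c J :=
  ⟨fun _ => 0, fun _ => Or.inl rfl, by simp⟩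

lemma mul_mem_valueSet {h : Rˣ} (hh : h ∈ H) {v : R} (hv : v ∈ valueSet H c J) :
    (h : R) * v ∈ valueSet H c J := by
  obtain ⟨y, hy, rfl⟩ := hv
  refine ⟨fun i => h * y i, fun i => ?_, ?_⟩
  · rcases hy i with h0 | ⟨g, hg, hgi⟩
    · exact Or.inl (by simp [h0])
    · exact Or.inr ⟨h * g, H.mul_mem hh hg, by simp [hgi]⟩
  · rw [Finset.mul_sum]
    exact Finset.sum_congr rfl fun i _ => by ring

variable [DecidableEq ι]

lemma add_mem_valueSet_insert {j : ι} (hj : j ∉ J) {v z : R} (hv : v ∈ valueSet H c J)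
    (hz : z = 0 ∨ ∃ h ∈ H, z = (h : R)) : v + c j * z ∈ valueSet H c (insert j J) := by
  obtain ⟨y, hy, rfl⟩ := hv
  refine ⟨Function.update y j z, fun i => ?_, ?_⟩
  · by_cases hij : i = j
    · subst hij
      simpa using hz
    · rw [Function.update_of_ne hij]
      exact hy i
  · rw [Finset.sum_insert hj, Function.update_self, add_comm]
    congr 1
    refine Finset.sum_congr rfl fun i hi => ?_
    rw [Function.update_of_ne (by rintro rfl; exact hj hi)]

lemma valueSet_subset_insert {j : ι} (hj : j ∉ J) :
    valueSet H c J ⊆ valueSet H c (insert j J) := fun v hv => by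
  simpa using add_mem_valueSet_insert H c J hj hv (Or.inl rfl)

lemma valueSet_insert_growth [Finite R]
    (hfree : ∀ h ∈ H, ∀ b : R, b ≠ 0 → (h : R) * b = b → h = 1) {j : ι} (hj : j ∉ J) :
    (∀ v ∈ valueSet H c J, v + c j ∈ valueSet H c J) ∨
      (valueSet H c J).ncard + Nat.card H ≤ (valueSet H c (insert j J)).ncard := by
  by_cases hsub : valueSet H c (insert j J) ⊆ valueSet H c J
  · left
    intro v hv
    refine hsub ?_
    have := add_mem_valueSet_insert H c J hj hv (z := 1) (Or.inr ⟨1, H.one_mem, by simp⟩)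
    simpa using this
  · right
    obtain ⟨b, hb, hb'⟩ := Set.not_subset.mp hsub
    have hb0 : b ≠ 0 := by
      rintro rfl
      exact hb' (zero_mem_valueSet H c J)
    let f : H → R := fun h => ((h : Rˣ) : R) * b
    have hf : Function.Injective f := by
      intro g h hgh
      have h1 : (((h : Rˣ)⁻¹ * (g : Rˣ) : Rˣ) : R) * b = b := by
        have : ((g : Rˣ) : R) * b = ((h : Rˣ) : R) * b := hgh
        rw [Units.val_mul, mul_assoc, this, Units.inv_mul_cancel_left]
      have h2 := hfree _ (H.mul_mem (H.inv_mem h.2) g.2) b hb0 h1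
      exact Subtype.ext (inv_mul_eq_one.mp h2).symm
    have hcard : (Set.range f).ncard = Nat.card H := by
      rw [← Set.image_univ, Set.ncard_image_of_injective _ hf, Set.ncard_univ]
    have hdisj : Disjoint (valueSet H c J) (Set.range f) := by
      rw [Set.disjoint_left]
      rintro _ hv ⟨h, rfl⟩
      apply hb'
      have := mul_mem_valueSet H c J (H.inv_mem h.2) hv
      simpa [f] using this
    rw [← hcard, ← Set.ncard_union_eq hdisj]
    refine Set.ncard_le_ncard (Set.union_subset (valueSet_subset_insert H c J hj) ?_)
    rintro _ ⟨h, rfl⟩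
    exact mul_mem_valueSet H c _ h.2 hb

end ValueSet

lemma add_natCast_mul_mem_of_forall_add_mem {R : Type*} [CommRing R] (S : Set R) (c : R)
    (hS : ∀ v ∈ S, v + c ∈ S) (n : ℕ) : ∀ v ∈ S, v + n * c ∈ S := by
  induction n with
  | zero => simp
  | succ n ih =>
    intro v hv
    have := hS _ (ih v hv)
    rw [add_assoc] at this
    convert this using 2
    push_cast
    ring

lemma mem_of_forall_add_unit_mem (m : ℕ) [NeZero m] (S : Set (ZMod m)) (c : ZMod m)
    (hc : IsUnit c) (hS : ∀ v ∈ S, v + c ∈ S) (h0 : (0 : ZMod m) ∈ S) : S = Set.univ := by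
  refine Set.eq_univ_of_forall fun x => ?_
  obtain ⟨u, rfl⟩ := hc
  have := add_natCast_mul_mem_of_forall_add_mem S u hS ((x * (u⁻¹ : (ZMod m)ˣ) : ZMod m)).val 0 h0
  simpa using this

lemma eq_univ_of_forall_add_two_mul_unit_mem (m : ℕ) [NeZero m] (S : Set (ZMod m)) (c : ZMod m)
    (hc : IsUnit c) (hS : ∀ v ∈ S, v + 2 * c ∈ S) (hcard : m < 2 * S.ncard) : S = Set.univ := by
  have hstep : ∀ v ∈ S, ∀ x : ZMod m, v + 2 * x ∈ S := by
    intro v hv x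
    obtain ⟨u, rfl⟩ := hc
    have := add_natCast_mul_mem_of_forall_add_mem S (2 * u) hS
      ((x * (u⁻¹ : (ZMod m)ˣ) : ZMod m)).val v hv
    rw [ZMod.natCast_zmod_val] at this
    convert this using 2
    rw [mul_left_comm, mul_assoc, Units.inv_mul, mul_one]
  by_contra hne
  have hsub : (fun x => x + 1) '' S ⊆ Sᶜ := by
    rintro _ ⟨v, hv, rfl⟩ hv1
    apply hne
    refine Set.eq_univ_of_forall fun x => ?_
    have hx : ((x - v).val : ZMod m) = x - v := ZMod.natCast_zmod_val _
    rcases Nat.even_or_odd' (x - v).val with ⟨n, hn | hn⟩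
    · have := hstep v hv n
      rw [hn] at hx
      push_cast at hx
      rwa [hx, add_sub_cancel] at this
    · have := hstep _ hv1 n
      rw [hn] at hx
      push_cast at hx
      rwa [show v + 1 + 2 * (n : ZMod m) = v + (2 * n + 1) by ring, hx, add_sub_cancel] at this
  have h1 := Set.ncard_le_ncard hsub
  rw [Set.ncard_image_of_injective _ (add_left_injective 1)] at h1
  have h2 := Set.ncard_add_ncard_compl S
  rw [Nat.card_zmod] at h2
  omega

lemma valueSet_units_growth {ι : Type*} (m : ℕ) [NeZero m] (H : Subgroup (ZMod m)ˣ)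
    (hfree : ∀ h ∈ H, ∀ b : ZMod m, b ≠ 0 → (h : ZMod m) * b = b → h = 1) (c : ι → ZMod m)
    (J : Finset ι) (hc : ∀ i ∈ J, IsUnit (c i)) :
    valueSet H c J = Set.univ ∨ 1 + J.card * Nat.card H ≤ (valueSet H c J).ncard := by
  classical
  induction J using Finset.induction_on with
  | empty =>
    right
    have : (valueSet H c ∅).Nonempty := ⟨0, zero_mem_valueSet H c ∅⟩
    have := this.ncard_pos (Set.toFinite _)
    simp only [Finset.card_empty]
    omega
  | insert j J hj ih =>
    have ih' := ih fun i hi => hc i (Finset.mem_insert_of_mem hi)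
    have hsub := valueSet_subset_insert H c J hj
    rcases ih' with h | h
    · exact Or.inl (Set.univ_subset_iff.mp (h ▸ hsub))
    rcases valueSet_insert_growth H c J hfree hj with h1 | h1
    · have := mem_of_forall_add_unit_mem m _ (c j) (hc j (Finset.mem_insert_self j J)) h1
        (zero_mem_valueSet H c J)
      exact Or.inl (Set.univ_subset_iff.mp (this ▸ hsub))
    · right
      rw [Finset.card_insert_of_notMem hj, add_mul, one_mul]
      omega

lemma valueSet_two_mul_units_growth {ι : Type*} [DecidableEq ι] (m : ℕ) [NeZero m]
    (H : Subgroup (ZMod m)ˣ)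
    (hfree : ∀ h ∈ H, ∀ b : ZMod m, b ≠ 0 → (h : ZMod m) * b = b → h = 1) (c : ι → ZMod m)
    (I J : Finset ι) (hIJ : Disjoint I J) (hI : m < 2 * (valueSet H c I).ncard)
    (hc : ∀ i ∈ J, ∃ u, IsUnit u ∧ c i = 2 * u) :
    valueSet H c (J ∪ I) = Set.univ ∨
      (valueSet H c I).ncard + J.card ≤ (valueSet H c (J ∪ I)).ncard := by
  induction J using Finset.induction_on with
  | empty => simp
  | insert j J hj ih =>
    rw [Finset.disjoint_insert_right] at hIJ
    have ih' := ih hIJ.2 fun i hi => hc i (Finset.mem_insert_of_mem hi)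
    rw [Finset.insert_union]
    have hj' : j ∉ J ∪ I := by
      rw [Finset.mem_union]
      tauto
    have hsub := valueSet_subset_insert H c (J ∪ I) hj'
    rcases ih' with h | h
    · exact Or.inl (Set.univ_subset_iff.mp (h ▸ hsub))
    rcases valueSet_insert_growth H c (J ∪ I) hfree hj' with h1 | h1
    · obtain ⟨u, hu, hju⟩ := hc j (Finset.mem_insert_self j J)
      rw [hju] at h1
      have := eq_univ_of_forall_add_two_mul_unit_mem m _ u hu h1 (by omega)
      exact Or.inl (Set.univ_subset_iff.mp (this ▸ hsub))
    · right
      have : 0 < Nat.card H := Nat.card_pos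
      rw [Finset.card_insert_of_notMem hj]
      omega

lemma pow_mul_pow_eq_one_of_prime_dvd (p τ k' : ℕ) (hp : p.Prime) (G : ℤ)
    (h : (p : ℤ) ∣ G ^ (p ^ τ * k') - 1) : (p ^ (τ + 1) : ℤ) ∣ G ^ (p ^ τ * k') - 1 := by
  have := Fact.mk hp
  have h1 : (p : ℤ) ∣ G ^ k' - 1 := by
    rw [← ZMod.intCast_zmod_eq_zero_iff_dvd] at h ⊢
    push_cast at h ⊢
    rwa [mul_comm, pow_mul, ZMod.pow_card_pow] at h
  have h2 := dvd_sub_pow_of_dvd_sub h1 τ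
  rwa [one_pow, ← pow_mul, mul_comm k'] at h2

lemma powMonoidHom_range_free (p τ k' : ℕ) (hp : p.Prime) :
    ∀ h ∈ (powMonoidHom (p ^ τ * k') : (ZMod (p ^ (τ + 1)))ˣ →* (ZMod (p ^ (τ + 1)))ˣ).range,
      ∀ b : ZMod (p ^ (τ + 1)), b ≠ 0 → (h : ZMod (p ^ (τ + 1))) * b = b → h = 1 := by
  rintro _ ⟨g, rfl⟩ b hb hgb
  have : NeZero (p ^ (τ + 1)) := ⟨(pow_pos hp.pos _).ne'⟩
  set G : ℤ := ((g : ZMod (p ^ (τ + 1))).val : ℤ) with hG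
  have hGc : (G : ZMod (p ^ (τ + 1))) = g := by simp [hG]
  have hnu : ¬ IsUnit ((G ^ (p ^ τ * k') - 1 : ℤ) : ZMod (p ^ (τ + 1))) := by
    intro hu
    apply hb
    have h0 : ((G ^ (p ^ τ * k') - 1 : ℤ) : ZMod (p ^ (τ + 1))) * b = 0 := by
      push_cast
      rw [hGc, sub_mul, one_mul, sub_eq_zero]
      simpa using hgb
    exact (hu.mul_right_eq_zero).mp h0
  rw [ZMod.coe_int_isUnit_iff_isCoprime] at hnu
  have hdvd : (p : ℤ) ∣ G ^ (p ^ τ * k') - 1 := by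
    by_contra hnd
    apply hnu
    push_cast
    exact ((Nat.prime_iff_prime_int.mp hp).coprime_iff_not_dvd.mpr hnd).pow_left
  have h1 := pow_mul_pow_eq_one_of_prime_dvd p τ k' hp G hdvd
  have h2 : ((G ^ (p ^ τ * k') - 1 : ℤ) : ZMod (p ^ (τ + 1))) = 0 := by
    rw [ZMod.intCast_zmod_eq_zero_iff_dvd]
    exact_mod_cast h1
  push_cast at h2
  rw [hGc, sub_eq_zero] at h2
  ext
  simpa using h2

lemma card_powMonoidHom_range_ge (p τ k : ℕ) (hp : p.Prime) (hk : 0 < k) (h : p ≠ 2 ∨ τ = 0) :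
    p ^ τ * (p - 1) ≤
      k * Nat.card (powMonoidHom k : (ZMod (p ^ (τ + 1)))ˣ →* (ZMod (p ^ (τ + 1)))ˣ).range := by
  have : NeZero (p ^ (τ + 1)) := ⟨(pow_pos hp.pos _).ne'⟩
  have hcyc : IsCyclic (ZMod (p ^ (τ + 1)))ˣ := by
    rcases h with h | rfl
    · exact ZMod.isCyclic_units_of_prime_pow p hp h _
    · rw [zero_add, pow_one]
      exact ZMod.isCyclic_units_prime hp
  have hG : Nat.card (ZMod (p ^ (τ + 1)))ˣ = p ^ τ * (p - 1) := by
    rw [Nat.card_eq_fintype_card, ZMod.card_units_eq_totient, Nat.totient_prime_pow_succ hp]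
  rw [IsCyclic.card_powMonoidHom_range, hG]
  set n := p ^ τ * (p - 1)
  calc n = n.gcd k * (n / n.gcd k) := (Nat.mul_div_cancel' (Nat.gcd_dvd_left n k)).symm
    _ ≤ k * (n / n.gcd k) := Nat.mul_le_mul_right _ (Nat.gcd_le_right _ hk)

lemma dvd_sum_of_valueSet_eq_univ {ι : Type*} [DecidableEq ι] (k m : ℕ) [NeZero m] (hk : k ≠ 0)
    (H : Subgroup (ZMod m)ˣ) (hH : ∀ h ∈ H, ∃ g : ZMod m, (h : ZMod m) = g ^ k) (c : ι → ℤ)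
    (J : Finset ι) (i0 : ι) (hi0 : i0 ∉ J)
    (hV : valueSet H (fun i => (c i : ZMod m)) J = Set.univ) :
    ∃ y : ι → ℤ, y i0 = 1 ∧ (m : ℤ) ∣ ∑ i ∈ insert i0 J, c i * y i ^ k := by
  have hmem : -(c i0 : ZMod m) ∈ valueSet H (fun i => (c i : ZMod m)) J := hV ▸ Set.mem_univ _
  obtain ⟨y, hy, hsum⟩ := hmem
  have hz : ∀ i, ∃ z : ℤ, y i = (z : ZMod m) ^ k := fun i => by
    rcases hy i with h | ⟨h, hh, hi⟩
    · exact ⟨0, by simp [h, hk]⟩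
    · obtain ⟨g, hg⟩ := hH h hh
      exact ⟨g.val, by simp [hi, hg]⟩
  choose z hz using hz
  refine ⟨Function.update z i0 1, by simp, ?_⟩
  rw [← ZMod.intCast_zmod_eq_zero_iff_dvd, Finset.sum_insert hi0, Function.update_self]
  push_cast
  have : ∑ i ∈ J, (c i : ZMod m) * (Function.update z i0 1 i : ZMod m) ^ k =
      ∑ i ∈ J, (c i : ZMod m) * y i := by
    refine Finset.sum_congr rfl fun i hi => ?_
    rw [Function.update_of_ne (by rintro rfl; exact hi0 hi), hz i]
  rw [this, ← hsum]
  simp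

lemma exists_dvd_sum_of_units {ι : Type*} (p τ k' k : ℕ) (hp : p.Prime) (hk : 2 ≤ k)
    (hkk : k = p ^ τ * k') (h : p ≠ 2 ∨ τ = 0) (c : ι → ℤ) (J : Finset ι)
    (hc : ∀ i ∈ J, ¬ (p : ℤ) ∣ c i) (hJ : 4 * k - 3 ≤ J.card) :
    ∃ i0 ∈ J, ∃ y : ι → ℤ, y i0 = 1 ∧ (p ^ (τ + 1) : ℤ) ∣ ∑ i ∈ J, c i * y i ^ k := by
  classical
  have : NeZero (p ^ (τ + 1)) := ⟨(pow_pos hp.pos _).ne'⟩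
  obtain ⟨i0, hi0⟩ : J.Nonempty := Finset.card_pos.mp (by omega)
  refine ⟨i0, hi0, ?_⟩
  have hfree := powMonoidHom_range_free p τ k' hp
  have hcard := card_powMonoidHom_range_ge p τ k hp (by omega) h
  rw [← hkk] at hfree
  set H := (powMonoidHom k : (ZMod (p ^ (τ + 1)))ˣ →* (ZMod (p ^ (τ + 1)))ˣ).range with hHdef
  have hV : valueSet H (fun i => (c i : ZMod (p ^ (τ + 1)))) (J.erase i0) = Set.univ := by
    rcases valueSet_units_growth _ H hfree (fun i => (c i : ZMod (p ^ (τ + 1)))) (J.erase i0)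
      (fun i hi => by
        rw [ZMod.coe_int_isUnit_iff_isCoprime]
        push_cast
        exact ((Nat.prime_iff_prime_int.mp hp).coprime_iff_not_dvd.mpr
          (hc i (Finset.mem_of_mem_erase hi))).pow_left) with h1 | h1
    · exact h1
    · rw [Set.eq_univ_iff_ncard]
      refine le_antisymm ?_ ?_
      · rw [← Set.ncard_univ]
        exact Set.ncard_le_ncard (Set.subset_univ _)
      · rw [Nat.card_zmod]
        refine le_trans ?_ h1
        rw [Finset.card_erase_of_mem hi0]
        have h2 : 2 * (k * Nat.card H) ≤ (J.card - 1) * Nat.card H := by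
          rw [← mul_assoc]
          exact Nat.mul_le_mul_right _ (by omega)
        have h3 : p ^ (τ + 1) ≤ 2 * (p ^ τ * (p - 1)) := by
          have := hp.two_le
          rw [pow_succ, mul_left_comm]
          exact Nat.mul_le_mul_left _ (by omega)
        omega
  obtain ⟨y, hy, hd⟩ := dvd_sum_of_valueSet_eq_univ k (p ^ (τ + 1)) (by omega) H (by
    rintro _ ⟨g, rfl⟩
    exact ⟨g, by simp⟩) c (J.erase i0) i0 (Finset.notMem_erase i0 J) hV
  rw [Finset.insert_erase hi0] at hd
  exact ⟨y, hy, by exact_mod_cast hd⟩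

lemma exists_dvd_sum_of_units_two {ι : Type*} [DecidableEq ι] (τ k : ℕ) (hk : 2 ≤ k)
    (hτ : 2 ^ τ ≤ k) (c : ι → ℤ) (I J : Finset ι)
    (hIJ : Disjoint I J) (hI : ∀ i ∈ I, ¬ (2 : ℤ) ∣ c i)
    (hJ : ∀ i ∈ J, ∃ u : ℤ, ¬ (2 : ℤ) ∣ u ∧ c i = 2 * u) (hIc : 4 * k - 3 ≤ I.card)
    (hIJc : 4 * k ≤ I.card + J.card) :
    ∃ i0 ∈ I, ∃ y : ι → ℤ, y i0 = 1 ∧ (2 ^ (τ + 2) : ℤ) ∣ ∑ i ∈ I ∪ J, c i * y i ^ k := by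
  classical
  have : NeZero (2 ^ (τ + 2)) := ⟨(pow_pos two_pos _).ne'⟩
  obtain ⟨i0, hi0⟩ : I.Nonempty := Finset.card_pos.mp (by omega)
  refine ⟨i0, hi0, ?_⟩
  have hunit : ∀ u : ℤ, ¬ (2 : ℤ) ∣ u → IsUnit (u : ZMod (2 ^ (τ + 2))) := fun u hu => by
    rw [ZMod.coe_int_isUnit_iff_isCoprime]
    push_cast
    exact (Int.prime_two.coprime_iff_not_dvd.mpr hu).pow_left
  have hm : 2 ^ (τ + 2) ≤ 4 * k := by
    rw [pow_add]
    omega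
  have hfree : ∀ h ∈ (⊥ : Subgroup (ZMod (2 ^ (τ + 2)))ˣ), ∀ b : ZMod (2 ^ (τ + 2)), b ≠ 0 →
      (h : ZMod (2 ^ (τ + 2))) * b = b → h = 1 := fun h hh _ _ _ => by simpa using hh
  set c' : ι → ZMod (2 ^ (τ + 2)) := fun i => (c i : ZMod (2 ^ (τ + 2))) with hc'
  have hle : ∀ S : Set (ZMod (2 ^ (τ + 2))), 2 ^ (τ + 2) ≤ S.ncard → S = Set.univ := by
    intro S hS
    rw [Set.eq_univ_iff_ncard]
    refine le_antisymm ?_ (by rwa [Nat.card_zmod])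
    rw [← Set.ncard_univ]
    exact Set.ncard_le_ncard (Set.subset_univ _)
  have h1 : 4 * k - 3 ≤ (valueSet ⊥ c' (I.erase i0)).ncard ∧
      I.card ≤ (valueSet ⊥ c' (I.erase i0)).ncard ∨
      valueSet ⊥ c' (I.erase i0) = Set.univ := by
    rcases valueSet_units_growth _ ⊥ hfree c' (I.erase i0)
      (fun i hi => hunit _ (hI i (Finset.mem_of_mem_erase hi))) with h | h
    · exact Or.inr h
    · left
      rw [Finset.card_erase_of_mem hi0] at h
      have : Nat.card (⊥ : Subgroup (ZMod (2 ^ (τ + 2)))ˣ) = 1 := Subgroup.card_bot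
      rw [this] at h
      omega
  have hlt : 2 ^ (τ + 2) < 2 * (valueSet ⊥ c' (I.erase i0)).ncard := by
    rcases h1 with h | h
    · omega
    · rw [h, Set.ncard_univ, Nat.card_zmod]
      have := Nat.pos_of_ne_zero this.out
      omega
  have hdis : Disjoint (I.erase i0) J := hIJ.mono_left (Finset.erase_subset _ _)
  have hV : valueSet ⊥ c' (J ∪ I.erase i0) = Set.univ := by
    rcases valueSet_two_mul_units_growth _ ⊥ hfree c' (I.erase i0) J hdis hlt
      (fun i hi => by
        obtain ⟨u, hu, hcu⟩ := hJ i hi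
        exact ⟨u, hunit u hu, by simp [hc', hcu]⟩) with h | h
    · exact h
    · rcases h1 with h1 | h1
      · exact hle _ (by omega)
      · rw [h1, Set.ncard_univ, Nat.card_zmod] at h
        exact hle _ (by omega)
  have hi0' : i0 ∉ J ∪ I.erase i0 := by
    rw [Finset.mem_union]
    rintro (h | h)
    · exact Finset.disjoint_left.mp hIJ hi0 h
    · exact Finset.notMem_erase i0 I h
  obtain ⟨y, hy, hd⟩ := dvd_sum_of_valueSet_eq_univ k (2 ^ (τ + 2)) (by omega) ⊥ (by
    intro h hh
    refine ⟨1, ?_⟩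
    rw [Subgroup.mem_bot.mp hh]
    simp) c (J ∪ I.erase i0) i0 hi0' hV
  rw [← Finset.union_insert, Finset.insert_erase hi0, Finset.union_comm] at hd
  exact ⟨y, hy, by exact_mod_cast hd⟩

lemma exists_dvd_add_mul (p : ℕ) (hp : p.Prime) (g r : ℤ) (hg : ¬ (p : ℤ) ∣ g) :
    ∃ m : ℤ, (p : ℤ) ∣ r + g * m := by
  obtain ⟨a, b, hab⟩ := (Nat.prime_iff_prime_int.mp hp).coprime_iff_not_dvd.mpr hg
  exact ⟨-(r * b), r * a, by linear_combination -r * hab⟩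

/-- Newton lifting of approximate `k`-th power residues modulo prime powers. -/
lemma exists_pow_lift (p τ k' e : ℕ) (hp : p.Prime) (hk' : ¬ p ∣ k') (he : 1 ≤ e)
    (h : τ = 0 ∨ e + 2 ≤ e * p) (w R : ℤ) (hw : ¬ (p : ℤ) ∣ w)
    (hR : (p : ℤ) ^ (τ + e) ∣ R - w) (d : ℕ) :
    ∃ z : ℤ, ¬ (p : ℤ) ∣ z ∧ (p : ℤ) ^ (τ + e + d) ∣ w * z ^ (p ^ τ * k') - R := by
  have hpz := Nat.prime_iff_prime_int.mp hp
  induction d with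
  | zero =>
    refine ⟨1, hpz.not_dvd_one, ?_⟩
    rw [one_pow, mul_one, add_zero, ← neg_sub]
    exact (dvd_neg.mpr hR)
  | succ d ih =>
    obtain ⟨z, hz, r, hr⟩ := ih
    have hk'' : ¬ (p : ℤ) ∣ k' := by exact_mod_cast hk'
    have hg : ¬ (p : ℤ) ∣ w * z ^ (p ^ τ * k') * k' := by
      intro hd
      rcases hpz.dvd_or_dvd hd with h1 | h1
      · rcases hpz.dvd_or_dvd h1 with h2 | h2
        · exact hw h2
        · exact hz (hpz.dvd_of_dvd_pow h2)
      · exact hk'' h1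
    obtain ⟨m, q, hm⟩ := exists_dvd_add_mul p hp _ r hg
    have hy : ∃ y : ℤ, (1 + (p : ℤ) ^ (e + d) * m) ^ p ^ τ =
        1 + (p : ℤ) ^ τ * (p : ℤ) ^ (e + d) * (m + p * y) := by
      rcases h with rfl | h
      · exact ⟨0, by simp⟩
      · refine ZMod.exists_one_add_mul_pow_prime_pow_eq hp (dvd_pow_self _ (by omega)) ?_ m τ
        rw [← pow_succ', ← pow_succ, ← pow_mul]
        refine pow_dvd_pow _ ?_
        have : 2 ≤ p := hp.two_le
        nlinarith
    obtain ⟨y, hy⟩ := hy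
    obtain ⟨A, hA⟩ := Polynomial.powAddExpansion (1 : ℤ)
      ((p : ℤ) ^ τ * (p : ℤ) ^ (e + d) * (m + p * y)) k'
    refine ⟨z * (1 + (p : ℤ) ^ (e + d) * m), ?_, ?_⟩
    · intro hd
      rcases hpz.dvd_or_dvd hd with h1 | h1
      · exact hz h1
      · have h2 : (p : ℤ) ∣ (p : ℤ) ^ (e + d) * m :=
          (dvd_pow_self _ (by omega)).mul_right _
        exact hpz.not_dvd_one ((dvd_add_left h2).mp h1)
    · have hpp : (p : ℤ) ^ τ * (p : ℤ) ^ (e + d) = (p : ℤ) ^ (τ + e + d) := by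
        rw [← pow_add, add_assoc]
      rw [hpp] at hA hy
      have h2 : (p : ℤ) ^ (τ + e + d) = p * (p : ℤ) ^ (τ + e + d - 1) := by
        rw [← pow_succ']
        congr 1
        omega
      rw [mul_pow, pow_mul (1 + _) (p ^ τ) k', hy, hA, one_pow, one_pow, mul_one, ← add_assoc,
        pow_succ]
      set Q := (p : ℤ) ^ (τ + e + d) with hQ
      refine ⟨q + w * z ^ (p ^ τ * k') * k' * y +
        w * z ^ (p ^ τ * k') * A * (p : ℤ) ^ (τ + e + d - 1) * (m + p * y) ^ 2, ?_⟩
      have h3 : Q * Q = Q * p * (p : ℤ) ^ (τ + e + d - 1) := by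
        nth_rewrite 2 [h2]
        ring
      linear_combination hr + Q * hm +
        w * z ^ (p ^ τ * k') * A * (m + p * y) ^ 2 * h3

/-- The number of solutions of `∑ a_i x_i ^ k = 0` modulo `N`. -/
noncomputable def modSol (k : ℕ) {ι : Type*} [Fintype ι] (a : ι → ℤ) (N : ℕ) : ℕ :=
  Nat.card {r : ι → ZMod N // ∑ i, (a i : ZMod N) * r i ^ k = 0}

lemma le_modSol_of_point {ι : Type*} [Fintype ι] [DecidableEq ι] (p τ k' e : ℕ) (hp : p.Prime)
    (hk' : ¬ p ∣ k') (he : 1 ≤ e) (h : τ = 0 ∨ e + 2 ≤ e * p) (a x : ι → ℤ) (i0 : ι) (v : ℕ)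
    (w : ℤ) (hw : ¬ (p : ℤ) ∣ w) (hx0 : a i0 * x i0 ^ (p ^ τ * k') = (p : ℤ) ^ v * w)
    (hx : (p : ℤ) ^ (v + (τ + e)) ∣ ∑ i, a i * x i ^ (p ^ τ * k')) (t : ℕ)
    (ht : v + (τ + e) ≤ t) :
    (p ^ (t - (v + (τ + e)))) ^ (Fintype.card ι - 1) ≤ modSol (p ^ τ * k') a (p ^ t) := by
  set k := p ^ τ * k' with hk
  set N := v + (τ + e) with hN
  have hp0 : (p : ℤ) ≠ 0 := by exact_mod_cast hp.ne_zero
  have : NeZero (p ^ t) := ⟨(pow_pos hp.pos _).ne'⟩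
  have key : ∀ m : {i // i ≠ i0} → Fin (p ^ (t - N)), ∃ x' : ι → ℤ,
      (∀ i : {i // i ≠ i0}, x' i = x i + (p : ℤ) ^ N * ((m i : ℕ) : ℤ)) ∧
      (p : ℤ) ^ t ∣ ∑ i, a i * x' i ^ k := by
    intro m
    let x1 : ι → ℤ := fun i => if hi : i ≠ i0 then x i + (p : ℤ) ^ N * ((m ⟨i, hi⟩ : ℕ) : ℤ)
      else x i0
    have hx1 : ∀ i, (p : ℤ) ^ N ∣ x1 i - x i := by
      intro i
      by_cases hi : i ≠ i0
      · simp [x1, hi]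
      · have := not_ne_iff.mp hi
        simp [x1, this]
    have hd : (p : ℤ) ^ N ∣ ∑ i, a i * x1 i ^ k := by
      rw [← dvd_sub_left hx, ← Finset.sum_sub_distrib]
      refine Finset.dvd_sum fun i _ => ?_
      rw [← mul_sub]
      exact ((hx1 i).trans (sub_dvd_pow_sub_pow _ _ _)).mul_left _
    have hsplit := Finset.add_sum_erase Finset.univ (fun i => a i * x1 i ^ k) (Finset.mem_univ i0)
    have hx1i0 : x1 i0 = x i0 := by simp [x1]
    simp only [hx1i0, hx0] at hsplit
    obtain ⟨r, hr⟩ := hd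
    obtain ⟨z, -, y, hy⟩ := exists_pow_lift p τ k' e hp hk' he h w
      (w - (p : ℤ) ^ (τ + e) * r) hw ⟨-r, by ring⟩ (t - N)
    refine ⟨Function.update x1 i0 (x i0 * z), fun i => ?_, ?_⟩
    · rw [Function.update_of_ne i.2]
      simp [x1, i.2]
    · rw [← Finset.add_sum_erase Finset.univ _ (Finset.mem_univ i0), Function.update_self]
      have : ∑ i ∈ Finset.univ.erase i0, a i * Function.update x1 i0 (x i0 * z) i ^ k =
          ∑ i ∈ Finset.univ.erase i0, a i * x1 i ^ k :=
        Finset.sum_congr rfl fun i hi => by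
          rw [Function.update_of_ne (Finset.ne_of_mem_erase hi)]
      rw [this]
      have e1 : (p : ℤ) ^ N = (p : ℤ) ^ v * (p : ℤ) ^ (τ + e) := by rw [hN, pow_add]
      have e2 : (p : ℤ) ^ t = (p : ℤ) ^ v * (p : ℤ) ^ (τ + e + (t - N)) := by
        rw [← pow_add]
        congr 1
        omega
      refine ⟨y, ?_⟩
      rw [e2, mul_pow]
      linear_combination hsplit + hr + (p : ℤ) ^ v * hy + z ^ k * hx0 + r * e1
  choose x' hx' hx'd using key
  let f : ({i // i ≠ i0} → Fin (p ^ (t - N))) →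
      {r : ι → ZMod (p ^ t) // ∑ i, (a i : ZMod (p ^ t)) * r i ^ k = 0} := fun m =>
    ⟨fun i => (x' m i : ZMod (p ^ t)), by
      have := (ZMod.intCast_zmod_eq_zero_iff_dvd (∑ i, a i * x' m i ^ k) (p ^ t)).mpr
        (by exact_mod_cast hx'd m)
      simpa using this⟩
  have hf : Function.Injective f := by
    intro m m' hmm
    funext i
    have h1 : ((x' m i : ℤ) : ZMod (p ^ t)) = (x' m' i : ℤ) :=
      congrFun (congrArg Subtype.val hmm) i
    rw [ZMod.intCast_eq_intCast_iff_dvd_sub, hx', hx'] at h1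
    have h2 : ((p ^ t : ℕ) : ℤ) = (p : ℤ) ^ N * (p : ℤ) ^ (t - N) := by
      push_cast
      rw [← pow_add]
      congr 1
      omega
    rw [h2, add_sub_add_left_eq_sub, ← mul_sub,
      mul_dvd_mul_iff_left (pow_ne_zero _ hp0)] at h1
    have h3 : ((m i : ℕ) : ℤ) ≡ (m' i : ℕ) [ZMOD ((p ^ (t - N) : ℕ) : ℤ)] := by
      rw [Int.modEq_iff_dvd]
      exact_mod_cast h1
    rw [Int.natCast_modEq_iff] at h3
    exact Fin.ext (Nat.ModEq.eq_of_lt_of_lt h3 (m i).2 (m' i).2)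
  have hcard := Nat.card_le_card_of_injective f hf
  rw [modSol]
  refine le_trans (le_of_eq ?_) hcard
  rw [Nat.card_eq_fintype_card, Fintype.card_fun, Fintype.card_fin, Fintype.card_subtype_compl,
    Fintype.card_subtype_eq]

lemma exists_point_of_dvd_sum {ι : Type*} [Fintype ι] [DecidableEq ι] (p k γ E : ℕ) (hk : k ≠ 0)
    (a b c y : ι → ℤ) (J : Finset ι) (i0 : ι) (hi0 : i0 ∈ J)
    (hab : ∀ i ∈ J, a i * b i ^ k = (p : ℤ) ^ E * c i) (hy : y i0 = 1)
    (hd : (p : ℤ) ^ γ ∣ ∑ i ∈ J, c i * y i ^ k) :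
    ∃ x : ι → ℤ, a i0 * x i0 ^ k = (p : ℤ) ^ E * c i0 ∧
      (p : ℤ) ^ (E + γ) ∣ ∑ i, a i * x i ^ k := by
  refine ⟨fun i => if i ∈ J then b i * y i else 0, by simp [hi0, hy, hab], ?_⟩
  have : ∑ i, a i * (if i ∈ J then b i * y i else 0) ^ k =
      (p : ℤ) ^ E * ∑ i ∈ J, c i * y i ^ k := by
    rw [Finset.mul_sum, ← Finset.sum_subset (Finset.subset_univ J)]
    · refine Finset.sum_congr rfl fun i hi => ?_
      rw [if_pos hi, mul_pow, ← mul_assoc, hab i hi, mul_assoc]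
    · intro i _ hi
      rw [if_neg hi, zero_pow hk, mul_zero]
  rw [this, pow_add]
  exact mul_dvd_mul_left _ hd

lemma exists_large_residue_class {ι : Type*} [Fintype ι] (k : ℕ) (hk : 2 ≤ k) (n : ι → ℕ)
    (hs : 4 * k ^ 2 - 4 * k + 1 ≤ Fintype.card ι) :
    ∃ r < k, 4 * k - 3 ≤ (Finset.univ.filter fun i => n i % k = r).card ∧
      ∀ r' < k, r' ≠ r → 4 * k ≤ (Finset.univ.filter fun i => n i % k = r).card +
        (Finset.univ.filter fun i => n i % k = r').card := by
  classical
  set C : ℕ → ℕ := fun r => (Finset.univ.filter fun i => n i % k = r).card with hC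
  have hsum : Fintype.card ι = ∑ r ∈ Finset.range k, C r :=
    Finset.card_eq_sum_card_fiberwise fun i _ => by simpa using Nat.mod_lt _ (by omega)
  obtain ⟨r, hr, hmax⟩ := Finset.exists_max_image (Finset.range k) C ⟨0, by simp; omega⟩
  have hrk := Finset.mem_range.mp hr
  have hb : ∀ T : Finset ℕ, T ⊆ Finset.range k → ∑ r' ∈ T, C r' ≤ T.card * C r := fun T hT => by
    simpa using Finset.sum_le_card_nsmul T C (C r) fun r' h => hmax r' (hT h)
  obtain ⟨K, rfl⟩ := Nat.exists_eq_add_of_le' hk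
  have hcard : 4 * (K + 2) ^ 2 - 4 * (K + 2) + 1 = 4 * (K + 2) * (K + 1) + 1 := by
    have : 4 * (K + 2) ^ 2 = 4 * (K + 2) * (K + 1) + 4 * (K + 2) := by ring
    omega
  rw [hcard] at hs
  refine ⟨r, hrk, ?_, fun r' hr' hne => ?_⟩
  · by_contra hlt
    have h1 := hb _ (Finset.Subset.refl _)
    rw [← hsum, Finset.card_range] at h1
    have h2 : C r ≤ 4 * (K + 1) := by
      change ¬ _ ≤ C r at hlt
      omega
    have h3 := Nat.mul_le_mul_left (K + 2) h2
    nlinarith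
  · change 4 * (K + 2) ≤ C r + C r'
    have h1 := hb ((Finset.range (K + 2)).erase r') (Finset.erase_subset _ _)
    rw [Finset.card_erase_of_mem (Finset.mem_range.mpr hr'), Finset.card_range] at h1
    have h2 := Finset.add_sum_erase (Finset.range (K + 2)) C (Finset.mem_range.mpr hr')
    rw [← hsum] at h2
    by_contra hlt
    have h3 : C r ≤ 4 * (K + 2) := by omega
    obtain ⟨j, hj⟩ := Nat.exists_eq_add_of_le h3
    have h4 : (K + 2 - 1) * C r + (K + 1) * j = 4 * (K + 2) * (K + 1) := by
      rw [show K + 2 - 1 = K + 1 by omega, ← mul_add, ← hj]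
      ring
    have h5 : C r' < j := by omega
    nlinarith

lemma exists_local_point {ι : Type*} [Fintype ι] [DecidableEq ι] (k : ℕ) (hk : 2 ≤ k)
    (hs : 4 * k ^ 2 - 4 * k + 1 ≤ Fintype.card ι) (a : ι → ℤ) (ha : ∀ i, a i ≠ 0) (p τ k' : ℕ)
    (hp : p.Prime) (hkk : k = p ^ τ * k') (hk' : ¬ p ∣ k') :
    ∃ e, 1 ≤ e ∧ (τ = 0 ∨ e + 2 ≤ e * p) ∧ ∃ (x : ι → ℤ) (i0 : ι) (v : ℕ) (w : ℤ),
      ¬ (p : ℤ) ∣ w ∧ a i0 * x i0 ^ k = (p : ℤ) ^ v * w ∧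
        (p : ℤ) ^ (v + (τ + e)) ∣ ∑ i, a i * x i ^ k := by
  have hpz := Nat.prime_iff_prime_int.mp hp
  have hfac : ∀ i, ∃ (n : ℕ) (u : ℤ), a i = (p : ℤ) ^ n * u ∧ ¬ (p : ℤ) ∣ u := fun i => by
    obtain ⟨u, hu, hu'⟩ := (Int.finiteMultiplicity_iff.mpr
      ⟨by simpa using hp.ne_one, ha i⟩ :
        FiniteMultiplicity (p : ℤ) (a i)).exists_eq_pow_mul_and_not_dvd
    exact ⟨_, u, hu, hu'⟩
  choose n u hau hu using hfac
  obtain ⟨r, hrk, hr, hr'⟩ := exists_large_residue_class k hk n hs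
  set L := ∑ i, n i with hL
  have hnL : ∀ i, n i / k ≤ L := fun i => (Nat.div_le_self _ _).trans
    (Finset.single_le_sum (f := n) (fun _ _ => Nat.zero_le _) (Finset.mem_univ i))
  have hscale : ∀ (i : ι) (δ : ℕ), a i * ((p : ℤ) ^ (L - n i / k + δ)) ^ k =
      (p : ℤ) ^ (k * L + n i % k + δ * k) * u i := fun i δ => by
    rw [hau i, ← pow_mul, mul_right_comm, ← pow_add]
    congr 2
    obtain ⟨d, hd⟩ := Nat.exists_eq_add_of_le (hnL i)
    have := Nat.div_add_mod (n i) k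
    rw [hd, Nat.add_sub_cancel_left]
    nlinarith
  set I := Finset.univ.filter fun i => n i % k = r with hI
  have hImem : ∀ i, i ∈ I ↔ n i % k = r := fun i => by simp [hI]
  have hI1 : ∀ i ∈ I, a i * ((p : ℤ) ^ (L - n i / k)) ^ k = (p : ℤ) ^ (k * L + r) * u i :=
    fun i hi => by simpa [(hImem i).mp hi] using hscale i 0
  by_cases hcase : p ≠ 2 ∨ τ = 0
  · obtain ⟨i0, hi0, y, hy, hd⟩ := exists_dvd_sum_of_units p τ k' k hp hk hkk hcase u I
      (fun i _ => hu i) hr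
    obtain ⟨x, hx0, hx⟩ := exists_point_of_dvd_sum p k (τ + 1) (k * L + r) (by omega) a _ u y I i0
      hi0 hI1 hy hd
    refine ⟨1, le_rfl, ?_, x, i0, _, _, hu i0, hx0, hx⟩
    rcases hcase with h | h
    · right
      have := hp.two_le
      omega
    · exact Or.inl h
  · obtain ⟨rfl, hτ⟩ : p = 2 ∧ τ ≠ 0 := by push Not at hcase; exact hcase
    set r' := (r + 1) % k with hr'def
    have hr'k : r' < k := Nat.mod_lt _ (by omega)
    have hmod : r + 1 = r' + (if r + 1 = k then 1 else 0) * k := by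
      split_ifs with h
      · rw [hr'def, h, Nat.mod_self]
        omega
      · rw [hr'def, Nat.mod_eq_of_lt (by omega)]
        omega
    have hne : r' ≠ r := by
      intro h
      rw [h] at hmod
      split_ifs at hmod <;> omega
    set I' := Finset.univ.filter fun i => n i % k = r' with hI'
    have hI'mem : ∀ i, i ∈ I' ↔ n i % k = r' := fun i => by simp [hI']
    have hdis : Disjoint I I' := by
      rw [Finset.disjoint_left]
      intro i hi hi'
      rw [hImem] at hi
      rw [hI'mem] at hi'
      omega
    have hτk : 2 ^ τ ≤ k := by
      rw [hkk]
      refine Nat.le_mul_of_pos_right _ (Nat.pos_of_ne_zero ?_)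
      rintro rfl
      simp at hk'
    set c : ι → ℤ := fun i => if i ∈ I then u i else 2 * u i with hc
    set b : ι → ℤ := fun i => if i ∈ I then 2 ^ (L - n i / k) else
      2 ^ (L - n i / k + if r + 1 = k then 1 else 0) with hb
    have hcI : ∀ i ∈ I, c i = u i := fun i hi => if_pos hi
    have hcI' : ∀ i ∈ I', c i = 2 * u i := fun i hi =>
      if_neg (Finset.disjoint_right.mp hdis hi)
    obtain ⟨i0, hi0, y, hy, hd⟩ := exists_dvd_sum_of_units_two τ k hk hτk c I I' hdis
      (fun i hi => by rw [hcI i hi]; exact_mod_cast hu i)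
      (fun i hi => ⟨u i, by exact_mod_cast hu i, hcI' i hi⟩) hr (hr' r' hr'k hne)
    obtain ⟨x, hx0, hx⟩ := exists_point_of_dvd_sum 2 k (τ + 2) (k * L + r) (by omega) a b c y
      (I ∪ I') i0 (Finset.mem_union_left _ hi0) (fun i hi => by
        by_cases hiI : i ∈ I
        · rw [hcI i hiI, ← hI1 i hiI]
          simp [hb, hiI]
        · have hiI' := (Finset.mem_union.mp hi).resolve_left hiI
          have := hscale i (if r + 1 = k then 1 else 0)
          rw [(hI'mem i).mp hiI', add_assoc, ← hmod, ← add_assoc, pow_succ, mul_assoc] at this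
          rw [hcI' i hiI']
          simpa [hb, hiI] using this) hy (by exact_mod_cast hd)
    rw [hcI i0 hi0] at hx0
    exact ⟨2, by norm_num, Or.inr (by norm_num), x, i0, _, _, hu i0, hx0, hx⟩

/-- Many solutions modulo high powers of every prime. -/
theorem exists_le_modSol_prime_pow {ι : Type*} [Fintype ι] (k : ℕ) (hk : 2 ≤ k)
    (hs : 4 * k ^ 2 - 4 * k + 1 ≤ Fintype.card ι) (a : ι → ℤ) (ha : ∀ i, a i ≠ 0) (p : ℕ)
    (hp : p.Prime) :
    ∃ N : ℕ, ∀ t, N ≤ t → (p ^ (t - N)) ^ (Fintype.card ι - 1) ≤ modSol k a (p ^ t) := by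
  classical
  obtain ⟨τ, k', hk', hkk⟩ := Nat.exists_eq_pow_mul_and_not_dvd (show k ≠ 0 by omega) p hp.ne_one
  obtain ⟨e, he, hcase, x, i0, v, w, hw, hx0, hx⟩ :=
    exists_local_point k hk hs a ha p τ k' hp hkk hk'
  subst hkk
  exact ⟨_, le_modSol_of_point p τ k' e hp hk' he hcase a x i0 v w hw hx0 hx⟩

lemma sum_range_unitExp (N : ℕ) (hN : 0 < N) (m : ℤ) :
    ∑ b ∈ Finset.range N, unitExp ((b : ℝ) * (m / N)) = if (N : ℤ) ∣ m then (N : ℂ) else 0 := by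
  have hN' : (N : ℝ) ≠ 0 := by exact_mod_cast hN.ne'
  simp_rw [unitExp_nat_mul]
  split_ifs with h
  · obtain ⟨c, rfl⟩ := h
    have : (((N * c : ℤ) : ℝ)) / N = (c : ℝ) := by
      push_cast
      field_simp
    simp_rw [this, unitExp_int]
    simp
  · have h1 : unitExp ((m : ℝ) / N) ≠ 1 := by
      intro h1
      have h2 := le_norm_unitExp_sub_one_distInt ((m : ℝ) / N)
      rw [h1, sub_self, norm_zero] at h2
      have h3 : (m : ℝ) / N - round ((m : ℝ) / N) = 0 :=
        abs_eq_zero.mp (le_antisymm (by unfold distInt at h2; linarith) (abs_nonneg _))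
      apply h
      refine ⟨round ((m : ℝ) / N), ?_⟩
      have h4 : (m : ℝ) = N * round ((m : ℝ) / N) := by
        field_simp at h3
        linarith
      exact_mod_cast h4
    rw [geom_sum_eq h1, ← unitExp_nat_mul, mul_div_cancel₀ _ hN', unitExp_int, sub_self, zero_div]

lemma powerSum_mul_eq (k g d : ℕ) (hd : 0 < d) (A : ℤ) :
    powerSum k (g * d) (A / d) = g * powerSum k d (A / d) := by
  have hd' : (d : ℝ) ≠ 0 := by exact_mod_cast hd.ne'
  simp only [powerSum_eq_range]
  induction g with
  | zero => simp
  | succ g ih =>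
    rw [add_mul, one_mul, Finset.sum_range_add, ih, Nat.cast_succ, add_mul, one_mul]
    congr 1
    refine Finset.sum_congr rfl fun x _ => ?_
    obtain ⟨c, hc⟩ : (d : ℤ) ∣ ((g * d + x + 1 : ℕ) : ℤ) ^ k - ((x + 1 : ℕ) : ℤ) ^ k :=
      (Dvd.intro_left (g : ℤ) (by push_cast; ring)).trans (sub_dvd_pow_sub_pow _ _ k)
    have hc' : ((g * d + x + 1 : ℕ) : ℝ) ^ k - ((x + 1 : ℕ) : ℝ) ^ k = d * c := by
      exact_mod_cast hc
    rw [sub_eq_iff_eq_add.mp hc', ← unitExp_add_int ((A : ℝ) / d * ((x + 1 : ℕ) : ℝ) ^ k) (A * c)]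
    congr 1
    push_cast
    field_simp
    ring

lemma prod_powerSum_eq {ι : Type*} [Fintype ι] [DecidableEq ι] (k P : ℕ) (a : ι → ℤ) (α : ℝ) :
    ∏ i, powerSum k P (α * a i) =
      ∑ x ∈ Fintype.piFinset fun _ : ι => Finset.Icc (1 : ℤ) P,
        unitExp (α * ((∑ i, a i * x i ^ k : ℤ) : ℝ)) := by
  simp only [powerSum]
  rw [Finset.prod_univ_sum]
  refine Finset.sum_congr rfl fun x _ => ?_
  rw [← unitExp_sum]
  congr 1
  push_cast
  rw [Finset.mul_sum]
  exact Finset.sum_congr rfl fun i _ => by ring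

lemma sum_prod_powerSum_eq {ι : Type*} [Fintype ι] [DecidableEq ι] (k N : ℕ) (hN : 0 < N)
    (a : ι → ℤ) :
    ∑ b ∈ Finset.range N, ∏ i, powerSum k N ((b : ℝ) / N * a i) =
      N * (((Fintype.piFinset fun _ : ι => Finset.Icc (1 : ℤ) N).filter fun x =>
        (N : ℤ) ∣ ∑ i, a i * x i ^ k).card : ℂ) := by
  simp_rw [prod_powerSum_eq]
  rw [Finset.sum_comm, Finset.card_filter, Nat.cast_sum, Finset.mul_sum]
  refine Finset.sum_congr rfl fun x _ => ?_
  have := sum_range_unitExp N hN (∑ i, a i * x i ^ k)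
  simp_rw [div_mul_eq_mul_div, ← mul_div_assoc] at this ⊢
  rw [this]
  split_ifs <;> simp

lemma card_filter_le_modSol {ι : Type*} [Fintype ι] [DecidableEq ι] (k N : ℕ) (hN : 0 < N)
    (a : ι → ℤ) :
    ((Fintype.piFinset fun _ : ι => Finset.Icc (1 : ℤ) N).filter fun x =>
        (N : ℤ) ∣ ∑ i, a i * x i ^ k).card ≤ modSol k a N := by
  have : NeZero N := ⟨hN.ne'⟩
  set S := (Fintype.piFinset fun _ : ι => Finset.Icc (1 : ℤ) N).filter fun x =>
        (N : ℤ) ∣ ∑ i, a i * x i ^ k with hS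
  let f : S → {r : ι → ZMod N // ∑ i, (a i : ZMod N) * r i ^ k = 0} := fun x =>
    ⟨fun i => (x.1 i : ZMod N), by
      have := (ZMod.intCast_zmod_eq_zero_iff_dvd _ N).mpr (Finset.mem_filter.mp x.2).2
      simpa using this⟩
  have hf : Function.Injective f := by
    intro x y hxy
    refine Subtype.ext (funext fun i => ?_)
    have h1 : ((x.1 i : ℤ) : ZMod N) = (y.1 i : ℤ) := congrFun (congrArg Subtype.val hxy) i
    rw [ZMod.intCast_eq_intCast_iff_dvd_sub] at h1
    have hx := Finset.mem_Icc.mp (Fintype.mem_piFinset.mp (Finset.mem_filter.mp x.2).1 i)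
    have hy := Finset.mem_Icc.mp (Fintype.mem_piFinset.mp (Finset.mem_filter.mp y.2).1 i)
    have := Int.eq_zero_of_abs_lt_dvd h1 (by rw [abs_lt]; omega)
    omega
  rw [modSol]
  simpa using Nat.card_le_card_of_injective f hf

lemma modSol_pos {ι : Type*} [Fintype ι] (k N : ℕ) (hk : k ≠ 0) (hN : 0 < N) (a : ι → ℤ) :
    0 < modSol k a N := by
  have : NeZero N := ⟨hN.ne'⟩
  have : Nonempty {r : ι → ZMod N // ∑ i, (a i : ZMod N) * r i ^ k = 0} :=
    ⟨⟨fun _ => 0, by simp [hk]⟩⟩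
  rw [modSol]
  exact Nat.card_pos

lemma modSol_mul_le {ι : Type*} [Fintype ι] (k m n : ℕ) (hm : 0 < m) (hn : 0 < n)
    (h : m.Coprime n) (a : ι → ℤ) : modSol k a m * modSol k a n ≤ modSol k a (m * n) := by
  have : NeZero (m * n) := ⟨(Nat.mul_pos hm hn).ne'⟩
  let e := ZMod.chineseRemainder h
  let f : {r : ι → ZMod m // ∑ i, (a i : ZMod m) * r i ^ k = 0} ×
      {r : ι → ZMod n // ∑ i, (a i : ZMod n) * r i ^ k = 0} →
      {r : ι → ZMod (m * n) // ∑ i, (a i : ZMod (m * n)) * r i ^ k = 0} := fun x =>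
    ⟨fun i => e.symm (x.1.1 i, x.2.1 i), by
      apply e.injective
      rw [map_sum, map_zero]
      simp only [map_mul, map_pow, map_intCast, RingEquiv.apply_symm_apply]
      ext
      · simpa [Prod.fst_sum] using x.1.2
      · simpa [Prod.snd_sum] using x.2.2⟩
  have hf : Function.Injective f := by
    intro x y hxy
    have h1 : ∀ i, (x.1.1 i, x.2.1 i) = (y.1.1 i, y.2.1 i) := fun i =>
      e.symm.injective (congrFun (congrArg Subtype.val hxy) i)
    exact Prod.ext (Subtype.ext (funext fun i => (Prod.ext_iff.mp (h1 i)).1))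
      (Subtype.ext (funext fun i => (Prod.ext_iff.mp (h1 i)).2))
  have := Nat.card_le_card_of_injective f hf
  rwa [Nat.card_prod] at this

lemma sum_gcd_le_sum_divisors (N : ℕ) (hN : 0 < N) (F : ℕ → ℝ) (hF : ∀ d, 0 ≤ F d) :
    ∑ b ∈ (Finset.range N).erase 0, F (N / N.gcd b) ≤
      ∑ d ∈ N.divisors.erase 1, d * F d := by
  have hmaps : ∀ b ∈ (Finset.range N).erase 0, N / N.gcd b ∈ N.divisors.erase 1 := by
    intro b hb
    rw [Finset.mem_erase, Finset.mem_range] at hb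
    rw [Finset.mem_erase, Nat.mem_divisors]
    refine ⟨fun h => ?_, Nat.div_dvd_of_dvd (Nat.gcd_dvd_left _ _), hN.ne'⟩
    have h1 := Nat.div_mul_cancel (Nat.gcd_dvd_left N b)
    rw [h, one_mul] at h1
    have h2 := Nat.le_of_dvd (Nat.pos_of_ne_zero hb.1) (Nat.gcd_dvd_right N b)
    omega
  rw [← Finset.sum_fiberwise_of_maps_to hmaps]
  refine Finset.sum_le_sum fun d hd => ?_
  have hdN : d ∣ N := Nat.dvd_of_mem_divisors (Finset.mem_of_mem_erase hd)
  have hd0 : 0 < d := Nat.pos_of_dvd_of_pos hdN hN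
  have hc : ((Finset.range N).erase 0 |>.filter fun b => N / N.gcd b = d).card ≤ d := by
    refine le_trans ?_ (Nat.totient_le d)
    have h1 := Nat.totient_div_of_dvd (Nat.div_dvd_of_dvd hdN)
    rw [Nat.div_div_self hdN hN.ne'] at h1
    rw [h1]
    refine Finset.card_le_card fun b hb => ?_
    simp only [Finset.mem_filter, Finset.mem_erase, Finset.mem_range] at hb ⊢
    refine ⟨hb.1.2, ?_⟩
    rw [← hb.2, Nat.div_div_self (Nat.gcd_dvd_left _ _) hN.ne']
  calc ∑ b ∈ (Finset.range N).erase 0 with N / N.gcd b = d, F (N / N.gcd b)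
      = ∑ b ∈ (Finset.range N).erase 0 with N / N.gcd b = d, F d :=
        Finset.sum_congr rfl fun b hb => by rw [(Finset.mem_filter.mp hb).2]
    _ = ((Finset.range N).erase 0 |>.filter fun b => N / N.gcd b = d).card * F d := by
        rw [Finset.sum_const, nsmul_eq_mul]
    _ ≤ d * F d := mul_le_mul_of_nonneg_right (by exact_mod_cast hc) (hF d)

lemma norm_powerSum_complete_le (k : ℕ) (σ C : ℝ)
    (hS : ∀ (q : ℕ) (a : ℤ), 0 < q → IsCoprime a q →
      ‖powerSum k q (a / q)‖ ≤ C * (q : ℝ) ^ (1 - σ)) (N b : ℕ) (hN : 0 < N) (a : ℤ)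
    (ha : IsCoprime a N) :
    ‖powerSum k N ((b : ℝ) / N * a)‖ ≤ N * (C * ((N / N.gcd b : ℕ) : ℝ) ^ (-σ)) := by
  set g := N.gcd b with hg
  have hg0 : 0 < g := Nat.gcd_pos_of_pos_left _ hN
  obtain ⟨d, hd⟩ := Nat.gcd_dvd_left N b
  obtain ⟨b', hb'⟩ := Nat.gcd_dvd_right N b
  rw [← hg] at hd hb'
  have hd0 : 0 < d := Nat.pos_of_ne_zero (by rintro rfl; simp at hd; omega)
  have hcop : Nat.Coprime b' d := by
    have := Nat.coprime_div_gcd_div_gcd (m := N) (n := b) hg0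
    rw [← hg, Nat.div_eq_of_eq_mul_right hg0 hd, Nat.div_eq_of_eq_mul_right hg0 hb'] at this
    exact this.symm
  have hNd : N / g = d := by
    rw [hd, Nat.mul_div_cancel_left _ hg0]
  have hda : IsCoprime (a * b') (d : ℤ) := by
    refine IsCoprime.mul_left (ha.of_isCoprime_of_dvd_right ?_) (Nat.isCoprime_iff_coprime.mpr hcop)
    rw [hd]
    exact ⟨g, by push_cast; ring⟩
  have hd1 : (0 : ℝ) < d := by exact_mod_cast hd0
  have hg1 : (0 : ℝ) < g := by exact_mod_cast hg0
  have e : (b : ℝ) / N * a = ((a * b' : ℤ) : ℝ) / d := by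
    have h1 : (N : ℝ) = g * d := by exact_mod_cast hd
    have h2 : (b : ℝ) = g * b' := by exact_mod_cast hb'
    rw [h1, h2]
    push_cast
    field_simp
  rw [hNd, e]
  have hN2 : powerSum k N (((a * b' : ℤ) : ℝ) / d) = g * powerSum k d (((a * b' : ℤ) : ℝ) / d) := by
    rw [← powerSum_mul_eq k g d hd0, ← hd]
  rw [hN2, norm_mul, Complex.norm_natCast]
  calc (g : ℝ) * ‖powerSum k d (((a * b' : ℤ) : ℝ) / d)‖ ≤ g * (C * (d : ℝ) ^ (1 - σ)) :=
        mul_le_mul_of_nonneg_left (hS d _ hd0 hda) hg1.le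
    _ = N * (C * (d : ℝ) ^ (-σ)) := by
        rw [sub_eq_add_neg, Real.rpow_add hd1, Real.rpow_one]
        have h1 : (N : ℝ) = g * d := by exact_mod_cast hd
        rw [h1]
        ring

/-- If all prime factors of `N` are large, there are many solutions modulo `N`. -/
lemma exists_le_modSol_of_large_primes {ι : Type*} [Fintype ι] (k : ℕ) (hk : 2 ≤ k)
    (hs : 2 ^ k + 1 ≤ Fintype.card ι) (a : ι → ℤ) (ha : ∀ i, a i ≠ 0) :
    ∃ p0 : ℕ, ∀ N : ℕ, 0 < N → (∀ p, p.Prime → p ∣ N → p0 ≤ p) →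
      1 / 2 * (N : ℝ) ^ (Fintype.card ι - 1) ≤ modSol k a N := by
  classical
  obtain ⟨σ, hσ0, hσ1, hσ, C, hC, hcs⟩ := exists_complete_sum_bound k hk
  set s := Fintype.card ι with hsdef
  have hs' : (2 ^ k + 1 : ℝ) ≤ s := by exact_mod_cast hs
  have hE : 1 < s * σ - 1 := by nlinarith
  have hsum : Summable fun q : ℕ => (q : ℝ) ^ (-(s * σ - 1)) :=
    Real.summable_nat_rpow.mpr (by linarith)
  obtain ⟨S, hS⟩ := summable_iff_vanishing_norm.mp hsum (1 / (2 * C ^ s)) (by positivity)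
  refine ⟨S.sup id + ∑ i, (a i).natAbs + 1, fun N hN hpN => ?_⟩
  have hN' : (0 : ℝ) < N := by exact_mod_cast hN
  have hcop : ∀ i, IsCoprime (a i) (N : ℤ) := by
    intro i
    rw [Int.isCoprime_iff_gcd_eq_one]
    by_contra hne
    obtain ⟨p, hp, hpd⟩ := Nat.exists_prime_and_dvd hne
    have h1 : p ∣ N := by
      have := hpd.trans (Int.gcd_dvd_natAbs_right (a i) (N : ℤ))
      simpa using this
    have h2 : p ∣ (a i).natAbs := hpd.trans (Int.gcd_dvd_natAbs_left (a i) (N : ℤ))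
    have h3 := Nat.le_of_dvd (Int.natAbs_pos.mpr (ha i)) h2
    have h4 := Finset.single_le_sum (f := fun i => (a i).natAbs) (fun _ _ => Nat.zero_le _)
      (Finset.mem_univ i)
    have h5 := hpN p hp h1
    omega
  set M := ((Fintype.piFinset fun _ : ι => Finset.Icc (1 : ℤ) N).filter fun x =>
        (N : ℤ) ∣ ∑ i, a i * x i ^ k).card with hM
  have hid := sum_prod_powerSum_eq k N hN a
  rw [← Finset.add_sum_erase _ _ (Finset.mem_range.mpr hN)] at hid
  have h0 : ∏ i, powerSum k N (((0 : ℕ) : ℝ) / N * a i) = (N : ℂ) ^ s := by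
    simp [powerSum, hsdef]
  rw [h0] at hid
  have hbound : ‖∑ b ∈ (Finset.range N).erase 0, ∏ i, powerSum k N ((b : ℝ) / N * a i)‖ ≤
      (N : ℝ) ^ s / 2 := by
    calc ‖∑ b ∈ (Finset.range N).erase 0, ∏ i, powerSum k N ((b : ℝ) / N * a i)‖
        ≤ ∑ b ∈ (Finset.range N).erase 0,
          (N * (C * ((N / N.gcd b : ℕ) : ℝ) ^ (-σ))) ^ s := by
          refine (norm_sum_le _ _).trans (Finset.sum_le_sum fun b _ => ?_)
          rw [norm_prod]
          refine (Finset.prod_le_prod (fun i _ => norm_nonneg _) fun i _ =>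
            norm_powerSum_complete_le k σ C hcs N b hN (a i) (hcop i)).trans ?_
          rw [Finset.prod_const, Finset.card_univ]
      _ ≤ ∑ d ∈ N.divisors.erase 1, d * (N * (C * (d : ℝ) ^ (-σ))) ^ s :=
          sum_gcd_le_sum_divisors N hN (fun d => (N * (C * (d : ℝ) ^ (-σ))) ^ s)
            fun d => by positivity
      _ = (N : ℝ) ^ s * C ^ s * ∑ d ∈ N.divisors.erase 1, (d : ℝ) ^ (-(s * σ - 1)) := by
          rw [Finset.mul_sum]
          refine Finset.sum_congr rfl fun d hd => ?_
          have hd0 : (0 : ℝ) < d := by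
            exact_mod_cast Nat.pos_of_mem_divisors (Finset.mem_of_mem_erase hd)
          rw [mul_pow, mul_pow, ← Real.rpow_mul_natCast hd0.le,
            show -(s * σ - 1) = -σ * s + 1 by ring, Real.rpow_add_one hd0.ne']
          ring
      _ ≤ (N : ℝ) ^ s * C ^ s * (1 / (2 * C ^ s)) := by
          refine mul_le_mul_of_nonneg_left ?_ (by positivity)
          refine (le_abs_self _).trans (hS _ ?_).le
          rw [Finset.disjoint_left]
          intro d hd hdS
          rw [Finset.mem_erase, Nat.mem_divisors] at hd
          obtain ⟨p, hp, hpd⟩ := Nat.exists_prime_and_dvd hd.1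
          have h1 := hpN p hp (hpd.trans hd.2.1)
          have h2 := Nat.le_of_dvd (Nat.pos_of_dvd_of_pos hd.2.1 hN) hpd
          have h3 : d ≤ S.sup id := Finset.le_sup (f := id) hdS
          omega
      _ = (N : ℝ) ^ s / 2 := by
          field_simp
  have hge : (N : ℝ) ^ s / 2 ≤ N * M := by
    have h1 : ((N * M : ℝ) : ℂ) - ((N : ℝ) : ℂ) ^ s =
        ∑ b ∈ (Finset.range N).erase 0, ∏ i, powerSum k N ((b : ℝ) / N * a i) := by
      push_cast
      rw [← hid]
      ring
    rw [← h1, ← Complex.ofReal_pow, ← Complex.ofReal_sub, Complex.norm_real,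
      Real.norm_eq_abs] at hbound
    have := (abs_le.mp hbound).1
    linarith
  have hMle : (M : ℝ) ≤ modSol k a N := by exact_mod_cast card_filter_le_modSol k N hN a
  refine le_trans ?_ hMle
  have hs1 : (N : ℝ) ^ s = N * (N : ℝ) ^ (s - 1) := by
    rw [← pow_succ']
    congr 1
    have := Nat.one_le_two_pow (n := k)
    omega
  rw [hs1] at hge
  have : (N : ℝ) * (1 / 2 * (N : ℝ) ^ (s - 1)) ≤ N * M := by linarith
  exact le_of_mul_le_mul_left this hN'

/-- The number of solutions modulo `N` is bounded below by a constant times the expected size. -/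
theorem exists_le_modSol {ι : Type*} [Fintype ι] (k : ℕ) (hk : 2 ≤ k)
    (hs₁ : 2 ^ k + 1 ≤ Fintype.card ι) (hs₂ : 4 * k ^ 2 - 4 * k + 1 ≤ Fintype.card ι)
    (a : ι → ℤ) (ha : ∀ i, a i ≠ 0) :
    ∃ c : ℝ, 0 < c ∧ ∀ N : ℕ, 0 < N → c * (N : ℝ) ^ (Fintype.card ι - 1) ≤ modSol k a N := by
  obtain ⟨p0, hp0⟩ := exists_le_modSol_of_large_primes k hk hs₁ a ha
  have key : ∀ d : ℕ, ∃ c : ℝ, 0 < c ∧ ∀ N : ℕ, 0 < N →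
      (∀ p, p.Prime → p ∣ N → p0 - d ≤ p) →
        c * (N : ℝ) ^ (Fintype.card ι - 1) ≤ modSol k a N := by
    intro d
    induction d with
    | zero => exact ⟨1 / 2, by norm_num, fun N hN h => hp0 N hN h⟩
    | succ d ih =>
      obtain ⟨c, hc, ih⟩ := ih
      by_cases hp : (p0 - (d + 1)).Prime
      · set p := p0 - (d + 1) with hpdef
        obtain ⟨T, hT⟩ := exists_le_modSol_prime_pow k hk hs₂ a ha p hp
        have hpp : (0 : ℝ) < p := by exact_mod_cast hp.pos
        set r := Fintype.card ι - 1 with hr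
        have hloc : ∀ t, (((p : ℝ) ^ T) ^ r)⁻¹ * ((p ^ t : ℕ) : ℝ) ^ r ≤ modSol k a (p ^ t) := by
          intro t
          rw [inv_mul_le_iff₀ (by positivity)]
          rcases le_total T t with htT | htT
          · have h1 : (((p ^ (t - T)) ^ r : ℕ) : ℝ) ≤ modSol k a (p ^ t) := by
              exact_mod_cast hT t htT
            calc ((p ^ t : ℕ) : ℝ) ^ r = ((p : ℝ) ^ T) ^ r * (((p ^ (t - T)) ^ r : ℕ) : ℝ) := by
                  push_cast
                  rw [← mul_pow, ← pow_add, Nat.add_sub_cancel' htT]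
              _ ≤ _ := mul_le_mul_of_nonneg_left h1 (by positivity)
          · have h1 : (1 : ℝ) ≤ modSol k a (p ^ t) := by
              exact_mod_cast modSol_pos k (p ^ t) (by omega) (pow_pos hp.pos t) a
            have h2 : ((p ^ t : ℕ) : ℝ) ^ r ≤ ((p : ℝ) ^ T) ^ r := by
              push_cast
              refine pow_le_pow_left₀ (by positivity) (pow_le_pow_right₀ ?_ htT) r
              exact_mod_cast hp.one_le
            exact h2.trans (le_mul_of_one_le_right (by positivity) h1)
        refine ⟨(((p : ℝ) ^ T) ^ r)⁻¹ * c, by positivity, fun N hN h => ?_⟩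
        obtain ⟨t, n, hpn, rfl⟩ := Nat.exists_eq_pow_mul_and_not_dvd hN.ne' p hp.ne_one
        have hn : 0 < n := Nat.pos_of_mul_pos_left hN
        have h1 := ih n hn fun q hq hqn => by
          have h1 := h q hq (hqn.mul_left _)
          have h2 : q ≠ p := by
            rintro rfl
            exact hpn hqn
          omega
        have h2 := modSol_mul_le k (p ^ t) n (pow_pos hp.pos t) hn
          (((Nat.Prime.coprime_iff_not_dvd hp).mpr hpn).pow_left t) a
        calc (((p : ℝ) ^ T) ^ r)⁻¹ * c * ((p ^ t * n : ℕ) : ℝ) ^ r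
            = ((((p : ℝ) ^ T) ^ r)⁻¹ * ((p ^ t : ℕ) : ℝ) ^ r) * (c * (n : ℝ) ^ r) := by
              push_cast
              rw [mul_pow]
              ring
          _ ≤ modSol k a (p ^ t) * modSol k a n := by
              exact mul_le_mul (hloc t) h1 (by positivity) (by positivity)
          _ ≤ _ := by exact_mod_cast h2
      · refine ⟨c, hc, fun N hN h => ih N hN fun q hq hqN => ?_⟩
        have h1 := h q hq hqN
        have h2 : q ≠ p0 - (d + 1) := by
          rintro rfl
          exact hp hq
        omega
  obtain ⟨c, hc, h⟩ := key p0
  exact ⟨c, hc, fun N hN => h N hN fun p _ _ => by omega⟩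

lemma exists_floor_root (k : ℕ) (hk : k ≠ 0) (b Y : ℤ) (hb : 1 ≤ b) (hY : 0 ≤ Y) :
    ∃ X : ℤ, 0 ≤ X ∧ b * X ^ k ≤ Y ∧ Y < b * (X + 1) ^ k := by
  obtain ⟨X, ⟨hX0, hX⟩, hmax⟩ := Int.exists_greatest_of_bdd
    (P := fun z : ℤ => 0 ≤ z ∧ b * z ^ k ≤ Y)
    ⟨Y, fun z hz => by
      rcases hz.1.eq_or_lt with h | h
      · omega
      · have h1 : z ≤ z ^ k := le_self_pow₀ (by omega) hk
        have h2 : z ^ k ≤ b * z ^ k := le_mul_of_one_le_left (by positivity) hb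
        exact h1.trans (h2.trans hz.2)⟩
    ⟨0, le_rfl, by simpa [hk] using hY⟩
  refine ⟨X, hX0, hX, ?_⟩
  by_contra h
  have := hmax (X + 1) ⟨by omega, not_lt.mp h⟩
  omega

lemma pow_sub_pow_le_mul (k : ℕ) (u v : ℤ) (hu : 0 ≤ u) (huv : u ≤ v) :
    v ^ k - u ^ k ≤ (v - u) * k * v ^ (k - 1) := by
  induction k with
  | zero => simp
  | succ k ih =>
    have hv : 0 ≤ v := hu.trans huv
    have h1 : u ^ k ≤ v ^ k := pow_le_pow_left₀ hu huv k
    have h2 : v * ((v - u) * k * v ^ (k - 1)) = (v - u) * k * v ^ k := by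
      rcases k with _ | k
      · simp
      · rw [Nat.add_sub_cancel, pow_succ]
        ring
    have h3 := mul_le_mul_of_nonneg_left ih hv
    have h4 := mul_le_mul_of_nonneg_left h1 (sub_nonneg.mpr huv)
    rw [h2] at h3
    rw [Nat.add_sub_cancel]
    push_cast
    linear_combination h3 + h4

/-- Lower and upper bounds for a diagonal sum with one dominant positive term. -/
lemma diagonal_sum_bounds {ι : Type*} [DecidableEq ι] (k M A : ℕ) (hk : k ≠ 0) (S : Finset ι)
    (a : ι → ℤ) (hA : ∑ i ∈ S, |a i| ≤ A) (i1 : ι) (hi1 : i1 ∈ S) (h1 : 0 < a i1) (y : ι → ℤ)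
    (hy1 : 2 * A * M ≤ y i1) (hy1' : y i1 ≤ (2 * A + 1) * M)
    (hy : ∀ i, i ≠ i1 → 0 ≤ y i ∧ y i ≤ M) :
    A * (M : ℤ) ^ k ≤ ∑ i ∈ S, a i * y i ^ k ∧
      ∑ i ∈ S, a i * y i ^ k ≤ ((A * (2 * A + 1) * M : ℕ) : ℤ) ^ k := by
  have hM : (0 : ℤ) ≤ M := Nat.cast_nonneg M
  have hA0 : (0 : ℤ) ≤ A := Nat.cast_nonneg A
  have hA1 : (1 : ℤ) ≤ A := by
    refine le_trans ?_ hA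
    refine le_trans ?_ (Finset.single_le_sum (f := fun i => |a i|) (fun i _ => abs_nonneg _) hi1)
    exact Int.one_le_abs h1.ne'
  constructor
  · rw [← Finset.add_sum_erase _ _ hi1]
    have e1 : 2 * A * (M : ℤ) ^ k ≤ a i1 * y i1 ^ k := by
      calc 2 * A * (M : ℤ) ^ k ≤ (2 * A) ^ k * (M : ℤ) ^ k :=
            mul_le_mul_of_nonneg_right (le_self_pow₀ (by omega) hk) (by positivity)
        _ = (2 * A * M) ^ k := by rw [← mul_pow]
        _ ≤ y i1 ^ k := pow_le_pow_left₀ (by positivity) hy1 k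
        _ ≤ a i1 * y i1 ^ k := le_mul_of_one_le_left
            (pow_nonneg (le_trans (by positivity) hy1) k) h1
    have e2 : -(A * (M : ℤ) ^ k) ≤ ∑ i ∈ S.erase i1, a i * y i ^ k := by
      calc -(A * (M : ℤ) ^ k) ≤ -((∑ i ∈ S.erase i1, |a i|) * (M : ℤ) ^ k) := by
            refine neg_le_neg (mul_le_mul_of_nonneg_right (le_trans ?_ hA) (by positivity))
            exact Finset.sum_le_sum_of_subset_of_nonneg (Finset.erase_subset _ _)
              fun i _ _ => abs_nonneg _
        _ = ∑ i ∈ S.erase i1, -(|a i| * (M : ℤ) ^ k) := by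
            rw [Finset.sum_neg_distrib, Finset.sum_mul]
        _ ≤ _ := by
            refine Finset.sum_le_sum fun i hi => ?_
            obtain ⟨g1, g2⟩ := hy i (Finset.ne_of_mem_erase hi)
            have g3 := mul_le_mul_of_nonneg_left (pow_le_pow_left₀ g1 g2 k) (abs_nonneg (a i))
            have g4 := mul_le_mul_of_nonneg_right (neg_abs_le (a i)) (pow_nonneg g1 k)
            linarith
    linarith
  · calc ∑ i ∈ S, a i * y i ^ k ≤ ∑ i ∈ S, |a i| * ((2 * A + 1) * (M : ℤ)) ^ k := by
          refine Finset.sum_le_sum fun i _ => ?_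
          have g : 0 ≤ y i ∧ y i ≤ (2 * A + 1) * (M : ℤ) := by
            by_cases hi : i = i1
            · rw [hi]
              exact ⟨le_trans (by positivity) hy1, hy1'⟩
            · obtain ⟨g1, g2⟩ := hy i hi
              exact ⟨g1, g2.trans (le_mul_of_one_le_left hM (by omega))⟩
          exact mul_le_mul (le_abs_self _) (pow_le_pow_left₀ g.1 g.2 k) (pow_nonneg g.1 k)
            (abs_nonneg _)
      _ = (∑ i ∈ S, |a i|) * ((2 * A + 1) * (M : ℤ)) ^ k := by rw [Finset.sum_mul]
      _ ≤ (A : ℤ) ^ k * ((2 * A + 1) * (M : ℤ)) ^ k :=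
          mul_le_mul_of_nonneg_right (hA.trans (le_self_pow₀ hA1 hk)) (by positivity)
      _ = _ := by
          rw [← mul_pow]
          push_cast
          ring

lemma modSol_mul_le_card {ι : Type*} [Fintype ι] [DecidableEq ι] (k W M A J T : ℕ) (hk : k ≠ 0)
    (hW : 0 < W) (hM : 0 < M) (a : ι → ℤ) (hA : ∑ i, |a i| ≤ A) (i0 i1 : ι) (h0 : a i0 < 0)
    (h1 : 0 < a i1) (hJM : W * J ≤ M)
    (hJT : J * (A * k * (2 * (A * (2 * A + 1) * M)) ^ (k - 1)) ≤ T) :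
    modSol k a W * ((M / W) ^ (Fintype.card ι - 1) * J) ≤
      ((Fintype.piFinset fun _ : ι => Finset.Icc (1 : ℤ) (A * (2 * A + 1) * M : ℕ)).filter fun x =>
        (W : ℤ) ∣ ∑ i, a i * x i ^ k ∧ 0 ≤ ∑ i, a i * x i ^ k ∧
          ∑ i, a i * x i ^ k < W * T).card := by
  have : NeZero W := ⟨hW.ne'⟩
  have h01 : i1 ≠ i0 := by
    rintro rfl
    omega
  set D := A * (2 * A + 1) * M with hD
  set L := M / W with hL
  have hWL : W * L ≤ M := Nat.mul_div_le M W
  set b := -a i0 with hb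
  have hAb : b ≤ A := by
    have := Finset.single_le_sum (f := fun i => |a i|) (fun i _ => abs_nonneg _)
      (Finset.mem_univ i0)
    exact (neg_le_abs _).trans (this.trans hA)
  have hA1 : 1 ≤ A := by omega
  have hMD : (2 * A + 1) * M ≤ D := by
    rw [hD, mul_assoc]
    exact Nat.le_mul_of_pos_left _ hA1
  have hMD' : M ≤ D := le_trans (Nat.le_mul_of_pos_left _ (by omega)) hMD
  choose! X hX0 hX1 hX2 using fun Y => exists_floor_root k hk b Y (by omega)
  let base : ι → ℤ := fun i => if i = i1 then 2 * A * M else 0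
  let Sol := {r : ι → ZMod W // ∑ i, (a i : ZMod W) * r i ^ k = 0}
  let Dom := Sol × (({i // i ≠ i0} → Fin L) × Fin J)
  let y : Dom → ι → ℤ := fun p i =>
    base i + 1 + ((p.1.1 i - ((base i + 1 : ℤ) : ZMod W)).val +
      W * (if h : i ≠ i0 then (p.2.1 ⟨i, h⟩ : ℤ) else 0))
  let Y : Dom → ℤ := fun p => ∑ i ∈ Finset.univ.erase i0, a i * y p i ^ k
  let z : Dom → ℤ := fun p =>
    X (Y p) - (((X (Y p) : ZMod W) - p.1.1 i0).val + W * (p.2.2 : ℤ))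
  let x : Dom → ι → ℤ := fun p => Function.update (y p) i0 (z p)
  have hvlt : ∀ u : ZMod W, (u.val : ℤ) < W := fun u => by exact_mod_cast ZMod.val_lt u
  have hlin : ∀ (u : ZMod W) (n N : ℕ), n < N →
      0 ≤ (u.val : ℤ) + W * n ∧ (u.val : ℤ) + W * n + 1 ≤ W * N := by
    intro u n N hn
    have g1 := hvlt u
    have g2 : (W : ℤ) * (n + 1) ≤ W * N := by
      exact_mod_cast Nat.mul_le_mul_left W hn
    exact ⟨by positivity, by linarith⟩
  have hy : ∀ p i, i ≠ i0 → base i + 1 ≤ y p i ∧ y p i ≤ base i + M := by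
    intro p i hi
    simp only [y, dif_pos hi]
    obtain ⟨g1, g2⟩ := hlin (p.1.1 i - ((base i + 1 : ℤ) : ZMod W)) (p.2.1 ⟨i, hi⟩) L
      (p.2.1 ⟨i, hi⟩).2
    have g3 : (W : ℤ) * L ≤ M := by exact_mod_cast hWL
    constructor <;> linarith
  have hycast : ∀ p i, ((y p i : ℤ) : ZMod W) = p.1.1 i := by
    intro p i
    simp only [y]
    push_cast
    simp
  have hzcast : ∀ p, ((z p : ℤ) : ZMod W) = p.1.1 i0 := by
    intro p
    simp only [z]
    push_cast
    simp
  have hxcast : ∀ p i, ((x p i : ℤ) : ZMod W) = p.1.1 i := by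
    intro p i
    by_cases hi : i = i0
    · subst hi
      simp only [x, Function.update_self]
      exact hzcast p
    · simp only [x, Function.update_of_ne hi]
      exact hycast p i
  have hYb : ∀ p, A * (M : ℤ) ^ k ≤ Y p ∧ Y p ≤ (D : ℤ) ^ k := by
    intro p
    have hy1 := hy p i1 h01
    simp only [base, if_true] at hy1
    have := diagonal_sum_bounds k M A hk (Finset.univ.erase i0) a
      ((Finset.sum_le_sum_of_subset_of_nonneg (Finset.erase_subset _ _)
        fun i _ _ => abs_nonneg _).trans hA) i1 (Finset.mem_erase.mpr ⟨h01, Finset.mem_univ _⟩) h1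
      (fun i => if i = i0 then 0 else y p i) (by rw [if_neg h01]; linarith)
      (by rw [if_neg h01]; linarith) (fun i hi => by
        split_ifs with h
        · exact ⟨le_rfl, by positivity⟩
        · have := hy p i h
          simp only [base, if_neg hi] at this
          constructor <;> linarith)
    have e : ∑ i ∈ Finset.univ.erase i0, a i * (if i = i0 then 0 else y p i) ^ k = Y p :=
      Finset.sum_congr rfl fun i hi => by rw [if_neg (Finset.ne_of_mem_erase hi)]
    rwa [e] at this
  have hY0 : ∀ p, 0 ≤ Y p := fun p => le_trans (by positivity) (hYb p).1
  have hXM : ∀ p, (M : ℤ) ≤ X (Y p) := by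
    intro p
    by_contra hlt
    have g1 := hX2 _ (hY0 p)
    have g2 : (X (Y p) + 1) ^ k ≤ (M : ℤ) ^ k :=
      pow_le_pow_left₀ (by have := hX0 _ (hY0 p); omega) (by omega) k
    have g3 := mul_le_mul hAb g2 (pow_nonneg (by have := hX0 _ (hY0 p); omega) k) (by positivity)
    have := (hYb p).1
    linarith
  have hXD : ∀ p, X (Y p) ≤ D := by
    intro p
    by_contra hlt
    have g1 := hX1 _ (hY0 p)
    have g2 : (D : ℤ) ^ k < X (Y p) ^ k := pow_lt_pow_left₀ (by omega) (by positivity) hk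
    have g3 : X (Y p) ^ k ≤ b * X (Y p) ^ k :=
      le_mul_of_one_le_left (pow_nonneg (hX0 _ (hY0 p)) k) (by omega)
    have := (hYb p).2
    linarith
  have hz : ∀ p, 1 ≤ z p ∧ z p ≤ X (Y p) ∧ X (Y p) + 1 - z p ≤ W * J := by
    intro p
    obtain ⟨g1, g2⟩ := hlin ((X (Y p) : ZMod W) - p.1.1 i0) p.2.2 J p.2.2.2
    have g3 : (W : ℤ) * J ≤ M := by exact_mod_cast hJM
    have g4 := hXM p
    simp only [z]
    refine ⟨?_, ?_, ?_⟩ <;> linarith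
  have hF : ∀ p, ∑ i, a i * x p i ^ k = Y p - b * z p ^ k := by
    intro p
    rw [← Finset.add_sum_erase _ _ (Finset.mem_univ i0)]
    have e : ∑ i ∈ Finset.univ.erase i0, a i * x p i ^ k = Y p :=
      Finset.sum_congr rfl fun i hi => by
        simp only [x, Function.update_of_ne (Finset.ne_of_mem_erase hi)]
    rw [e]
    simp only [x, Function.update_self, b]
    ring
  have hinj : Function.Injective x := by
    intro p q hpq
    have e1 : p.1 = q.1 := Subtype.ext (funext fun i => by rw [← hxcast p, ← hxcast q, hpq])
    have e2 : ∀ i, i ≠ i0 → y p i = y q i := by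
      intro i hi
      have := congrFun hpq i
      simpa only [x, Function.update_of_ne hi] using this
    have hW' : (W : ℤ) ≠ 0 := by exact_mod_cast hW.ne'
    have e3 : p.2.1 = q.2.1 := by
      refine funext fun i => ?_
      have := e2 i.1 i.2
      simp only [y, dif_pos i.2, e1, add_right_inj, mul_right_inj' hW'] at this
      exact Fin.ext (by exact_mod_cast this)
    have e4 : Y p = Y q := Finset.sum_congr rfl fun i hi => by
      rw [e2 i (Finset.ne_of_mem_erase hi)]
    have e5 : z p = z q := by
      have := congrFun hpq i0
      simpa only [x, Function.update_self] using this
    simp only [z, e4, e1, sub_right_inj, add_right_inj, mul_right_inj' hW'] at e5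
    exact Prod.ext e1 (Prod.ext e3 (Fin.ext (by exact_mod_cast e5)))
  have hmem : ∀ p, x p ∈ (Fintype.piFinset fun _ : ι => Finset.Icc (1 : ℤ) D).filter fun x =>
        (W : ℤ) ∣ ∑ i, a i * x i ^ k ∧ 0 ≤ ∑ i, a i * x i ^ k ∧ ∑ i, a i * x i ^ k < W * T := by
    intro p
    obtain ⟨z1, z2, z3⟩ := hz p
    rw [Finset.mem_filter, Fintype.mem_piFinset]
    refine ⟨fun i => ?_, ?_, ?_, ?_⟩
    · rw [Finset.mem_Icc]
      by_cases hi : i = i0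
      · subst hi
        simp only [x, Function.update_self]
        exact ⟨z1, z2.trans (hXD p)⟩
      · simp only [x, Function.update_of_ne hi]
        have g1 := hy p i hi
        have g2 : ((2 * A + 1) * M : ℤ) ≤ D := by exact_mod_cast hMD
        have g3 : (M : ℤ) ≤ D := by exact_mod_cast hMD'
        have g4 : (0 : ℤ) ≤ A * M := by positivity
        simp only [base] at g1
        split_ifs at g1
        · exact ⟨by linarith, by linarith⟩
        · exact ⟨by linarith, by linarith⟩
    · rw [← ZMod.intCast_zmod_eq_zero_iff_dvd]
      have := p.1.2
      push_cast
      simp_rw [hxcast p]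
      exact this
    · rw [hF]
      have g1 := hX1 _ (hY0 p)
      have g2 := mul_le_mul_of_nonneg_left (pow_le_pow_left₀ (by omega) z2 k) (by omega : 0 ≤ b)
      linarith
    · rw [hF]
      have g1 := hX2 _ (hY0 p)
      have g2 := pow_sub_pow_le_mul k (z p) (X (Y p) + 1) (by omega) (by omega)
      have g3 : (X (Y p) + 1) ^ (k - 1) ≤ (2 * (D : ℤ)) ^ (k - 1) :=
        pow_le_pow_left₀ (by omega) (by have := hXD p; omega) _
      have g4 : (X (Y p) + 1 - z p) * k * (X (Y p) + 1) ^ (k - 1) ≤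
          W * J * k * (2 * (D : ℤ)) ^ (k - 1) :=
        mul_le_mul (mul_le_mul_of_nonneg_right z3 (by positivity)) g3
          (pow_nonneg (by omega) _) (by positivity)
      have g5 := mul_le_mul hAb (g2.trans g4)
        (sub_nonneg.mpr (pow_le_pow_left₀ (by omega) (by omega) k)) (by positivity)
      have g6 : (W : ℤ) * (J * (A * k * (2 * D) ^ (k - 1))) ≤ W * T := by
        exact_mod_cast Nat.mul_le_mul_left W hJT
      linarith
  have hcard := Nat.card_le_card_of_injective
    (fun p => (⟨x p, hmem p⟩ : {x // x ∈ (Fintype.piFinset fun _ : ι =>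
      Finset.Icc (1 : ℤ) D).filter fun x => (W : ℤ) ∣ ∑ i, a i * x i ^ k ∧
        0 ≤ ∑ i, a i * x i ^ k ∧ ∑ i, a i * x i ^ k < W * T}))
    (fun p q hpq => hinj (congrArg Subtype.val hpq))
  have hsub : Nat.card {i // i ≠ i0} = Fintype.card ι - 1 := by
    simp
  rw [Nat.card_prod, Nat.card_prod, Nat.card_fun, Nat.card_fin, Nat.card_fin, hsub,
    Nat.card_eq_finsetCard] at hcard
  exact hcard

/-- Lower bound for the number of points in a box at which a diagonal form with coefficients of
both signs takes a value in a short interval that is divisible by a given modulus. -/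
theorem exists_le_card_value_dvd {ι : Type*} [Fintype ι] [DecidableEq ι] (k : ℕ) (hk : 2 ≤ k)
    (hs₁ : 2 ^ k + 1 ≤ Fintype.card ι) (hs₂ : 4 * k ^ 2 - 4 * k + 1 ≤ Fintype.card ι)
    (a : ι → ℤ) (ha : ∀ i, a i ≠ 0) (i0 i1 : ι) (h0 : a i0 < 0) (h1 : 0 < a i1) :
    ∃ c : ℝ, 0 < c ∧ ∃ η1 : ℝ, 0 < η1 ∧ ∀ W : ℕ, 0 < W → ∀ η : ℝ, 0 < η → η ≤ η1 →
      ∃ P1 : ℕ, ∀ P : ℕ, P1 ≤ P → ∃ T : ℕ, 0 < T ∧ (W : ℝ) * T ≤ η * (P : ℝ) ^ k ∧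
        c * (T * ((P : ℝ) ^ Fintype.card ι / (P : ℝ) ^ k)) ≤
          (((Fintype.piFinset fun _ : ι => Finset.Icc (1 : ℤ) P).filter fun x =>
            (W : ℤ) ∣ ∑ i, a i * x i ^ k ∧ 0 ≤ ∑ i, a i * x i ^ k ∧
              ∑ i, a i * x i ^ k < W * T).card : ℝ) := by
  obtain ⟨c0, hc0, hmod⟩ := exists_le_modSol k hk hs₁ hs₂ a ha
  set s := Fintype.card ι with hs
  obtain ⟨A, hA⟩ : ∃ A : ℕ, ∑ i, |a i| = A :=
    ⟨∑ i, (a i).natAbs, by push_cast; rfl⟩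
  have hA1 : 1 ≤ A := by
    have g1 := Finset.single_le_sum (f := fun i => |a i|) (fun i _ => abs_nonneg _)
      (Finset.mem_univ i1)
    have g2 := Int.one_le_abs h1.ne'
    have g3 : |a i1| ≤ (A : ℤ) := by rw [← hA]; exact g1
    omega
  set B := A * (2 * A + 1) with hB
  have hB0 : 0 < B := by positivity
  have hB' : (0 : ℝ) < B := by exact_mod_cast hB0
  have hA' : (1 : ℝ) ≤ A := by exact_mod_cast hA1
  have hk' : (1 : ℝ) ≤ k := by exact_mod_cast (by omega : 1 ≤ k)
  set E : ℝ := A * k * 2 ^ (k - 1) with hE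
  have hE0 : 0 < E := by positivity
  refine ⟨c0 / ((4 * B) ^ (s - 1) * (2 * E)), by positivity, 1 / (2 * B), by positivity,
    fun W hW η hη hη1 => ⟨⌈W * (2 + E) / η⌉₊ + B * W + 1, fun P hP => ?_⟩⟩
  have hW' : (0 : ℝ) < W := by exact_mod_cast hW
  have hPpos : 0 < P := by omega
  have hP' : (1 : ℝ) ≤ P := by exact_mod_cast hPpos
  have hP0 : (0 : ℝ) < P := by linarith
  set M := P / B with hM
  have hWM : W ≤ M := (Nat.le_div_iff_mul_le hB0).mpr (by nlinarith)
  have hM0 : 0 < M := hW.trans_le hWM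
  have hBM : B * M ≤ P := Nat.mul_div_le P B
  have hPBM : P ≤ 2 * (B * M) := by
    have := Nat.lt_mul_div_succ P hB0
    rw [← hM, mul_add] at this
    have g : B * 1 ≤ B * M := Nat.mul_le_mul_left B hM0
    omega
  set T := ⌊η * (P : ℝ) ^ k / W⌋₊ with hT
  have hWT : (W : ℝ) * T ≤ η * (P : ℝ) ^ k := by
    rw [mul_comm, ← le_div_iff₀ hW']
    exact Nat.floor_le (by positivity)
  have hpk : (P : ℝ) ^ k = P * (P : ℝ) ^ (k - 1) := by
    rw [← pow_succ']
    congr 1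
    omega
  set Z := A * k * (2 * (B * M)) ^ (k - 1) with hZ
  have hZ0 : 0 < Z := by positivity
  have hZP : (Z : ℝ) ≤ E * (P : ℝ) ^ (k - 1) := by
    have g1 : (B * M : ℝ) ≤ P := by exact_mod_cast hBM
    have g2 : (2 * (B * M) : ℝ) ^ (k - 1) ≤ (2 * P) ^ (k - 1) :=
      pow_le_pow_left₀ (by positivity) (by linarith) _
    calc (Z : ℝ) = A * k * (2 * (B * M)) ^ (k - 1) := by rw [hZ]; push_cast; ring
      _ ≤ A * k * (2 * P) ^ (k - 1) := mul_le_mul_of_nonneg_left g2 (by positivity)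
      _ = E * (P : ℝ) ^ (k - 1) := by rw [mul_pow, hE]; ring
  have hZT : (Z : ℝ) ≤ T := by
    have g1 : W * (2 + E) / η ≤ P := by
      refine (Nat.le_ceil _).trans ?_
      exact_mod_cast (by omega : ⌈W * (2 + E) / η⌉₊ ≤ P)
    rw [div_le_iff₀ hη] at g1
    have g2 : (1 : ℝ) ≤ (P : ℝ) ^ (k - 1) := one_le_pow₀ hP'
    have g3 : (2 + E) * (P : ℝ) ^ (k - 1) ≤ η * (P : ℝ) ^ k / W := by
      rw [le_div_iff₀ hW', hpk]
      have := mul_le_mul_of_nonneg_right g1 (by positivity : 0 ≤ (P : ℝ) ^ (k - 1))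
      linarith
    have g4 := Nat.lt_floor_add_one (η * (P : ℝ) ^ k / W)
    rw [← hT] at g4
    linarith
  have hT0 : 0 < T := by
    have : Z ≤ T := by exact_mod_cast hZT
    omega
  refine ⟨T, hT0, hWT, ?_⟩
  set J := T / Z with hJ
  have hJZ : J * Z ≤ T := Nat.div_mul_le_self T Z
  have hJM : W * J ≤ M := by
    have g0 : (P : ℝ) ≤ 2 * (B * M) := by exact_mod_cast hPBM
    have g1 : (W : ℝ) * J * Z ≤ M * Z := by
      calc (W : ℝ) * J * Z = W * (J * Z) := by ring
        _ ≤ W * T := mul_le_mul_of_nonneg_left (by exact_mod_cast hJZ) hW'.le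
        _ ≤ η * (P : ℝ) ^ k := hWT
        _ ≤ 1 / (2 * B) * (2 * (B * M)) ^ k :=
            mul_le_mul hη1 (pow_le_pow_left₀ hP0.le g0 k) (by positivity) (by positivity)
        _ = M * (1 * 1 * (2 * (B * M)) ^ (k - 1)) := by
            obtain ⟨n, rfl⟩ : ∃ n, k = n + 1 := ⟨k - 1, by omega⟩
            rw [Nat.add_sub_cancel, pow_succ]
            field_simp
        _ ≤ M * (A * k * (2 * (B * M)) ^ (k - 1)) := by
            refine mul_le_mul_of_nonneg_left ?_ (by positivity)
            exact mul_le_mul_of_nonneg_right (mul_le_mul hA' hk' (by norm_num) (by positivity))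
              (by positivity)
        _ = M * Z := by rw [hZ]; push_cast; ring
    have g2 := le_of_mul_le_mul_right g1 (by exact_mod_cast hZ0)
    exact_mod_cast g2
  have hcount := modSol_mul_le_card k W M A J T (by omega) hW hM0 a hA.le i0 i1 h0 h1 hJM hJZ
  have hsub : ((Fintype.piFinset fun _ : ι => Finset.Icc (1 : ℤ) (B * M : ℕ)).filter fun x =>
        (W : ℤ) ∣ ∑ i, a i * x i ^ k ∧ 0 ≤ ∑ i, a i * x i ^ k ∧
          ∑ i, a i * x i ^ k < W * T) ⊆
      ((Fintype.piFinset fun _ : ι => Finset.Icc (1 : ℤ) P).filter fun x =>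
        (W : ℤ) ∣ ∑ i, a i * x i ^ k ∧ 0 ≤ ∑ i, a i * x i ^ k ∧ ∑ i, a i * x i ^ k < W * T) :=
    Finset.filter_subset_filter _ (Fintype.piFinset_subset _ _ fun _ =>
      Finset.Icc_subset_Icc_right (by exact_mod_cast hBM))
  have hcount' := hcount.trans (Finset.card_le_card hsub)
  refine le_trans ?_ (Nat.cast_le.mpr hcount')
  have hL : (P : ℝ) / (4 * B) ≤ W * (M / W : ℕ) := by
    have g1 := Nat.lt_mul_div_succ M hW
    have g2 : W * 1 ≤ W * (M / W) := Nat.mul_le_mul_left W (Nat.div_pos hWM hW)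
    have g3 : M ≤ 2 * (W * (M / W)) := by
      rw [mul_add] at g1
      omega
    have g4 : (P : ℝ) ≤ 2 * (B * M) := by exact_mod_cast hPBM
    have g5 : (M : ℝ) ≤ 2 * (W * (M / W : ℕ)) := by exact_mod_cast g3
    rw [div_le_iff₀ (by positivity)]
    nlinarith
  have hJ' : (T : ℝ) / (2 * (E * (P : ℝ) ^ (k - 1))) ≤ J := by
    have g1 := Nat.lt_mul_div_succ T hZ0
    have g2 : Z * 1 ≤ Z * J :=
      Nat.mul_le_mul_left Z (Nat.div_pos (by exact_mod_cast hZT) hZ0)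
    have g3 : T ≤ 2 * (Z * J) := by
      rw [← hJ, mul_add] at g1
      omega
    have g4 : (T : ℝ) ≤ 2 * (Z * J) := by exact_mod_cast g3
    rw [div_le_iff₀ (by positivity)]
    have := mul_le_mul_of_nonneg_right hZP (Nat.cast_nonneg (α := ℝ) J)
    linarith
  have hps : (P : ℝ) ^ s / (P : ℝ) ^ k = (P : ℝ) ^ (s - 1) / (P : ℝ) ^ (k - 1) := by
    have : (P : ℝ) ^ s = P * (P : ℝ) ^ (s - 1) := by
      rw [← pow_succ']
      congr 1
      have := Nat.one_le_two_pow (n := k)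
      omega
    rw [this, hpk, mul_div_mul_left _ _ hP0.ne']
  push_cast
  calc c0 / ((4 * B) ^ (s - 1) * (2 * E)) * (T * ((P : ℝ) ^ s / (P : ℝ) ^ k))
      = c0 * ((P : ℝ) / (4 * B)) ^ (s - 1) * ((T : ℝ) / (2 * (E * (P : ℝ) ^ (k - 1)))) := by
        rw [hps, div_pow]
        field_simp
    _ ≤ c0 * (W * (M / W : ℕ)) ^ (s - 1) * J := by
        refine mul_le_mul (mul_le_mul_of_nonneg_left ?_ hc0.le) hJ' (by positivity) (by positivity)
        exact pow_le_pow_left₀ (by positivity) hL _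
    _ = c0 * (W : ℝ) ^ (s - 1) * ((M / W : ℕ) ^ (s - 1) * J) := by
        rw [mul_pow]
        ring
    _ ≤ modSol k a W * ((M / W : ℕ) ^ (s - 1) * J) :=
        mul_le_mul_of_nonneg_right (hmod W hW) (by positivity)

lemma integral_comp_mul_int_of_periodic (g : ℝ → ℝ) (hg : Function.Periodic g 1)
    (hc : Continuous g) (n : ℤ) (hn : n ≠ 0) :
    ∫ α in (0 : ℝ)..1, g (α * n) = ∫ α in (0 : ℝ)..1, g α := by
  have hn' : (n : ℝ) ≠ 0 := by exact_mod_cast hn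
  rw [intervalIntegral.integral_comp_mul_right g hn', zero_mul, one_mul]
  have := hg.intervalIntegral_add_zsmul_eq n 0 fun _ _ => hc.intervalIntegrable _ _
  simp only [zsmul_eq_mul, mul_one, zero_add] at this
  rw [this, smul_eq_mul, ← mul_assoc, inv_mul_cancel₀ hn', one_mul]

lemma periodic_powerSum (k P : ℕ) : Function.Periodic (powerSum k P) 1 := by
  intro α
  refine Finset.sum_congr rfl fun x _ => ?_
  rw [add_mul, one_mul, unitExp_add_int]

lemma periodic_avgDefect (W : ℤ) (T : ℕ) : Function.Periodic (avgDefect W T) 1 := by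
  intro α
  simp only [avgDefect, add_mul, one_mul, unitExp_add_int]

lemma avgDefect_mul (n V : ℤ) (T : ℕ) (α : ℝ) :
    avgDefect (n * V) T α = avgDefect V T (α * n) := by
  have e : ∀ h : ℕ, α * ((n * V * h : ℤ) : ℝ) = α * n * ((V * h : ℤ) : ℝ) := fun h => by
    push_cast
    ring
  simp only [avgDefect, e]

lemma integral_powerSum_comp_mul (k P s T : ℕ) (n V : ℤ) (hn : n ≠ 0) :
    ∫ α in (0 : ℝ)..1, ‖powerSum k P (α * n)‖ ^ s * avgDefect (n * V) T α =
      ∫ α in (0 : ℝ)..1, ‖powerSum k P α‖ ^ s * avgDefect V T α := by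
  simp_rw [avgDefect_mul]
  refine integral_comp_mul_int_of_periodic (fun α => ‖powerSum k P α‖ ^ s * avgDefect V T α) ?_
    (((continuous_powerSum k P).norm.pow s).mul (continuous_avgDefect V T)) n hn
  intro α
  simp only [periodic_powerSum k P α, periodic_avgDefect V T α]

lemma prod_le_sum_pow_card {ι : Type*} [Fintype ι] [Nonempty ι] (y : ι → ℝ) (hy : ∀ i, 0 ≤ y i) :
    ∏ i, y i ≤ ∑ i, y i ^ Fintype.card ι := by
  obtain ⟨j, -, hj⟩ := Finset.exists_max_image Finset.univ y Finset.univ_nonempty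
  calc ∏ i, y i ≤ ∏ _i : ι, y j :=
        Finset.prod_le_prod (fun i _ => hy i) fun i _ => hj i (Finset.mem_univ i)
    _ = y j ^ Fintype.card ι := by rw [Finset.prod_const, Finset.card_univ]
    _ ≤ ∑ i, y i ^ Fintype.card ι :=
        Finset.single_le_sum (f := fun i => y i ^ Fintype.card ι)
          (fun i _ => pow_nonneg (hy i) _) (Finset.mem_univ j)

/-- The number of zeros of an integer-valued function compared with the average number of times it
takes values in a short arithmetic progression. -/
lemma integral_sum_mul_one_sub_avg {κ : Type*} [DecidableEq κ] (S : Finset κ) (F : κ → ℤ)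
    (W T : ℕ) (hF : ∀ x ∈ S, F x ≠ 0) :
    ∫ α in (0 : ℝ)..1, (∑ x ∈ S, unitExp (α * F x)) *
        (1 - (∑ h ∈ Finset.range T, unitExp (α * ((-(W : ℤ) * h : ℤ) : ℝ))) / T) =
      -((((S ×ˢ Finset.range T).filter fun p => F p.1 - W * p.2 = 0).card : ℂ) / T) := by
  have e : ∀ α : ℝ, (∑ x ∈ S, unitExp (α * F x)) *
        (1 - (∑ h ∈ Finset.range T, unitExp (α * ((-(W : ℤ) * h : ℤ) : ℝ))) / T) =
      (∑ x ∈ S, unitExp (α * F x)) -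
        (∑ p ∈ S ×ˢ Finset.range T, unitExp (α * ((F p.1 - W * p.2 : ℤ) : ℝ))) / T := by
    intro α
    rw [mul_sub, mul_one, ← mul_div_assoc, Finset.sum_mul_sum, ← Finset.sum_product']
    congr 2
    refine Finset.sum_congr rfl fun p _ => ?_
    rw [← unitExp_add]
    congr 1
    push_cast
    ring
  have c1 : Continuous fun α : ℝ => ∑ x ∈ S, unitExp (α * F x) :=
    continuous_finsetSum _ fun x _ => continuous_unitExp.comp (by fun_prop)
  have c2 : Continuous fun α : ℝ =>
      (∑ p ∈ S ×ˢ Finset.range T, unitExp (α * ((F p.1 - W * p.2 : ℤ) : ℝ))) / (T : ℂ) :=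
    (continuous_finsetSum _ fun x _ => continuous_unitExp.comp (by fun_prop)).div_const _
  simp_rw [e]
  rw [intervalIntegral.integral_sub (c1.intervalIntegrable 0 1) (c2.intervalIntegrable 0 1),
    intervalIntegral.integral_div, integral_sum_unitExp S F,
    integral_sum_unitExp (S ×ˢ Finset.range T) fun p => F p.1 - W * p.2,
    Finset.filter_false_of_mem hF]
  simp

theorem exists_diagonal_zero {ι : Type*} [Fintype ι] [DecidableEq ι] (k : ℕ) (hk : 2 ≤ k)
    (hs₁ : 2 ^ k + 1 ≤ Fintype.card ι) (hs₂ : 4 * k ^ 2 - 4 * k + 1 ≤ Fintype.card ι)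
    (a : ι → ℤ) (ha : ∀ i, a i ≠ 0) (i0 i1 : ι) (h0 : a i0 < 0) (h1 : 0 < a i1) :
    ∃ x : ι → ℤ, ∑ i, a i * x i ^ k = 0 ∧ ∀ i, x i ≠ 0 := by
  by_contra hno
  push Not at hno
  have : Nonempty ι := ⟨i0⟩
  obtain ⟨c, hc, η1, hη1, hcount⟩ := exists_le_card_value_dvd k hk hs₁ hs₂ a ha i0 i1 h0 h1
  set s := Fintype.card ι with hs
  have hs0 : (0 : ℝ) < s := by exact_mod_cast Fintype.card_pos
  obtain ⟨W0, hW0, η, hη, P0, hP0, hmean⟩ :=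
    exists_integral_avgDefect_le k s hk hs₁ (c / (2 * s)) (by positivity)
  set W := W0 * ∏ i, (a i).natAbs with hW
  have hWpos : 0 < W := Nat.mul_pos hW0 (Finset.prod_pos fun i _ => Int.natAbs_pos.mpr (ha i))
  obtain ⟨P1, hP1⟩ := hcount W hWpos (min η η1) (lt_min hη hη1) (min_le_right _ _)
  set P := P0 + P1 with hP
  obtain ⟨T, hT0, hWT, hcard⟩ := hP1 P (by omega)
  have hPpos : (0 : ℝ) < P := by exact_mod_cast (by omega : 0 < P)
  have hT' : (0 : ℝ) < T := by exact_mod_cast hT0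
  set Q := (P : ℝ) ^ s / (P : ℝ) ^ k with hQ
  have hQ0 : 0 < Q := by positivity
  set S := Fintype.piFinset fun _ : ι => Finset.Icc (1 : ℤ) P with hS
  set F : (ι → ℤ) → ℤ := fun x => ∑ i, a i * x i ^ k with hF
  have hF0 : ∀ x ∈ S, F x ≠ 0 := by
    intro x hx hFx
    obtain ⟨i, hi⟩ := hno x hFx
    have := Finset.mem_Icc.mp (Fintype.mem_piFinset.mp hx i)
    omega
  have hid := integral_sum_mul_one_sub_avg S F W T hF0
  set N := ((S ×ˢ Finset.range T).filter fun p => F p.1 - W * p.2 = 0).card with hN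
  have hNge : (S.filter fun x => (W : ℤ) ∣ F x ∧ 0 ≤ F x ∧ F x < W * T).card ≤ N := by
    refine Finset.card_le_card_of_injOn (fun x => (x, (F x / W).toNat)) ?_
      fun x _ y _ h => (Prod.ext_iff.mp h).1
    intro x hx
    obtain ⟨hxS, ⟨m, hm⟩, hx0, hx1⟩ := Finset.mem_filter.mp hx
    have hWz : (0 : ℤ) < W := by exact_mod_cast hWpos
    have hm0 : 0 ≤ m := by
      rw [hm] at hx0
      exact nonneg_of_mul_nonneg_right hx0 hWz
    have hm1 : m < T := by
      rw [hm] at hx1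
      exact lt_of_mul_lt_mul_left hx1 hWz.le
    have hdiv : F x / W = m := by rw [hm, Int.mul_ediv_cancel_left _ hWz.ne']
    simp only [Finset.coe_filter, Finset.mem_product, Finset.mem_range, Set.mem_ofPred_eq, hdiv]
    refine ⟨⟨hxS, by omega⟩, ?_⟩
    rw [Int.toNat_of_nonneg hm0, hm, sub_self]
  have hdvd : ∀ i, ∃ V : ℤ, -(W : ℤ) = a i * V ∧ (W0 : ℤ) ∣ V ∧ V.natAbs ≤ W := by
    intro i
    obtain ⟨m, hm⟩ : a i ∣ ((∏ i, (a i).natAbs : ℕ) : ℤ) :=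
      Int.natAbs_dvd.mp (by exact_mod_cast Finset.dvd_prod_of_mem _ (Finset.mem_univ i))
    have e : -(W : ℤ) = a i * (W0 * -m) := by
      rw [hW, Nat.cast_mul, hm]
      ring
    refine ⟨W0 * -m, e, dvd_mul_right _ _, ?_⟩
    have g := congrArg Int.natAbs e
    rw [Int.natAbs_neg, Int.natAbs_natCast, Int.natAbs_mul] at g
    rw [g]
    exact Nat.le_mul_of_pos_left _ (Int.natAbs_pos.mpr (ha i))
  have hci : ∀ i, Continuous fun α : ℝ =>
      ‖powerSum k P (α * a i)‖ ^ s * avgDefect (-(W : ℤ)) T α := fun i =>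
    (((continuous_powerSum k P).comp (by fun_prop)).norm.pow s).mul (continuous_avgDefect _ T)
  have hci' : Continuous fun α : ℝ =>
      ‖(∑ x ∈ S, unitExp (α * F x)) *
        (1 - (∑ h ∈ Finset.range T, unitExp (α * ((-(W : ℤ) * h : ℤ) : ℝ))) / T)‖ := by
    refine Continuous.norm (Continuous.mul ?_ (continuous_const.sub (Continuous.div_const ?_ _)))
    · exact continuous_finsetSum _ fun x _ => continuous_unitExp.comp (by fun_prop)
    · exact continuous_finsetSum _ fun x _ => continuous_unitExp.comp (by fun_prop)
  have hterm : ∀ i, ∫ α in (0 : ℝ)..1, ‖powerSum k P (α * a i)‖ ^ s * avgDefect (-(W : ℤ)) T α ≤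
      c / (2 * s) * Q := by
    intro i
    obtain ⟨V, hV, hV0, hVW⟩ := hdvd i
    rw [hV, integral_powerSum_comp_mul k P s T (a i) V (ha i)]
    refine hmean P (by omega) V hV0 T hT0 ?_
    calc (V.natAbs : ℝ) * T ≤ W * T :=
          mul_le_mul_of_nonneg_right (by exact_mod_cast hVW) hT'.le
      _ ≤ min η η1 * (P : ℝ) ^ k := hWT
      _ ≤ η * (P : ℝ) ^ k := mul_le_mul_of_nonneg_right (min_le_left _ _) (by positivity)
  have hle : (N : ℝ) / T ≤ c / 2 * Q := by
    calc (N : ℝ) / T = ‖-((N : ℂ) / T)‖ := by simp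
      _ ≤ ∫ α in (0 : ℝ)..1, ‖(∑ x ∈ S, unitExp (α * F x)) *
          (1 - (∑ h ∈ Finset.range T, unitExp (α * ((-(W : ℤ) * h : ℤ) : ℝ))) / T)‖ := by
          rw [← hid]
          exact intervalIntegral.norm_integral_le_integral_norm zero_le_one
      _ ≤ ∫ α in (0 : ℝ)..1, ∑ i, ‖powerSum k P (α * a i)‖ ^ s * avgDefect (-(W : ℤ)) T α := by
          refine intervalIntegral.integral_mono_on zero_le_one (hci'.intervalIntegrable 0 1)
            ((continuous_finsetSum _ fun i _ => hci i).intervalIntegrable 0 1) fun α _ => ?_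
          rw [← prod_powerSum_eq k P a α, norm_mul, norm_prod, ← Finset.sum_mul]
          exact mul_le_mul_of_nonneg_right (prod_le_sum_pow_card _ fun i => norm_nonneg _)
            (norm_nonneg _)
      _ = ∑ i, ∫ α in (0 : ℝ)..1, ‖powerSum k P (α * a i)‖ ^ s * avgDefect (-(W : ℤ)) T α :=
          intervalIntegral.integral_finsetSum fun i _ => (hci i).intervalIntegrable 0 1
      _ ≤ ∑ _i : ι, c / (2 * s) * Q := Finset.sum_le_sum fun i _ => hterm i
      _ = c / 2 * Q := by
          rw [Finset.sum_const, Finset.card_univ, nsmul_eq_mul, ← hs]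
          field_simp
  have hge : c * (T * Q) ≤ N := hcard.trans (by exact_mod_cast hNge)
  rw [div_le_iff₀ hT'] at hle
  nlinarith [mul_pos (mul_pos hc hT') hQ0]

/-- For `k ≥ 2` and `s ≥ max(2^k + 1, 4k² - 4k + 1)`, and nonzero integers
`a₁, …, a_s`, not all of the same sign if `k` is even, the equation
`a₁x₁^k + ⋯ + a_sx_s^k = 0` has a nontrivial integer solution. -/
theorem stmt7 (k s : ℕ) (hk : 2 ≤ k) (hs₁ : 2 ^ k + 1 ≤ s)
    (hs₂ : 4 * k ^ 2 - 4 * k + 1 ≤ s)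
    (a : Fin s → ℤ) (ha : ∀ i, a i ≠ 0)
    (hsign : Even k → ¬ ((∀ i, 0 < a i) ∨ (∀ i, a i < 0))) :
    ∃ x : Fin s → ℤ, (∑ i, a i * x i ^ k = 0) ∧ x ≠ 0 := by
  have hs2 : 2 ≤ s := by
    have := Nat.one_le_two_pow (n := k)
    omega
  let j0 : Fin s := ⟨0, by omega⟩
  let j1 : Fin s := ⟨1, by omega⟩
  have hj : j1 ≠ j0 := by simp [j0, j1]
  obtain ⟨u, hu, hu0, i0, i1, h0, h1⟩ : ∃ u : Fin s → ℤ, (∀ i, u i ^ k = u i) ∧ (∀ i, u i ≠ 0) ∧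
      ∃ i0 i1, a i0 * u i0 < 0 ∧ 0 < a i1 * u i1 := by
    by_cases hmix : (∀ i, 0 < a i) ∨ (∀ i, a i < 0)
    · have hodd : Odd k := Nat.not_even_iff_odd.mp fun he => hsign he hmix
      refine ⟨fun i => if i = j0 then -1 else 1, fun i => ?_, fun i => ?_, ?_⟩
      · dsimp only
        split_ifs
        · exact hodd.neg_one_pow
        · exact one_pow k
      · dsimp only
        split_ifs <;> norm_num
      · rcases hmix with h | h
        · exact ⟨j0, j1, by simpa using h j0, by simpa [hj] using h j1⟩
        · exact ⟨j1, j0, by simpa [hj] using h j1, by simpa using h j0⟩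
    · push Not at hmix
      obtain ⟨⟨i0, h0⟩, i1, h1⟩ := hmix
      exact ⟨fun _ => 1, fun _ => one_pow k, fun _ => one_ne_zero, i0, i1,
        by simpa using lt_of_le_of_ne h0 (ha i0), by simpa using lt_of_le_of_ne h1 (ha i1).symm⟩
  obtain ⟨x, hx, hx0⟩ := exists_diagonal_zero k hk (by simpa using hs₁) (by simpa using hs₂)
    (fun i => a i * u i) (fun i => mul_ne_zero (ha i) (hu0 i)) i0 i1 h0 h1
  refine ⟨fun i => u i * x i, ?_, fun h => mul_ne_zero (hu0 j0) (hx0 j0) (congrFun h j0)⟩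
  rw [← hx]
  refine Finset.sum_congr rfl fun i _ => ?_
  rw [mul_pow, hu, mul_assoc]
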